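/- arXiv:2001.05051 — 2 statements merged into one kernel-verified Lean document; each statement's English description precedes it below -/
import Mathlib

section
/- Let H be a (finite simple) graph with maximum degree at most 2, and let G be obtained from H by gluing in vertex-disjoint copies of K_4. If H contains at most one odd cycle of length exceeding 3, or if H contains at most 3 triangles, then the chromatic number of G is at most 4. -/
open SimpleGraph

/-- `G` is obtained from `H` by gluing in vertex-disjoint copies of `K₄`:
there are pairwise disjoint 4-element subsets `Y j` of the vertex set such that the
edges of `G` are the edges of `H` together with all pairs of distinct vertices lying
in a common `Y j`. -/
def GluedK4 {V : Type} [DecidableEq V] (H G : SimpleGraph V) : Prop :=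
  ∃ (q : ℕ) (Y : Fin q → Finset V),
    (∀ j, (Y j).card = 4) ∧
    (∀ i j, i ≠ j → Disjoint (Y i) (Y j)) ∧
    ∀ u v, G.Adj u v ↔ H.Adj u v ∨ (u ≠ v ∧ ∃ j, u ∈ Y j ∧ v ∈ Y j)

/-- `s` is the vertex set of a cycle subgraph of `H`.  (In a graph of maximum degree
at most 2, cycle subgraphs are in bijection with their vertex sets, and the length of
the cycle equals `s.card`.) -/
def IsCycleSet {V : Type} [DecidableEq V] (H : SimpleGraph V) (s : Finset V) : Prop :=
  ∃ (v : V) (w : H.Walk v v), w.IsCycle ∧ w.support.toFinset = s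

section ParityCount

variable {ι : Type*} [Fintype ι] [DecidableEq ι]

lemma sum_pi_eq_zero_of_sum_update_eq_zero {β M : Type*} [Fintype β] [AddCommMonoid M]
    (F : (ι → β) → M) (i : ι)
    (h : ∀ p, ∑ t, F (Function.update p i t) = 0) : ∑ p, F p = 0 := by
  classical
  rw [← (Equiv.funSplitAt i β).symm.sum_comp, Fintype.sum_prod_type_right]
  refine Finset.sum_eq_zero fun g _ => ?_
  by_cases hβ : Nonempty β
  · obtain ⟨b⟩ := hβ
    rw [← h ((Equiv.funSplitAt i β).symm (b, g))]
    refine Finset.sum_congr rfl fun t _ => congrArg F ?_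
    ext j
    by_cases hj : j = i
    · subst hj; simp [Equiv.funSplitAt, Equiv.piSplitAt]
    · simp [Equiv.funSplitAt, Equiv.piSplitAt, hj]
  · have := not_nonempty_iff.mp hβ
    simp

lemma zmod2_mul_self (a : ZMod 2) : a * a = a := by revert a; decide

lemma sum_prod_sum_eq_one (y : ι → ι → Fin 3 → Fin 3 → ZMod 2)
    (hdiag : ∀ i p, y i i p p = 1)
    (hsymm : ∀ i j p q, i ≠ j → y i j p q = y j i q p)
    (hsum : ∀ i j q, i ≠ j → ∑ p, y i j p q = 0) :
    ∑ p : ι → Fin 3, ∏ i, ∑ j, y i j (p i) (p j) = 1 := by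
  classical
  simp_rw [Finset.prod_univ_sum, Fintype.piFinset_univ]
  rw [Finset.sum_comm]
  set S : (ι → ι) → ZMod 2 := fun φ => ∑ p : ι → Fin 3, ∏ i, y i (φ i) (p i) (p (φ i)) with hS
  have hnon : ∀ φ : ι → ι, ¬ Function.Bijective φ → S φ = 0 := by
    intro φ hφ
    rw [← Finite.surjective_iff_bijective, Function.Surjective] at hφ
    push Not at hφ
    obtain ⟨i, hi⟩ := hφ
    refine sum_pi_eq_zero_of_sum_update_eq_zero _ i fun p => ?_
    have : ∀ t, ∏ k, y k (φ k) (Function.update p i t k) (Function.update p i t (φ k)) =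
        y i (φ i) t (p (φ i)) * ∏ k ∈ Finset.univ.erase i, y k (φ k) (p k) (p (φ k)) := by
      intro t
      rw [← Finset.mul_prod_erase _ _ (Finset.mem_univ i)]
      congr 1
      · simp [hi i]
      · refine Finset.prod_congr rfl fun k hk => ?_
        rw [Function.update_of_ne (Finset.ne_of_mem_erase hk), Function.update_of_ne (hi k)]
    simp_rw [this]
    rw [← Finset.sum_mul, hsum i (φ i) _ (hi i).symm, zero_mul]
  have hinvol : ∀ σ : Equiv.Perm ι, σ ≠ 1 → σ⁻¹ = σ → S σ = 0 := by
    intro σ hσ hinv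
    have hσσ : ∀ k, σ (σ k) = k := fun k => by
      simpa using congrArg (fun τ : Equiv.Perm ι => τ (σ k)) hinv.symm
    obtain ⟨i, hi⟩ : ∃ i, σ i ≠ i := by
      by_contra! hc
      exact hσ (Equiv.ext hc)
    refine sum_pi_eq_zero_of_sum_update_eq_zero _ i fun p => ?_
    have : ∀ t, ∏ k, y k (σ k) (Function.update p i t k) (Function.update p i t (σ k)) =
        y i (σ i) t (p (σ i)) *
          ∏ k ∈ (Finset.univ.erase i).erase (σ i), y k (σ k) (p k) (p (σ k)) := by
      intro t
      rw [← Finset.mul_prod_erase _ _ (Finset.mem_univ i),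
        ← Finset.mul_prod_erase _ _ (Finset.mem_erase.mpr ⟨hi, Finset.mem_univ (σ i)⟩),
        ← mul_assoc]
      congr 1
      · simp only [Function.update_self, Function.update_of_ne hi, hσσ]
        rw [hsymm (σ i) i _ _ hi, zmod2_mul_self]
      · refine Finset.prod_congr rfl fun k hk => ?_
        have h1 := Finset.ne_of_mem_erase hk
        have h2 := Finset.ne_of_mem_erase (Finset.mem_of_mem_erase hk)
        have h3 : σ k ≠ i := fun h => h1 (by rw [← h, hσσ])
        rw [Function.update_of_ne h2, Function.update_of_ne h3]
    simp_rw [this]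
    rw [← Finset.sum_mul, hsum i (σ i) _ hi.symm, zero_mul]
  have hperm : ∀ σ : Equiv.Perm ι, S (σ⁻¹ : Equiv.Perm ι) = S σ := by
    intro σ
    refine Finset.sum_congr rfl fun p _ => ?_
    rw [← Equiv.prod_comp σ]
    refine Finset.prod_congr rfl fun k _ => ?_
    by_cases hk : σ k = k
    · have hk' : σ.symm k = k := by rw [Equiv.symm_apply_eq, hk]
      simp [hk, hk']
    · simp [hsymm _ _ _ _ hk]
  have hone : S (1 : Equiv.Perm ι) = 1 := by
    have h3 : (3 : ZMod 2) = 1 := by decide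
    simp [hS, hdiag, h3]
  have hsub : ∑ φ, S φ = ∑ σ : Equiv.Perm ι, S σ := by
    symm
    refine Finset.sum_bij_ne_zero (fun σ _ _ => (σ : ι → ι)) (fun _ _ _ => Finset.mem_univ _)
      (fun σ _ _ τ _ _ h => Equiv.coe_fn_injective h) (fun φ _ h => ?_) (fun _ _ _ => rfl)
    have hb : Function.Bijective φ := by
      by_contra hb
      exact h (hnon φ hb)
    exact ⟨Equiv.ofBijective φ hb, Finset.mem_univ _, h, rfl⟩
  change ∑ φ, S φ = 1
  rw [hsub, ← Finset.add_sum_erase _ _ (Finset.mem_univ (1 : Equiv.Perm ι)), hone]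
  rw [Finset.sum_involution (fun σ _ => σ⁻¹), add_zero]
  · intro σ _
    rw [hperm]
    exact CharTwo.add_self_eq_zero _
  · intro σ hσ h0 h
    exact h0 (hinvol σ (Finset.ne_of_mem_erase hσ) h)
  · intro σ hσ
    simpa using hσ
  · intro σ _
    exact inv_inv σ

end ParityCount

section Chords

variable {ι : Type*} [Fintype ι] [DecidableEq ι]

/-- The indicator function with values in `ZMod 2`. -/
def ind (P : Prop) [Decidable P] : ZMod 2 := if P then 1 else 0

lemma sum_prod_chords_eq_one {n : ℕ} (pos : ι × Fin 3 ≃ Fin n) :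
    ∑ p : ι → Fin 3, ∏ i, ∑ j, ∑ a : Fin 3, ∑ b : Fin 3,
      ind (a ≠ p i) * ind (b ≠ p j) * ind (pos (j, b) ≤ pos (i, a)) = 1 := by
  have htot : ∀ u v, u ≠ v → ind (pos u ≤ pos v) + ind (pos v ≤ pos u) = 1 := by
    intro u v huv
    have : pos u ≠ pos v := fun h => huv (pos.injective h)
    rcases lt_or_gt_of_ne this with h | h
    · simp [ind, h.le, h.not_ge]
    · simp [ind, h.le, h.not_ge]
  refine sum_prod_sum_eq_one (fun i j p q => ∑ a : Fin 3, ∑ b : Fin 3,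
      ind (a ≠ p) * ind (b ≠ q) * ind (pos (j, b) ≤ pos (i, a))) ?_ ?_ ?_
  · intro i p
    have h01 := htot (i, 0) (i, 1) (by simp)
    have h02 := htot (i, 0) (i, 2) (by simp)
    have h12 := htot (i, 1) (i, 2) (by simp)
    have hrefl : ∀ u, ind (pos u ≤ pos u) = 1 := fun u => by simp [ind]
    have h2 : (2 : ZMod 2) = 0 := by decide
    have hT : ind True = 1 := rfl
    have hF : ind False = 0 := rfl
    fin_cases p <;> simp [Fin.sum_univ_three, hT, hF]
    · linear_combination h12 + h2
    · linear_combination h02 + h2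
    · linear_combination h01 + h2
  · intro i j p q hij
    rw [← sub_eq_zero, CharTwo.sub_eq_add]
    conv_lhs => rw [Finset.sum_comm]
    simp_rw [← Finset.sum_add_distrib]
    have : ∀ a b, ind (b ≠ p) * ind (a ≠ q) * ind (pos (j, a) ≤ pos (i, b)) +
        ind (a ≠ q) * ind (b ≠ p) * ind (pos (i, b) ≤ pos (j, a)) =
        ind (b ≠ p) * ind (a ≠ q) := by
      intro a b
      have := htot (j, a) (i, b) (by simp [hij.symm])
      linear_combination ind (b ≠ p) * ind (a ≠ q) * this
    simp_rw [this]
    clear this hij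
    revert p q; decide
  · intro i j q hij
    rw [Finset.sum_comm]
    refine Finset.sum_eq_zero fun a _ => ?_
    rw [Finset.sum_comm]
    refine Finset.sum_eq_zero fun b _ => ?_
    simp_rw [mul_assoc]
    rw [← Finset.sum_mul]
    have : ∑ p : Fin 3, ind (a ≠ p) = 0 := by revert a; decide
    rw [this, zero_mul]

lemma prod_select_eq_prod_pow {K : Type*} [CommMonoid K] (C : ℕ → K) (E : ℕ → ZMod 2)
    (h0 : E 0 = 1) (n : ℕ) :
    ∏ p ∈ Finset.range n, (if E (p + 1) = 1 then C p else C (p + 1)) =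
      (∏ p ∈ Finset.range n, C p ^ ((E (p + 1)).val + (1 + E p).val)) * C n ^ (1 + E n).val := by
  induction n with
  | zero =>
    have : (1 + 1 : ZMod 2) = 0 := by decide
    simp [h0, this]
  | succ n ih =>
    rw [Finset.prod_range_succ, ih, Finset.prod_range_succ]
    have h : ∀ z : ZMod 2, z = 0 ∨ z = 1 := by decide
    have h2 : (1 + 1 : ZMod 2) = 0 := by decide
    rcases h (E (n + 1)) with h | h
    · simp [h, ZMod.val_one, mul_comm]
    · simp [h, h2, ZMod.val_one, pow_add, mul_assoc, mul_comm]

/-- Counts, modulo two, the ways in which a triangle with edge orientations recorded by `x` (leaving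
its vertices) and `y` (entering its vertices) has one source, one sink and one neutral vertex. -/
def balanced (x y : Fin 3 → ZMod 2) : ZMod 2 :=
  ∑ p : Fin 3, (if ∀ i, x i + y i = ind (i ≠ p) then ∑ i, ind (i ≠ p) * x i else 0)

lemma balanced_eq (x y : Fin 3 → ZMod 2) :
    balanced x y =
      let a := fun i => (x i).val + (1 + y i).val
      ind (a 0 ≠ a 1 ∧ a 1 ≠ a 2 ∧ a 0 ≠ a 2) := by
  revert x y; decide

lemma sum_perm_eq_ind {K : Type*} [Field K] [Algebra (ZMod 2) K] [CharP K 2] (ω : K)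
    (hω : ω ^ 2 = ω + 1) (a : Fin 3 → ℕ) (ha : ∀ i, a i ≤ 2) :
    ∑ π : Equiv.Perm (Fin 3), ∏ i, (ω ^ (π i).val) ^ a i =
      algebraMap (ZMod 2) K (ind (a 0 ≠ a 1 ∧ a 1 ≠ a 2 ∧ a 0 ≠ a 2)) := by
  have h2 : (2 : K) = 0 := CharTwo.two_eq_zero
  have hsum : ∀ f : Equiv.Perm (Fin 3) → K, ∑ π, f π = f 1 + f (Equiv.swap 0 1) +
      f (Equiv.swap 0 2) + f (Equiv.swap 1 2) + f (Equiv.swap 0 1 * Equiv.swap 1 2) +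
      f (Equiv.swap 1 2 * Equiv.swap 0 1) := by
    intro f
    have : (Finset.univ : Finset (Equiv.Perm (Fin 3))) =
        {1, Equiv.swap 0 1, Equiv.swap 0 2, Equiv.swap 1 2, Equiv.swap 0 1 * Equiv.swap 1 2,
          Equiv.swap 1 2 * Equiv.swap 0 1} := by decide
    rw [this]
    repeat rw [Finset.sum_insert (by decide)]
    rw [Finset.sum_singleton]; ring
  rw [hsum]
  have h0 := ha 0
  have h1 := ha 1
  have h2 := ha 2
  simp only [Fin.prod_univ_three]
  generalize a 0 = r at *
  generalize a 1 = s at *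
  generalize a 2 = t at *
  interval_cases r <;> interval_cases s <;> interval_cases t <;>
    simp [ind, Equiv.swap_apply_def] <;> grind

/-- The sequence of bits starting with `1` and continuing with the values of `e`. -/
def bitSeq {n : ℕ} (e : Fin n → ZMod 2) (k : ℕ) : ZMod 2 :=
  if k = 0 then 1 else if h : k - 1 < n then e ⟨k - 1, h⟩ else 0

lemma bitSeq_succ {n : ℕ} (e : Fin n → ZMod 2) (k : Fin n) : bitSeq e (k.val + 1) = e k := by
  simp [bitSeq]

lemma sum_prod_balanced_eq_one {n : ℕ} (pos : ι × Fin 3 ≃ Fin n) :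
    ∑ e : Fin n → ZMod 2, ∏ i, balanced (fun a => bitSeq e ((pos (i, a)).val + 1))
      (fun a => bitSeq e (pos (i, a)).val) = 1 := by
  classical
  unfold balanced
  simp_rw [Finset.prod_univ_sum, Fintype.piFinset_univ]
  rw [Finset.sum_comm, ← sum_prod_chords_eq_one pos]
  refine Finset.sum_congr rfl fun p _ => ?_
  -- the only edge orientation with the prescribed neutral vertices
  set e₀ : Fin n → ZMod 2 := fun q =>
    1 + ∑ u : ι × Fin 3, ind (u.2 ≠ p u.1) * ind (pos u ≤ q) with he₀
  have hstep : ∀ u, bitSeq e₀ ((pos u).val + 1) + bitSeq e₀ (pos u).val = ind (u.2 ≠ p u.1) := by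
    intro u
    have h1 : bitSeq e₀ ((pos u).val + 1) =
        1 + ∑ v : ι × Fin 3, ind (v.2 ≠ p v.1) * ind ((pos v).val < (pos u).val + 1) := by
      rw [bitSeq_succ]
      simp only [he₀, Fin.le_def, Nat.lt_succ_iff]
    have h2 : bitSeq e₀ (pos u).val =
        1 + ∑ v : ι × Fin 3, ind (v.2 ≠ p v.1) * ind ((pos v).val < (pos u).val) := by
      unfold bitSeq
      split_ifs with h h'
      · simp [h, ind]
      · simp only [he₀, Fin.le_def]
        congr 1
        refine Finset.sum_congr rfl fun v _ => ?_
        congr 2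
        simp only [eq_iff_iff]
        omega
      · omega
    rw [h1, h2]
    have h3 : ∀ v, ind (v.2 ≠ p v.1) * ind ((pos v).val < (pos u).val + 1) =
        ind (v.2 ≠ p v.1) * ind ((pos v).val < (pos u).val) +
          if v = u then ind (u.2 ≠ p u.1) else 0 := by
      intro v
      by_cases hv : v = u
      · subst hv; simp [ind]
      · have hne : (pos v).val ≠ (pos u).val := fun h => hv (pos.injective (Fin.ext h))
        have : ((pos v).val < (pos u).val + 1) = ((pos v).val < (pos u).val) := by
          simp only [eq_iff_iff]; omega
        simp [hv, this]
    simp_rw [h3, Finset.sum_add_distrib]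
    have h4 : ∀ a b : ZMod 2, 1 + (a + b) + (1 + a) = b := by decide
    simp [h4]
  have hrec : ∀ e : Fin n → ZMod 2,
      (∀ u, bitSeq e ((pos u).val + 1) + bitSeq e (pos u).val = ind (u.2 ≠ p u.1)) → e = e₀ := by
    intro e he
    have hk : ∀ k ≤ n, bitSeq e k = bitSeq e₀ k := by
      intro k
      induction k with
      | zero => intro _; rfl
      | succ k ih =>
        intro hk
        have h1 := he (pos.symm ⟨k, hk⟩)
        have h2 := hstep (pos.symm ⟨k, hk⟩)
        simp only [Equiv.apply_symm_apply] at h1 h2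
        rw [ih (by omega)] at h1
        exact add_right_cancel (h1.trans h2.symm)
    ext q
    have := hk (q.val + 1) q.isLt
    rwa [bitSeq_succ, bitSeq_succ] at this
  rw [Finset.sum_eq_single e₀]
  · refine Finset.prod_congr rfl fun i _ => ?_
    rw [if_pos fun a => hstep (i, a)]
    have hx : ∀ a, bitSeq e₀ ((pos (i, a)).val + 1) =
        1 + ∑ j, ∑ b, ind (b ≠ p j) * ind (pos (j, b) ≤ pos (i, a)) := by
      intro a
      rw [bitSeq_succ]
      simp only [he₀, Fintype.sum_prod_type]
    simp_rw [hx, mul_add, Finset.sum_add_distrib]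
    have h0 : ∑ a : Fin 3, ind (a ≠ p i) * 1 = 0 := by
      generalize p i = q
      revert q; decide
    rw [h0, zero_add]
    simp_rw [Finset.mul_sum, mul_assoc]
    rw [Finset.sum_comm]
  · intro e _ he
    by_contra h
    refine he (hrec e fun u => ?_)
    have := Finset.prod_ne_zero_iff.mp h u.1 (Finset.mem_univ _)
    by_contra hu
    exact this (if_neg fun hall => hu (hall u.2))
  · simp

/-- **Cycle-plus-triangles theorem**, for a Hamiltonian path. -/
theorem exists_perm_coloring_of_path {n : ℕ} (pos : ι × Fin 3 ≃ Fin n) :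
    ∃ c : ι → Equiv.Perm (Fin 3), ∀ u v, (pos v).val = (pos u).val + 1 →
      c u.1 u.2 ≠ c v.1 v.2 := by
  classical
  let K := AlgebraicClosure (ZMod 2)
  have : CharP K 2 := charP_of_injective_algebraMap (algebraMap (ZMod 2) K).injective 2
  obtain ⟨ω, hω⟩ : ∃ ω : K, ω ^ 2 = ω + 1 := by
    obtain ⟨ω, h⟩ := IsAlgClosed.exists_eval₂_eq_zero (RingHom.id K)
      (Polynomial.X ^ 2 + Polynomial.X + 1 : Polynomial K) (by
        have : (Polynomial.X ^ 2 + Polynomial.X + 1 : Polynomial K).degree = 2 := by compute_degree!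
        rw [this]; decide)
    refine ⟨ω, ?_⟩
    have h2 : (2 : K) = 0 := CharTwo.two_eq_zero
    simp at h
    linear_combination h - (ω + 1) * h2
  let C : (ι → Equiv.Perm (Fin 3)) → ℕ → K := fun c k =>
    if h : k < n then ω ^ (c (pos.symm ⟨k, h⟩).1 (pos.symm ⟨k, h⟩).2).val else 1
  have hC : ∀ c u, C c (pos u).val = ω ^ (c u.1 u.2).val := fun c u => by simp [C]
  have hCn : ∀ c, C c n = 1 := fun c => by simp [C]
  have hexpand : ∀ c, ∏ k ∈ Finset.range n, (C c k + C c (k + 1)) =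
      ∑ e : Fin n → ZMod 2, ∏ i, ∏ a, (ω ^ (c i a).val) ^
        ((bitSeq e ((pos (i, a)).val + 1)).val + (1 + bitSeq e (pos (i, a)).val).val) := by
    intro c
    have h1 : ∀ k, C c k + C c (k + 1) = ∑ b : ZMod 2, if b = 1 then C c k else C c (k + 1) := by
      intro k
      rw [show (Finset.univ : Finset (ZMod 2)) = {1, 0} from by decide, Finset.sum_pair (by decide)]
      simp
    simp_rw [h1]
    rw [← Fin.prod_univ_eq_prod_range
      (fun k => ∑ b : ZMod 2, if b = 1 then C c k else C c (k + 1)), Finset.prod_univ_sum,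
      Fintype.piFinset_univ]
    refine Finset.sum_congr rfl fun e _ => ?_
    have h2 := prod_select_eq_prod_pow (C c) (bitSeq e) (by simp [bitSeq]) n
    rw [hCn, one_pow, mul_one, ← Fin.prod_univ_eq_prod_range
      (fun k => if bitSeq e (k + 1) = 1 then C c k else C c (k + 1)), 
      ← Fin.prod_univ_eq_prod_range
      (fun k => C c k ^ ((bitSeq e (k + 1)).val + (1 + bitSeq e k).val)),
      ← pos.prod_comp (fun k : Fin n =>
        C c k ^ ((bitSeq e (k.val + 1)).val + (1 + bitSeq e k.val).val)),
      Fintype.prod_prod_type] at h2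
    simp_rw [hC] at h2
    rw [← h2]
    refine Finset.prod_congr rfl fun k _ => ?_
    rw [bitSeq_succ]
  have hle : ∀ x y : ZMod 2, x.val + (1 + y).val ≤ 2 := by decide
  have hZ : ∑ c : ι → Equiv.Perm (Fin 3), ∏ k ∈ Finset.range n, (C c k + C c (k + 1)) = 1 := by
    simp_rw [hexpand]
    rw [Finset.sum_comm]
    have h1 : ∀ e : Fin n → ZMod 2, ∑ c : ι → Equiv.Perm (Fin 3), ∏ i, ∏ a, (ω ^ (c i a).val) ^
        ((bitSeq e ((pos (i, a)).val + 1)).val + (1 + bitSeq e (pos (i, a)).val).val) =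
        algebraMap (ZMod 2) K (∏ i, balanced (fun a => bitSeq e ((pos (i, a)).val + 1))
          (fun a => bitSeq e (pos (i, a)).val)) := by
      intro e
      rw [map_prod]
      simp_rw [balanced_eq]
      have := fun i => sum_perm_eq_ind ω hω (fun a =>
        (bitSeq e ((pos (i, a)).val + 1)).val + (1 + bitSeq e (pos (i, a)).val).val)
        fun a => hle _ _
      simp_rw [← this, Finset.prod_univ_sum, Fintype.piFinset_univ]
    simp_rw [h1]
    rw [← map_sum, sum_prod_balanced_eq_one, map_one]
  obtain ⟨c, -, hc⟩ := Finset.exists_ne_zero_of_sum_ne_zero (hZ.trans_ne one_ne_zero)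
  refine ⟨c, fun u v huv heq => ?_⟩
  refine Finset.prod_ne_zero_iff.mp hc (pos u).val (by simp) ?_
  rw [← huv, hC, hC, heq]
  exact CharTwo.add_self_eq_zero _

end Chords

section Transversal

/-- Every vertex has at most two neighbours. -/
def DegLETwo {V : Type*} (H : SimpleGraph V) : Prop :=
  ∀ v a b c, H.Adj v a → H.Adj v b → H.Adj v c → a = b ∨ a = c ∨ b = c

/-- Every vertex of `T` has two neighbours in `T`. -/
def IsCore {V : Type*} (H : SimpleGraph V) (T : Finset V) : Prop :=
  ∀ v ∈ T, ∃ a ∈ T, ∃ b ∈ T, a ≠ b ∧ H.Adj v a ∧ H.Adj v b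

lemma exists_int_arrangement {V : Type*} [DecidableEq V] {H : SimpleGraph V} (hH : DegLETwo H)
    (S : Finset V) (hS : ∀ T ⊆ S, IsCore H T → T = ∅) :
    ∃ f : V → ℤ, Set.InjOn f S ∧
      ∀ a ∈ S, ∀ b ∈ S, H.Adj a b → ∀ w ∈ S, ¬ (f a < f w ∧ f w < f b) := by
  induction S using Finset.strongInduction with
  | H S ih =>
  rcases S.eq_empty_or_nonempty with rfl | hne
  · exact ⟨fun _ => 0, by simp, by simp⟩
  have hcore : ¬ IsCore H S := fun h => hne.ne_empty (hS S subset_rfl h)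
  obtain ⟨v, hv, hleaf⟩ : ∃ v ∈ S, ∀ a ∈ S, ∀ b ∈ S, H.Adj v a → H.Adj v b → a = b := by
    by_contra! hc
    refine hcore fun v hv => ?_
    obtain ⟨a, ha, b, hb, h1, h2, h3⟩ := hc v hv
    exact ⟨a, ha, b, hb, h3, h1, h2⟩
  obtain ⟨f, hinj, hf⟩ := ih (S.erase v) (Finset.erase_ssubset hv)
    fun T hT => hS T (hT.trans (Finset.erase_subset _ _))
  have hf' : ∀ a ∈ S, a ≠ v → ∀ b ∈ S, b ≠ v → H.Adj a b → ∀ w ∈ S, w ≠ v →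
      ¬ (f a < f w ∧ f w < f b) := fun a ha hav b hb hbv hab w hw hwv =>
    hf a (Finset.mem_erase.mpr ⟨hav, ha⟩) b (Finset.mem_erase.mpr ⟨hbv, hb⟩) hab w
      (Finset.mem_erase.mpr ⟨hwv, hw⟩)
  have hinj' : ∀ a ∈ S, a ≠ v → ∀ b ∈ S, b ≠ v → f a = f b → a = b :=
    fun a ha hav b hb hbv h => hinj (by simp [ha, hav]) (by simp [hb, hbv]) h
  by_cases hu : ∃ u ∈ S, H.Adj v u
  · obtain ⟨u, huS, huv⟩ := hu
    have huv' : u ≠ v := huv.ne'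
    obtain ⟨ε, hε, hε1, hε2⟩ : ∃ ε : ℤ, (ε = 1 ∨ ε = -1) ∧
        (ε = 1 → ∀ w ∈ S, w ≠ v → H.Adj u w → f w ≤ f u) ∧
        (ε = -1 → ∀ w ∈ S, w ≠ v → H.Adj u w → f u ≤ f w) := by
      by_cases h : ∀ w ∈ S, w ≠ v → H.Adj u w → f w ≤ f u
      · exact ⟨1, Or.inl rfl, fun _ => h, fun h => by omega⟩
      · push Not at h
        obtain ⟨w, hw, hwv, hadj, hlt⟩ := h
        refine ⟨-1, Or.inr rfl, fun h => by omega, fun _ z hz hzv hz' => ?_⟩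
        rcases hH u v w z huv.symm hadj hz' with h | h | h
        · exact absurd h.symm hwv
        · exact absurd h.symm hzv
        · exact h ▸ hlt.le
    have hval : ∀ w, w ≠ v → Function.update (fun w => 2 * f w) v (2 * f u + ε) w = 2 * f w :=
      fun w hw => Function.update_of_ne hw _ _
    refine ⟨Function.update (fun w => 2 * f w) v (2 * f u + ε), ?_, ?_⟩
    · intro a ha b hb hab
      by_cases hav : a = v <;> by_cases hbv : b = v
      · rw [hav, hbv]
      · rw [hval b hbv, hav, Function.update_self] at hab; omega
      · rw [hval a hav, hbv, Function.update_self] at hab; omega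
      · rw [hval a hav, hval b hbv] at hab
        exact hinj' a ha hav b hb hbv (by omega)
    · intro a ha b hb hab w hw
      by_cases hav : a = v
      · subst hav
        obtain rfl : b = u := hleaf b hb u huS hab huv
        rw [hval b huv', Function.update_self]
        by_cases hwv : w = a
        · subst hwv; simp
        · rw [hval w hwv]; omega
      by_cases hbv : b = v
      · subst hbv
        obtain rfl : a = u := hleaf a ha u huS hab.symm huv
        rw [hval a huv', Function.update_self]
        by_cases hwv : w = b
        · subst hwv; simp
        · rw [hval w hwv]; omega
      rw [hval a hav, hval b hbv]
      by_cases hwv : w = v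
      · subst hwv
        rw [Function.update_self]
        rintro ⟨h1, h2⟩
        have h3 := hf' a ha hav b hb hbv hab u huS huv'
        rcases hε with rfl | rfl
        · by_cases hau : a = u
          · subst hau
            have := hε1 rfl b hb hbv hab
            omega
          · have : f a ≠ f u := fun h => hau (hinj' a ha hav u huS huv' h)
            omega
        · by_cases hbu : b = u
          · subst hbu
            have := hε2 rfl a ha hav hab.symm
            omega
          · have : f b ≠ f u := fun h => hbu (hinj' b hb hbv u huS huv' h)
            omega
      · rw [hval w hwv]
        have := hf' a ha hav b hb hbv hab w hw hwv
        omega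
  · push Not at hu
    obtain ⟨N, hN⟩ : ∃ N : ℤ, ∀ w ∈ S, f w < N := by
      obtain ⟨N, hN⟩ := (S.image f).exists_le
      exact ⟨N + 1, fun w hw => Int.lt_add_one_of_le (hN _ (Finset.mem_image_of_mem f hw))⟩
    have hval : ∀ w, w ≠ v → Function.update f v N w = f w :=
      fun w hw => Function.update_of_ne hw _ _
    refine ⟨Function.update f v N, ?_, ?_⟩
    · intro a ha b hb hab
      by_cases hav : a = v <;> by_cases hbv : b = v
      · rw [hav, hbv]
      · rw [hval b hbv, hav, Function.update_self] at hab; have := hN b hb; omega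
      · rw [hval a hav, hbv, Function.update_self] at hab; have := hN a ha; omega
      · rw [hval a hav, hval b hbv] at hab
        exact hinj' a ha hav b hb hbv hab
    · intro a ha b hb hab w hw
      have hav : a ≠ v := by rintro rfl; exact hu b hb hab
      have hbv : b ≠ v := by rintro rfl; exact hu a ha hab.symm
      rw [hval a hav, hval b hbv]
      by_cases hwv : w = v
      · subst hwv
        have := hN b hb
        rw [Function.update_self]; omega
      · rw [hval w hwv]; exact hf' a ha hav b hb hbv hab w hw hwv

lemma exists_consecutive_arrangement {V : Type*} [Fintype V] {H : SimpleGraph V} (hH : DegLETwo H)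
    (hS : ∀ T, IsCore H T → T = ∅) :
    ∃ pos : V ≃ Fin (Fintype.card V), ∀ a b, H.Adj a b →
      (pos b).val = (pos a).val + 1 ∨ (pos a).val = (pos b).val + 1 := by
  classical
  obtain ⟨f, hinj, hf⟩ := exists_int_arrangement hH Finset.univ fun T _ => hS T
  have hinj' : Function.Injective f := by simpa [Set.injOn_univ] using hinj
  let : LinearOrder V := LinearOrder.lift' f hinj'
  let e : Fin (Fintype.card V) ≃o V := Fintype.orderIsoFinOfCardEq V rfl
  have key : ∀ a b, H.Adj a b → a < b → (e.symm b).val = (e.symm a).val + 1 := by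
    intro a b hab hlt
    have h1 : e.symm a < e.symm b := e.symm.lt_iff_lt.mpr hlt
    have h2 : (e.symm a).val < (e.symm b).val := h1
    by_contra hne
    have h3 : (e.symm a).val + 1 < (e.symm b).val := by omega
    have h4 := (e.symm b).isLt
    let k : Fin (Fintype.card V) := ⟨(e.symm a).val + 1, by omega⟩
    refine hf a (Finset.mem_univ _) b (Finset.mem_univ _) hab (e k) (Finset.mem_univ _) ⟨?_, ?_⟩
    · have : a < e k := by
        rw [← e.symm.lt_iff_lt, OrderIso.symm_apply_apply]
        exact Nat.lt_succ_self _
      exact this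
    · have : e k < b := by
        rw [← e.symm.lt_iff_lt, OrderIso.symm_apply_apply]
        exact h3
      exact this
  refine ⟨e.symm.toEquiv, fun a b hab => ?_⟩
  rcases lt_or_gt_of_ne hab.ne with h | h
  · exact Or.inl (key a b hab h)
  · exact Or.inr (key b a hab.symm h)

variable {ι : Type*} [Fintype ι] [DecidableEq ι]

lemma exists_perm_coloring_of_avoid {H : SimpleGraph (ι × Fin 4)} (hH : DegLETwo H) (D : ι → Fin 4)
    (hD : ∀ T, IsCore H T → T.Nonempty → ∃ i, (i, D i) ∈ T) :
    ∃ c : ι → Equiv.Perm (Fin 3), ∀ u v : ι × Fin 3,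
      H.Adj (u.1, (D u.1).succAbove u.2) (v.1, (D v.1).succAbove v.2) → c u.1 u.2 ≠ c v.1 v.2 := by
  classical
  let φ : ι × Fin 3 ↪ ι × Fin 4 := ⟨fun u => (u.1, (D u.1).succAbove u.2), by
    rintro ⟨i, a⟩ ⟨j, b⟩ h
    simp only [Prod.mk.injEq] at h
    obtain ⟨rfl, h⟩ := h
    simpa using h⟩
  obtain ⟨pos, hpos⟩ := exists_consecutive_arrangement (H := H.comap φ)
    (fun v a b c ha hb hc => by
      simpa using hH (φ v) (φ a) (φ b) (φ c) ha hb hc)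
    (fun T hT => by
      by_contra hne
      obtain ⟨i, hi⟩ := hD (T.map φ) (fun v hv => by
        obtain ⟨v, hvT, rfl⟩ := Finset.mem_map.mp hv
        obtain ⟨a, ha, b, hb, hab, h1, h2⟩ := hT v hvT
        exact ⟨φ a, Finset.mem_map_of_mem _ ha, φ b, Finset.mem_map_of_mem _ hb,
          fun h => hab (φ.injective h), h1, h2⟩)
        ((Finset.nonempty_iff_ne_empty.mpr hne).map)
      obtain ⟨⟨j, a⟩, -, h⟩ := Finset.mem_map.mp hi
      have h1 : j = i := congrArg Prod.fst h
      have h2 : (D j).succAbove a = D i := congrArg Prod.snd h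
      rw [h1] at h2
      exact Fin.succAbove_ne _ _ h2)
  obtain ⟨c, hc⟩ := exists_perm_coloring_of_path pos
  refine ⟨c, fun u v huv => ?_⟩
  rcases hpos u v huv with h | h
  · exact hc u v h
  · exact (hc v u h).symm

omit [Fintype ι] in
lemma exists_distinct_representatives (𝒞 : Finset (Finset (ι × Fin 4)))
    (hdisj : ∀ C ∈ 𝒞, ∀ C' ∈ 𝒞, ∀ v, v ∈ C → v ∈ C' → C = C')
    (hcard : ∀ C ∈ 𝒞, 3 ≤ C.card) (hthree : (𝒞.filter (·.card = 3)).card ≤ 3) :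
    ∃ g : 𝒞 → ι × Fin 4, (∀ C, g C ∈ C.1) ∧ Function.Injective fun C => (g C).1 := by
  classical
  have hall : ∀ A : Finset 𝒞, A.card ≤ (A.biUnion fun C => C.1.image Prod.fst).card := by
    intro A
    have h1 : (A.biUnion fun C => C.1).card = ∑ C ∈ A, C.1.card := by
      refine Finset.card_biUnion fun C _ C' _ hne => ?_
      refine Finset.disjoint_left.mpr fun v hv hv' => ?_
      exact hne (Subtype.ext (hdisj _ C.2 _ C'.2 v hv hv'))
    have h2 : (A.biUnion fun C => C.1) ⊆
        (A.biUnion fun C => C.1.image Prod.fst) ×ˢ (Finset.univ : Finset (Fin 4)) := by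
      intro v hv
      obtain ⟨C, hC, hv⟩ := Finset.mem_biUnion.mp hv
      exact Finset.mem_product.mpr ⟨Finset.mem_biUnion.mpr ⟨C, hC, Finset.mem_image_of_mem _ hv⟩,
        Finset.mem_univ _⟩
    have h3 := Finset.card_le_card h2
    rw [h1, Finset.card_product, Finset.card_univ, Fintype.card_fin] at h3
    have h4 : (A.filter fun C => C.1.card = 3).card ≤ 3 := by
      refine le_trans ?_ hthree
      refine Finset.card_le_card_of_injOn (fun C => C.1) (fun C hC => ?_)
        (Subtype.val_injective.injOn)
      have := (Finset.mem_filter.mp hC).2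
      exact Finset.mem_coe.mpr (Finset.mem_filter.mpr ⟨C.2, this⟩)
    have h5 : 4 * A.card ≤ ∑ C ∈ A, C.1.card + (A.filter fun C => C.1.card = 3).card := by
      rw [Finset.card_filter, ← Finset.sum_add_distrib, mul_comm, ← smul_eq_mul]
      refine Finset.card_nsmul_le_sum _ _ _ fun C _ => ?_
      have := hcard _ C.2
      split_ifs <;> omega
    omega
  obtain ⟨t, hinj, ht⟩ := (Finset.all_card_le_biUnion_card_iff_exists_injective _).mp hall
  have : ∀ C : 𝒞, ∃ v ∈ C.1, v.1 = t C := fun C => by simpa using ht C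
  choose g hg hgt using this
  exact ⟨g, hg, by simpa only [hgt] using hinj⟩

lemma exists_hitting_transversal {H : SimpleGraph (ι × Fin 4)} (𝒞 : Finset (Finset (ι × Fin 4)))
    (hclosed : ∀ C ∈ 𝒞, ∀ u ∈ C, ∀ v, H.Adj u v → v ∈ C)
    (hdisj : ∀ C ∈ 𝒞, ∀ C' ∈ 𝒞, ∀ v, v ∈ C → v ∈ C' → C = C')
    (g : 𝒞 → ι × Fin 4) (hg : ∀ C, g C ∈ C.1) (hinj : Function.Injective fun C => (g C).1)
    (hindep : ∃ J : ι → Fin 4, ∀ i j, ¬ H.Adj (i, J i) (j, J j)) :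
    ∃ J : ι → Fin 4, (∀ i j, ¬ H.Adj (i, J i) (j, J j)) ∧ ∀ C ∈ 𝒞, ∃ i, (i, J i) ∈ C := by
  classical
  let hit : (ι → Fin 4) → Finset 𝒞 := fun J => Finset.univ.filter fun C => ∃ i, (i, J i) ∈ C.1
  let agree : (ι → Fin 4) → Finset 𝒞 := fun J => Finset.univ.filter fun C => J (g C).1 = (g C).2
  obtain ⟨J₀, hJ₀⟩ := hindep
  obtain ⟨J, hJ, hmax⟩ := Finset.exists_max_image
    (Finset.univ.filter fun J : ι → Fin 4 => ∀ i j, ¬ H.Adj (i, J i) (j, J j))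
    (fun J => (hit J).card + (agree J).card) ⟨J₀, by simpa using hJ₀⟩
  have hJ := (Finset.mem_filter.mp hJ).2
  refine ⟨J, hJ, fun C hC => ?_⟩
  by_contra hmiss
  push Not at hmiss
  set C₀ : 𝒞 := ⟨C, hC⟩ with hC₀
  obtain ⟨k, a, hka⟩ : ∃ k a, g C₀ = (k, a) := ⟨_, _, rfl⟩
  have hkC : (k, a) ∈ C := hka ▸ hg C₀
  have hself : ∀ i, Function.update J k a i ≠ J i → i = k := fun i hi => by
    by_contra h
    exact hi (Function.update_of_ne h _ _)
  have hJ' : ∀ i j, ¬ H.Adj (i, Function.update J k a i) (j, Function.update J k a j) := by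
    intro i j
    by_cases hi : i = k <;> by_cases hj : j = k
    · subst hi; subst hj; exact H.irrefl
    · subst hi
      rw [Function.update_self, Function.update_of_ne hj]
      exact fun h => hmiss j (hclosed C hC _ hkC _ h)
    · subst hj
      rw [Function.update_self, Function.update_of_ne hi]
      exact fun h => hmiss i (hclosed C hC _ hkC _ h.symm)
    · rw [Function.update_of_ne hi, Function.update_of_ne hj]
      exact hJ i j
  have hle := hmax (Function.update J k a) (Finset.mem_filter.mpr ⟨Finset.mem_univ _, hJ'⟩)
  have hhit : (hit J).card ≤ (hit (Function.update J k a)).card := by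
    by_cases hlost : ∃ C' : 𝒞, (k, J k) ∈ C'.1
    · obtain ⟨C', hC'⟩ := hlost
      have hsub : (insert C₀ ((hit J).erase C')) ⊆ hit (Function.update J k a) := by
        intro D hD
        rcases Finset.mem_insert.mp hD with rfl | hD
        · exact Finset.mem_filter.mpr ⟨Finset.mem_univ _, k, by simpa using hkC⟩
        · obtain ⟨hne, hD⟩ := Finset.mem_erase.mp hD
          obtain ⟨i, hi⟩ := (Finset.mem_filter.mp hD).2
          have hik : i ≠ k := by
            rintro rfl
            exact hne (Subtype.ext (hdisj _ D.2 _ C'.2 _ hi hC'))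
          exact Finset.mem_filter.mpr ⟨Finset.mem_univ _, i, by
            rwa [Function.update_of_ne hik]⟩
      have h1 := Finset.card_le_card hsub
      rw [Finset.card_insert_of_notMem (fun h => by
        obtain ⟨i, hi⟩ := (Finset.mem_filter.mp (Finset.mem_of_mem_erase h)).2
        exact hmiss i hi)] at h1
      have := Finset.pred_card_le_card_erase (s := hit J) (a := C')
      omega
    · refine Finset.card_le_card fun D hD => ?_
      obtain ⟨i, hi⟩ := (Finset.mem_filter.mp hD).2
      have hik : i ≠ k := by
        rintro rfl
        exact hlost ⟨D, hi⟩
      exact Finset.mem_filter.mpr ⟨Finset.mem_univ _, i, by rwa [Function.update_of_ne hik]⟩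
  have hagree : (agree J).card < (agree (Function.update J k a)).card := by
    refine Finset.card_lt_card (Finset.ssubset_iff.mpr ⟨C₀, ?_, ?_⟩)
    · intro h
      have h1 := (Finset.mem_filter.mp h).2
      rw [hka] at h1
      exact hmiss k (by rw [h1]; exact hkC)
    · intro D hD
      rcases Finset.mem_insert.mp hD with rfl | hD
      · exact Finset.mem_filter.mpr ⟨Finset.mem_univ _, by simp [hka]⟩
      · have h1 := (Finset.mem_filter.mp hD).2
        refine Finset.mem_filter.mpr ⟨Finset.mem_univ _, ?_⟩
        by_cases hk : (g D).1 = k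
        · obtain rfl : D = C₀ := hinj (by simp [hk, hka])
          simp [hka]
        · rw [Function.update_of_ne hk, h1]
  omega

theorem exists_coloring_of_few_triangles {H : SimpleGraph (ι × Fin 4)} (hH : DegLETwo H)
    (𝒞 : Finset (Finset (ι × Fin 4)))
    (hclosed : ∀ C ∈ 𝒞, ∀ u ∈ C, ∀ v, H.Adj u v → v ∈ C)
    (hdisj : ∀ C ∈ 𝒞, ∀ C' ∈ 𝒞, ∀ v, v ∈ C → v ∈ C' → C = C')
    (hcore : ∀ T, IsCore H T → T.Nonempty → ∃ C ∈ 𝒞, C ⊆ T)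
    (hcard : ∀ C ∈ 𝒞, 3 ≤ C.card) (hthree : (𝒞.filter (·.card = 3)).card ≤ 3) :
    ∃ c : ι × Fin 4 → Fin 4, (∀ u v, H.Adj u v → c u ≠ c v) ∧
      ∀ i a b, a ≠ b → c (i, a) ≠ c (i, b) := by
  classical
  obtain ⟨g, hg, hinj⟩ := exists_distinct_representatives 𝒞 hdisj hcard hthree
  obtain ⟨D, hD⟩ : ∃ D : ι → Fin 4, ∀ C, D (g C).1 = (g C).2 := by
    refine ⟨fun i => if h : ∃ C, (g C).1 = i then (g h.choose).2 else 0, fun C => ?_⟩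
    have h : ∃ C', (g C').1 = (g C).1 := ⟨C, rfl⟩
    dsimp only
    rw [dif_pos h, hinj h.choose_spec]
  have hindep : ∃ J : ι → Fin 4, ∀ i j, ¬ H.Adj (i, J i) (j, J j) := by
    obtain ⟨c, hc⟩ := exists_perm_coloring_of_avoid hH D (fun T hT hne => by
      obtain ⟨C, hC, hCT⟩ := hcore T hT hne
      exact ⟨(g ⟨C, hC⟩).1, by rw [hD]; exact hCT (hg _)⟩)
    refine ⟨fun i => (D i).succAbove ((c i).symm 0), fun i j h => ?_⟩
    exact hc (i, (c i).symm 0) (j, (c j).symm 0) h (by simp)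
  obtain ⟨J, hJ, hhit⟩ := exists_hitting_transversal 𝒞 hclosed hdisj g hg hinj hindep
  obtain ⟨c, hc⟩ := exists_perm_coloring_of_avoid hH J (fun T hT hne => by
    obtain ⟨C, hC, hCT⟩ := hcore T hT hne
    obtain ⟨i, hi⟩ := hhit C hC
    exact ⟨i, hCT hi⟩)
  let col : ι × Fin 4 → Fin 4 := fun u =>
    ((J u.1).insertNth 3 fun a => (c u.1 a).castSucc : Fin 4 → Fin 4) u.2
  have hcol : ∀ i, col (i, J i) = 3 := fun i => by simp [col]
  have hcol' : ∀ i a, col (i, (J i).succAbove a) = (c i a).castSucc := fun i a => by simp [col]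
  have hlast : ∀ x : Fin 3, x.castSucc ≠ (3 : Fin 4) := by decide
  refine ⟨col, ?_, ?_⟩
  · rintro ⟨i, a⟩ ⟨j, b⟩ h
    rcases Fin.eq_self_or_eq_succAbove (J i) a with rfl | ⟨a, rfl⟩ <;>
    rcases Fin.eq_self_or_eq_succAbove (J j) b with rfl | ⟨b, rfl⟩
    · exact absurd h (hJ i j)
    · rw [hcol, hcol']; exact (hlast _).symm
    · rw [hcol, hcol']; exact hlast _
    · rw [hcol', hcol']
      exact fun heq => hc (i, a) (j, b) h (Fin.castSucc_injective _ heq)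
  · intro i a b hab
    rcases Fin.eq_self_or_eq_succAbove (J i) a with rfl | ⟨a, rfl⟩ <;>
    rcases Fin.eq_self_or_eq_succAbove (J i) b with rfl | ⟨b, rfl⟩
    · exact absurd rfl hab
    · rw [hcol, hcol']; exact (hlast _).symm
    · rw [hcol, hcol']; exact hlast _
    · rw [hcol', hcol']
      exact fun heq => hab (by rw [(c i).injective (Fin.castSucc_injective _ heq)])

end Transversal

section Matchings

lemma exists_involution_of_unique {V : Type*} (R : V → V → Prop) (hsymm : ∀ x y, R x y → R y x)
    (huniq : ∀ x y z, R x y → R x z → y = z) :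
    ∃ m : V → V, (∀ x, m (m x) = x) ∧ (∀ x y, R x y → m x = y) ∧ ∀ x, m x ≠ x → R x (m x) := by
  classical
  obtain ⟨m, hm, hm'⟩ : ∃ m : V → V, (∀ x y, R x y → m x = y) ∧ ∀ x, (¬ ∃ y, R x y) → m x = x := by
    refine ⟨fun x => if h : ∃ y, R x y then h.choose else x, fun x y hxy => ?_,
      fun x h => dif_neg h⟩
    have h : ∃ y, R x y := ⟨y, hxy⟩
    dsimp only
    rw [dif_pos h]
    exact huniq x _ _ h.choose_spec hxy
  refine ⟨m, fun x => ?_, hm, fun x hx => ?_⟩ <;> by_cases h : ∃ y, R x y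
  · obtain ⟨y, hy⟩ := h
    rw [hm x y hy]
    exact hm y x (hsymm x y hy)
  · rw [hm' x h, hm' x h]
  · obtain ⟨y, hy⟩ := h
    rwa [hm x y hy]
  · exact absurd (hm' x h) hx

variable {V : Type*} [Fintype V] [DecidableEq V]

lemma exists_bool_coloring_extending (n : V → V) (hn : ∀ x, n (n x) = x) (C : Finset V)
    (χ : V → Bool) (hχ : ∀ x ∈ C, n x ∈ C → n x ≠ x → χ (n x) ≠ χ x) :
    ∃ χ' : V → Bool, (∀ x ∈ C, χ' x = χ x) ∧ ∀ x, n x ≠ x → χ' (n x) ≠ χ' x := by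
  let e := Fintype.equivFin V
  refine ⟨fun x => if x ∈ C then χ x else if n x ∈ C then !χ (n x) else decide (e x < e (n x)),
    fun x hx => by simp [hx], fun x hx => ?_⟩
  have hne : e x ≠ e (n x) := fun h => hx (e.injective h).symm
  by_cases h1 : x ∈ C <;> by_cases h2 : n x ∈ C
  · simpa [h1, h2] using hχ x h1 h2 hx
  · simp [h1, h2, hn]
  · simp [h1, h2]
  · simp only [h1, h2, hn, if_false]
    rcases lt_or_gt_of_ne hne with h | h
    · simp [h, h.le]
    · simp [h, h.le]

/-- Contracting the alternating paths of two partial matchings, given as involutions, onto a set `C`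
avoided by one of them. -/
lemma exists_contracted_involution (C : Finset V) (k : ℕ) (n m : V → V) (hn : ∀ x, n (n x) = x)
    (hm : ∀ x, m (m x) = x) (hC : ∀ x ∈ C, m x = x)
    (hk : (Finset.univ.filter fun x => m x ≠ x).card ≤ k) :
    ∃ n' : V → V, (∀ x, n' (n' x) = x) ∧ (∀ x ∈ C, n' x ∈ C) ∧
      ∀ χ : V → Bool, (∀ x ∈ C, n' x ≠ x → χ (n' x) ≠ χ x) →
        ∃ χ' : V → Bool, (∀ x ∈ C, χ' x = χ x) ∧ (∀ x, n x ≠ x → χ' (n x) ≠ χ' x) ∧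
          ∀ x, m x ≠ x → χ' (m x) ≠ χ' x := by
  induction k generalizing n m with
  | zero =>
    have hm0 : ∀ x, m x = x := by
      simpa [Finset.filter_eq_empty_iff] using hk
    refine ⟨fun x => if x ∈ C ∧ n x ∈ C then n x else x, fun x => ?_, fun x hx => ?_,
      fun χ hχ => ?_⟩
    · by_cases h : x ∈ C ∧ n x ∈ C
      · simp [h, hn]
      · simp [h]
    · dsimp only
      split_ifs with h
      · exact h.2
      · exact hx
    · obtain ⟨χ', h1, h2⟩ := exists_bool_coloring_extending n hn C χ
        (fun x hx hnx hne => by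
          have := hχ x hx
          simp only [hx, hnx, and_self, if_true] at this
          exact this hne)
      exact ⟨χ', h1, h2, fun x hx => absurd (hm0 x) hx⟩
  | succ k ih =>
    by_cases h0 : ∀ x, m x = x
    · exact ih n m hn hm hC (by simp [h0])
    push Not at h0
    obtain ⟨a, ha⟩ := h0
    obtain ⟨b, hab⟩ : ∃ b, m a = b := ⟨_, rfl⟩
    have hba : m b = a := by rw [← hab, hm]
    have hne : a ≠ b := fun h => ha (hab.trans h.symm)
    have haC : a ∉ C := fun h => ha (hC a h)
    have hbC : b ∉ C := fun h => hne ((hC b h).symm.trans hba).symm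
    let n₁ : V → V := fun x => if x = a ∨ x = b then x else
      if n x = a then (if n b = b then x else n b) else
      if n x = b then (if n a = a then x else n a) else n x
    let m₁ : V → V := fun x => if x = a ∨ x = b then x else m x
    have hn₁ : ∀ x, n₁ (n₁ x) = x := by intro x; simp only [n₁]; grind
    have hm₁ : ∀ x, m₁ (m₁ x) = x := by intro x; simp only [m₁]; grind
    obtain ⟨n', h1, h2, h3⟩ := ih n₁ m₁ hn₁ hm₁ (fun x hx => by simp [m₁, hC x hx]) (by
      have : (Finset.univ.filter fun x => m₁ x ≠ x) ⊆
          (Finset.univ.filter fun x => m x ≠ x).erase a := by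
        intro x hx
        simp only [Finset.mem_filter, Finset.mem_univ, true_and, Finset.mem_erase, m₁] at hx ⊢
        grind
      have h4 := Finset.card_le_card this
      rw [Finset.card_erase_of_mem (by simpa using ha)] at h4
      omega)
    refine ⟨n', h1, h2, fun χ hχ => ?_⟩
    obtain ⟨χ₁, h4, h5, h6⟩ := h3 χ hχ
    obtain ⟨p, q, hpq, hp, hq⟩ : ∃ p q : Bool, p ≠ q ∧
        (n a ≠ a → n a ≠ b → χ₁ (n a) ≠ p) ∧ (n b ≠ b → n b ≠ a → χ₁ (n b) ≠ q) := by
      by_cases hna : n a = a ∨ n a = b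
      · exact ⟨χ₁ (n b), !χ₁ (n b), by simp, by grind, by simp⟩
      · refine ⟨!χ₁ (n a), χ₁ (n a), by simp, by simp, fun hb hb' => ?_⟩
        have := h5 (n a)
        simp only [n₁] at this
        grind
    refine ⟨fun x => if x = a then p else if x = b then q else χ₁ x, ?_, ?_, ?_⟩
    · intro x hx
      have hxa : x ≠ a := by rintro rfl; exact haC hx
      have hxb : x ≠ b := by rintro rfl; exact hbC hx
      simp [hxa, hxb, h4 x hx]
    · intro x hx
      have := h5 x
      simp only [n₁] at this
      dsimp only
      grind
    · intro x hx
      have := h6 x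
      simp only [m₁] at this
      dsimp only
      grind

lemma exists_bool_coloring_of_involutions (n m : V → V) (hn : ∀ x, n (n x) = x)
    (hm : ∀ x, m (m x) = x) :
    ∃ χ : V → Bool, (∀ x, n x ≠ x → χ (n x) ≠ χ x) ∧ ∀ x, m x ≠ x → χ (m x) ≠ χ x := by
  obtain ⟨_, -, -, h⟩ := exists_contracted_involution ∅ _ n m hn hm (by simp) le_rfl
  obtain ⟨χ, -, h⟩ := h (fun _ => true) (by simp)
  exact ⟨χ, h⟩

omit [Fintype V] [DecidableEq V] in
lemma exists_fixed_of_odd (n : V → V) (hn : ∀ x, n (n x) = x) (C : Finset V)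
    (hC : ∀ x ∈ C, n x ∈ C) (hodd : Odd C.card) : ∃ r ∈ C, n r = r := by
  by_contra! h
  have : (∑ x ∈ C, (1 : ZMod 2)) = 0 :=
    Finset.sum_involution (fun x _ => n x) (fun _ _ => by decide) (fun x hx _ => h x hx)
      (fun x hx => hC x hx) (fun x _ => hn x)
  rw [Finset.sum_const, nsmul_one, ZMod.natCast_eq_zero_iff_even] at this
  exact (Nat.not_even_iff_odd.mpr hodd) this

end Matchings

section CyclicSets

/-- The set `s` can be cyclically enumerated, without repetition, along edges of `H`. -/
def IsCyclicSet {V : Type*} (H : SimpleGraph V) (s : Finset V) : Prop :=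
  ∃ (n : ℕ) (c : ZMod n → V), 3 ≤ n ∧ Function.Injective c ∧ (∀ i, H.Adj (c i) (c (i + 1))) ∧
    ∀ x, x ∈ s ↔ ∃ i, c i = x

lemma ZMod.val_add_one_eq {n : ℕ} (hn : 2 ≤ n) (i : ZMod n) :
    (i + 1).val = if i.val + 1 = n then 0 else i.val + 1 := by
  have : NeZero n := ⟨by omega⟩
  have h1 : (1 : ZMod n).val = 1 := by rw [ZMod.val_one_eq_one_mod, Nat.mod_eq_of_lt hn]
  have := i.val_lt
  rw [ZMod.val_add, h1]
  split_ifs with h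
  · simp [h]
  · exact Nat.mod_eq_of_lt (by omega)

section General

variable {V : Type*} {H : SimpleGraph V} {s T : Finset V}

lemma IsCyclicSet.isCore (h : IsCyclicSet H s) : IsCore H s := by
  obtain ⟨n, c, hn, hc, hadj, hs⟩ := h
  intro v hv
  obtain ⟨i, rfl⟩ := (hs v).1 hv
  refine ⟨c (i + 1), (hs _).2 ⟨_, rfl⟩, c (i - 1), (hs _).2 ⟨_, rfl⟩, fun h => ?_, hadj i, ?_⟩
  · have h2 : ((2 : ℕ) : ZMod n) = 0 := by
      have := hc h
      push_cast
      linear_combination this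
    rw [ZMod.natCast_eq_zero_iff] at h2
    exact absurd (Nat.le_of_dvd two_pos h2) (by omega)
  · simpa using (hadj (i - 1)).symm

lemma IsCore.mem_of_adj (hH : DegLETwo H) (h : IsCore H T) {u v : V} (hu : u ∈ T)
    (huv : H.Adj u v) : v ∈ T := by
  obtain ⟨a, ha, b, hb, hab, h1, h2⟩ := h u hu
  rcases hH u a b v h1 h2 huv with h | h | h
  · exact absurd h hab
  · exact h ▸ ha
  · exact h ▸ hb

lemma IsCyclicSet.three_le_card (h : IsCyclicSet H s) : 3 ≤ s.card := by
  obtain ⟨n, c, hn, hc, hadj, hs⟩ := h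
  have : NeZero n := ⟨by omega⟩
  have : s = Finset.univ.map ⟨c, hc⟩ := by ext x; simp [hs]
  rw [this, Finset.card_map, Finset.card_univ, ZMod.card]
  exact hn

lemma IsCyclicSet.subset_of_isCore (hH : DegLETwo H) (hs : IsCyclicSet H s) (hT : IsCore H T)
    {v : V} (hv : v ∈ s) (hvT : v ∈ T) : s ⊆ T := by
  obtain ⟨n, c, hn, hc, hadj, hs⟩ := hs
  have : NeZero n := ⟨by omega⟩
  obtain ⟨i, rfl⟩ := (hs v).1 hv
  have h : ∀ k : ℕ, c (i + k) ∈ T := by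
    intro k
    induction k with
    | zero => simpa using hvT
    | succ k ih =>
      have := hT.mem_of_adj hH ih (hadj _)
      rwa [add_assoc, ← Nat.cast_succ] at this
  intro x hx
  obtain ⟨j, rfl⟩ := (hs x).1 hx
  simpa using h (j - i).val

lemma IsCyclicSet.eq_of_mem (hH : DegLETwo H) (hs : IsCyclicSet H s) (hT : IsCyclicSet H T)
    {v : V} (hv : v ∈ s) (hvT : v ∈ T) : s = T :=
  (hs.subset_of_isCore hH hT.isCore hv hvT).antisymm (hT.subset_of_isCore hH hs.isCore hvT hv)

/-- A cycle has a matching that misses at most a prescribed vertex, and misses none if the cycle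
is even. -/
lemma IsCyclicSet.exists_matching (hs : IsCyclicSet H s) {r : V} (hr : r ∈ s) :
    ∃ m : V → V, (∀ x, m (m x) = x) ∧ (∀ x, m x ≠ x → x ∈ s ∧ H.Adj x (m x)) ∧
      ∀ x ∈ s, m x = x → x = r ∧ Odd s.card := by
  obtain ⟨n, c, hn, hc, hadj, hs⟩ := hs
  have : NeZero n := ⟨by omega⟩
  obtain ⟨k, rfl⟩ := (hs r).1 hr
  have hodd : ∀ i : ZMod n, Odd i.val → ¬ Odd (i + 1).val := by
    intro i hi
    rw [ZMod.val_add_one_eq (by omega)]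
    split_ifs
    · simp
    · simpa using hi.add_one
  have hcard : s.card = n := by
    have : s = Finset.univ.map ⟨c, hc⟩ := by ext x; simp [hs]
    rw [this, Finset.card_map, Finset.card_univ, ZMod.card]
  obtain ⟨m, h1, h2, h3⟩ := exists_involution_of_unique
    (fun x y => ∃ i : ZMod n, Odd i.val ∧
      (x = c (k + i) ∧ y = c (k + (i + 1)) ∨ y = c (k + i) ∧ x = c (k + (i + 1))))
    (fun x y ⟨i, hi, h⟩ => ⟨i, hi, h.symm⟩) (by
      rintro x y z ⟨i, hi, ⟨rfl, rfl⟩ | ⟨rfl, rfl⟩⟩ ⟨j, hj, ⟨h, rfl⟩ | ⟨rfl, h⟩⟩ <;>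
        have h := add_left_cancel (hc h)
      · rw [h]
      · exact absurd (h ▸ hi) (hodd j hj)
      · exact absurd (h ▸ hj) (hodd i hi)
      · rw [add_right_cancel h])
  refine ⟨m, h1, fun x hx => ?_, fun x hx hmx => ?_⟩
  · obtain ⟨i, hi, ⟨h, h'⟩ | ⟨h', h⟩⟩ := h3 x hx
    · rw [h', h]
      refine ⟨(hs _).2 ⟨_, rfl⟩, ?_⟩
      rw [← add_assoc]
      exact hadj _
    · rw [h', h]
      refine ⟨(hs _).2 ⟨_, rfl⟩, ?_⟩
      rw [← add_assoc]
      exact (hadj _).symm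
  · obtain ⟨j, rfl⟩ := (hs x).1 hx
    obtain ⟨i, rfl⟩ : ∃ i, j = k + i := ⟨j - k, by ring⟩
    have hne : ∀ i : ZMod n, c i ≠ c (i + 1) := fun i => (hadj i).ne
    have hi : ¬ Odd i.val := fun hi => by
      have := h2 (c (k + i)) _ ⟨i, hi, Or.inl ⟨rfl, rfl⟩⟩
      rw [hmx, ← add_assoc] at this
      exact hne _ this
    have hi' : ¬ Odd (i - 1).val := fun hi => by
      have := h2 (c (k + i)) _ ⟨i - 1, hi, Or.inr ⟨rfl, by simp⟩⟩
      rw [hmx] at this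
      have h4 := hne (k + (i - 1))
      rw [← this, add_assoc] at h4
      simp at h4
    have hval := ZMod.val_add_one_eq (by omega) (i - 1)
    rw [sub_add_cancel] at hval
    rw [hcard]
    split_ifs at hval with h
    · refine ⟨?_, ?_⟩
      · rw [ZMod.val_eq_zero] at hval
        rw [hval, add_zero]
      · rw [← h]
        exact (Nat.not_odd_iff_even.1 hi').add_one
    · exact absurd (hval ▸ (Nat.not_odd_iff_even.1 hi').add_one) hi

end General

section Cycles

variable {V : Type} [DecidableEq V] {H : SimpleGraph V} {s T : Finset V}

lemma IsCycleSet.isCyclicSet (h : IsCycleSet H s) : IsCyclicSet H s := by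
  obtain ⟨v, w, hw, rfl⟩ := h
  have hn := hw.three_le_length
  have : NeZero w.length := ⟨by omega⟩
  refine ⟨w.length, fun i => w.getVert i.val, hn, fun i j hij => ?_, fun i => ?_, fun x => ?_⟩
  · have hi := i.val_lt
    have hj := j.val_lt
    exact ZMod.val_injective _ (hw.getVert_injOn' (Set.mem_ofPred.2 (by omega))
      (Set.mem_ofPred.2 (by omega)) hij)
  · have := w.adj_getVert_succ i.val_lt
    dsimp only
    rw [ZMod.val_add_one_eq (by omega)]
    split_ifs with h
    · rw [h, w.getVert_length] at this
      rwa [w.getVert_zero]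
    · exact this
  · rw [List.mem_toFinset, Walk.mem_support_iff_exists_getVert]
    constructor
    · rintro ⟨k, rfl, hk⟩
      rcases hk.lt_or_eq with h | rfl
      · exact ⟨k, by dsimp only; rw [ZMod.val_natCast_of_lt h]⟩
      · exact ⟨0, by simp⟩
    · rintro ⟨i, rfl⟩
      exact ⟨_, rfl, i.val_lt.le⟩

lemma IsCore.exists_isCycleSet_subset (hT : IsCore H T) (hne : T.Nonempty) :
    ∃ s ⊆ T, IsCycleSet H s := by
  have hcyc : ¬ (H.induce (T : Set V)).IsAcyclic := by
    intro hac
    have : Nonempty (T : Set V) := hne.to_subtype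
    obtain ⟨u, v, p, hp, hmax⟩ := Walk.exists_isPath_forall_isPath_length_le_length
      (H.induce (T : Set V))
    obtain ⟨a, ha, b, hb, hab, h1, h2⟩ := hT u u.2
    have key : ∀ w : (T : Set V), (H.induce (T : Set V)).Adj u w → w = p.snd := by
      intro w hw
      refine hac.eq_snd_of_adj_start hp hw ?_
      by_contra h
      have := hmax _ _ (Walk.cons hw.symm p) (hp.cons h)
      simp at this
    have h3 := (key ⟨a, ha⟩ h1).trans (key ⟨b, hb⟩ h2).symm
    exact hab (congrArg Subtype.val h3)
  simp only [IsAcyclic, not_forall, not_not] at hcyc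
  obtain ⟨v, w, hw⟩ := hcyc
  refine ⟨_, ?_, _, w.map (Embedding.induce (T : Set V)).toHom,
    hw.map Subtype.val_injective, rfl⟩
  intro x hx
  rw [List.mem_toFinset, Walk.support_map, List.mem_map] at hx
  obtain ⟨y, -, rfl⟩ := hx
  exact y.2

lemma IsCyclicSet.isCycleSet (hH : DegLETwo H) (h : IsCyclicSet H s) : IsCycleSet H s := by
  have hne : s.Nonempty := Finset.card_pos.1 (by have := h.three_le_card; omega)
  obtain ⟨t, hts, ht⟩ := h.isCore.exists_isCycleSet_subset hne
  obtain ⟨x, hx⟩ : t.Nonempty :=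
    Finset.card_pos.1 (by have := ht.isCyclicSet.three_le_card; omega)
  rwa [h.eq_of_mem hH ht.isCyclicSet (hts hx) hx]

end Cycles
end CyclicSets

section NearMatchings

variable {V : Type} [Fintype V] {H : SimpleGraph V}

lemma exists_matching_off_cyclicSets (hH : DegLETwo H) :
    ∃ m : V → V, (∀ x, m (m x) = x) ∧
      (∀ x, m x ≠ x → H.Adj x (m x) ∧ ∀ s, IsCyclicSet H s → x ∉ s) ∧
      ∀ x, (∀ s, IsCyclicSet H s → x ∉ s) → m x = x → ∀ a b, H.Adj x a → H.Adj x b → a = b := by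
  classical
  let H₁ : SimpleGraph V :=
    { Adj := fun u v => H.Adj u v ∧ (∀ s, IsCyclicSet H s → u ∉ s) ∧ ∀ s, IsCyclicSet H s → v ∉ s
      symm := ⟨fun u v h => ⟨h.1.symm, h.2.2, h.2.1⟩⟩
      loopless := ⟨fun u h => h.1.ne rfl⟩ }
  obtain ⟨pos, hpos⟩ := exists_consecutive_arrangement (H := H₁)
    (fun v a b c ha hb hc => hH v a b c ha.1 hb.1 hc.1) (fun T hT => by
      by_contra hne
      have hT' : IsCore H T := fun v hv => by
        obtain ⟨a, ha, b, hb, hab, h1, h2⟩ := hT v hv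
        exact ⟨a, ha, b, hb, hab, h1.1, h2.1⟩
      obtain ⟨s, hsT, hs⟩ := hT'.exists_isCycleSet_subset (Finset.nonempty_iff_ne_empty.2 hne)
      obtain ⟨x, hx⟩ := Finset.card_pos.1
        (show 0 < s.card by have := hs.isCyclicSet.three_le_card; omega)
      obtain ⟨a, -, -, -, -, h1, -⟩ := hT x (hsT hx)
      exact h1.2.1 s hs.isCyclicSet hx)
  obtain ⟨m, h1, h2, h3⟩ := exists_involution_of_unique
    (fun u v => H₁.Adj u v ∧ (Even (pos u).val ∧ (pos v).val = (pos u).val + 1 ∨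
      Even (pos v).val ∧ (pos u).val = (pos v).val + 1))
    (fun u v h => ⟨h.1.symm, h.2.symm⟩) (by
      rintro x y z ⟨-, h⟩ ⟨-, h'⟩
      apply pos.injective
      apply Fin.ext
      rw [Nat.even_iff, Nat.even_iff] at h h'
      omega)
  refine ⟨m, h1, fun x hx => ⟨(h3 x hx).1.1, (h3 x hx).1.2.1⟩, fun x hx hmx a b ha hb => ?_⟩
  have key : ∀ y, H.Adj x y → H₁.Adj x y := fun y hy =>
    ⟨hy, hx, fun s hs hys => hx s hs (hs.isCore.mem_of_adj hH hys hy.symm)⟩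
  have key2 : ∀ y, H.Adj x y → (pos y).val = (pos x).val + 1 ∧ ¬ Even (pos x).val ∨
      (pos x).val = (pos y).val + 1 ∧ Even (pos x).val := by
    intro y hy
    have hne : ¬ _ := fun h => hy.ne (hmx.symm.trans (h2 x y ⟨key y hy, h⟩))
    have := hpos x y (key y hy)
    rw [Nat.even_iff, Nat.even_iff] at hne
    rw [Nat.even_iff]
    omega
  apply pos.injective
  apply Fin.ext
  have h4 := key2 a ha
  have h5 := key2 b hb
  rw [Nat.even_iff] at h4 h5
  omega

/-- The involution `m` is a matching of `H` covering all vertices of degree two, except possibly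
the representatives `ρ s` of the odd cycles `s`. -/
structure IsNearMatching (H : SimpleGraph V) (ρ : Finset V → V) (m : V → V) : Prop where
  invol : ∀ x, m (m x) = x
  adj : ∀ x, m x ≠ x → H.Adj x (m x)
  fixed : ∀ x, m x = x → (∃ s, IsCyclicSet H s ∧ x ∈ s ∧ x = ρ s ∧ Odd s.card) ∨
    ∀ a b, H.Adj x a → H.Adj x b → a = b

lemma exists_isNearMatching (hH : DegLETwo H) (ρ : Finset V → V)
    (hρ : ∀ s, IsCyclicSet H s → ρ s ∈ s) : ∃ m, IsNearMatching H ρ m := by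
  obtain ⟨m₀, h1, h2, h3⟩ := exists_matching_off_cyclicSets hH
  have : Nonempty (V → V) := ⟨id⟩
  choose! μ g1 g2 g3 using fun s (hs : IsCyclicSet H s) => hs.exists_matching (hρ s hs)
  obtain ⟨m, f1, f2, f3⟩ := exists_involution_of_unique
    (fun x y => (∃ s, IsCyclicSet H s ∧ x ∈ s ∧ μ s x = y ∧ x ≠ y) ∨ (m₀ x = y ∧ x ≠ y)) (by
      rintro x y (⟨s, hs, hx, rfl, hne⟩ | ⟨rfl, hne⟩)
      · refine Or.inl ⟨s, hs, ?_, g1 s hs x, hne.symm⟩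
        exact hs.isCore.mem_of_adj hH hx (g2 s hs x hne.symm).2
      · exact Or.inr ⟨h1 x, hne.symm⟩) (by
      rintro x y z (⟨s, hs, hx, rfl, hne⟩ | ⟨rfl, hne⟩) (⟨t, ht, hx', rfl, hne'⟩ | ⟨rfl, hne'⟩)
      · rw [hs.eq_of_mem hH ht hx hx']
      · exact absurd hx ((h2 x hne'.symm).2 s hs)
      · exact absurd hx' ((h2 x hne.symm).2 t ht)
      · rfl)
  refine ⟨m, f1, fun x hx => ?_, fun x hx => ?_⟩
  · rcases f3 x hx with ⟨s, hs, hxs, h, hne⟩ | ⟨h, hne⟩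
    · rw [← h] at hne ⊢
      exact (g2 s hs x hne.symm).2
    · rw [← h] at hne ⊢
      exact (h2 x hne.symm).1
  · by_cases hc : ∃ s, IsCyclicSet H s ∧ x ∈ s
    · obtain ⟨s, hs, hxs⟩ := hc
      refine Or.inl ⟨s, hs, hxs, g3 s hs x hxs ?_⟩
      by_contra hne
      exact hne ((f2 x _ (Or.inl ⟨s, hs, hxs, rfl, fun h => hne h.symm⟩)).symm.trans hx)
    · push Not at hc
      refine Or.inr (h3 x hc ?_)
      by_contra hne
      exact hne ((f2 x _ (Or.inr ⟨rfl, fun h => hne h.symm⟩)).symm.trans hx)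

omit [Fintype V] in
lemma IsNearMatching.eq_of_adj_of_adj {ρ : Finset V → V} {m : V → V} (hm : IsNearMatching H ρ m)
    (hH : DegLETwo H) {χ : V → Bool} (hχ : ∀ x, m x ≠ x → χ (m x) ≠ χ x)
    (hlong : ∀ s, IsCyclicSet H s → Odd s.card → 3 < s.card →
      ∃ b, H.Adj (ρ s) b ∧ χ b ≠ χ (ρ s)) {v a b : V} (ha : H.Adj v a) (hb : H.Adj v b)
    (hca : χ a = χ v) (hcb : χ b = χ v) : a = b := by
  classical
  by_contra hab
  have hnbr : ∀ c, H.Adj v c → χ c = χ v := fun c hc => by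
    rcases hH v a b c ha hb hc with h | h | h
    · exact absurd h hab
    · rw [← h, hca]
    · rw [← h, hcb]
  have hmv : m v = v := by
    by_contra h
    exact hχ v h (hnbr _ (hm.adj v h))
  rcases hm.fixed v hmv with ⟨s, hs, hvs, hv, hodd⟩ | h
  · by_cases h3 : 3 < s.card
    · obtain ⟨c, hc, hne⟩ := hlong s hs hodd h3
      rw [← hv] at hc hne
      exact hne (hnbr c hc)
    have has := hs.isCore.mem_of_adj hH hvs ha
    have hbs := hs.isCore.mem_of_adj hH hvs hb
    have hsub : ({v, a, b} : Finset V) = s := by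
      apply Finset.eq_of_subset_of_card_le
      · intro x hx
        simp only [Finset.mem_insert, Finset.mem_singleton] at hx
        rcases hx with rfl | rfl | rfl <;> assumption
      · rw [Finset.card_eq_three.2 ⟨v, a, b, ha.ne, hb.ne, hab, rfl⟩]
        omega
    have hma : m a ≠ a := by
      intro h
      rcases hm.fixed a h with ⟨t, ht, hat, h1, -⟩ | h1
      · rw [hs.eq_of_mem hH ht has hat] at hv
        exact ha.ne (hv.trans h1.symm)
      · obtain ⟨x, -, y, -, hxy, hx, hy⟩ := hs.isCore a has
        exact hxy (h1 x y hx hy)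
    have hmem := hs.isCore.mem_of_adj hH has (hm.adj a hma)
    rw [← hsub, Finset.mem_insert, Finset.mem_insert, Finset.mem_singleton] at hmem
    rcases hmem with h | h | h
    · rw [← h, hm.invol] at hmv
      exact hma hmv.symm
    · exact hma h
    · exact hχ a hma (by rw [h, hca, hcb])
  · exact hab (h a b ha hb)

/-- If `H` has at most one long odd cycle, then the pairs of `n` can be properly coloured with two
colours so that the monochromatic edges of `H` form a matching. -/
lemma exists_bool_coloring_of_long_unique [DecidableEq V] (hH : DegLETwo H)
    (hlong : ∀ s t, IsCyclicSet H s → IsCyclicSet H t → Odd s.card → Odd t.card → 3 < s.card →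
      3 < t.card → s = t) (n : V → V) (hn : ∀ x, n (n x) = x) :
    ∃ χ : V → Bool, (∀ x, n x ≠ x → χ (n x) ≠ χ x) ∧
      ∀ v a b, H.Adj v a → H.Adj v b → χ a = χ v → χ b = χ v → a = b := by
  by_cases hV : IsEmpty V
  · exact ⟨fun _ => true, fun x => isEmptyElim x, fun x => isEmptyElim x⟩
  rw [not_isEmpty_iff] at hV
  choose! ρ hρ using fun s (hs : IsCyclicSet H s) =>
    (Finset.card_pos.1 (show 0 < s.card by have := hs.three_le_card; omega) : ∃ x, x ∈ s)
  obtain ⟨m, hm⟩ := exists_isNearMatching hH ρ hρ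
  by_cases hC : ∃ C, IsCyclicSet H C ∧ Odd C.card ∧ 3 < C.card
  swap
  · obtain ⟨χ, h1, h2⟩ := exists_bool_coloring_of_involutions n m hn hm.invol
    exact ⟨χ, h1, fun v a b ha hb hca hcb => hm.eq_of_adj_of_adj hH h2
      (fun s hs ho h3 => absurd ⟨s, hs, ho, h3⟩ hC) ha hb hca hcb⟩
  obtain ⟨C, hC, hodd, h3⟩ := hC
  have hmC : ∀ x, m x ∈ C ↔ x ∈ C := by
    have : ∀ x ∈ C, m x ∈ C := fun x hx => by
      by_cases h : m x = x
      · rwa [h]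
      · exact hC.isCore.mem_of_adj hH hx (hm.adj x h)
    exact fun x => ⟨fun h => hm.invol x ▸ this _ h, this x⟩
  obtain ⟨n', hn', hn'C, hext⟩ := exists_contracted_involution C _ n
    (fun x => if x ∈ C then x else m x) hn
    (fun x => by by_cases h : x ∈ C <;> simp [h, hmC, hm.invol]) (fun x hx => by simp [hx]) le_rfl
  obtain ⟨r, hr, hnr⟩ := exists_fixed_of_odd n' hn' C hn'C hodd
  obtain ⟨μ, hμ, hμadj, hμfix⟩ := hC.exists_matching hr
  have hμC : ∀ x ∈ C, μ x ∈ C := fun x hx => by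
    by_cases h : μ x = x
    · rwa [h]
    · exact hC.isCore.mem_of_adj hH hx (hμadj x h).2
  have hμr : μ r = r := by
    obtain ⟨r', hr', h⟩ := exists_fixed_of_odd μ hμ C hμC hodd
    rwa [← (hμfix r' hr' h).1]
  obtain ⟨χ₀, hχn, hχμ⟩ := exists_bool_coloring_of_involutions n' μ hn' hμ
  obtain ⟨b, hb, -, -, -, hrb, -⟩ := hC.isCore r hr
  obtain ⟨χ, e1, e2, e3⟩ := hext (fun x => if x = r then !χ₀ b else χ₀ x) (fun x hx hne => by
    have hxr : x ≠ r := by rintro rfl; exact hne hnr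
    have hnxr : n' x ≠ r := fun h => hxr (by rw [← hn' x, h, hnr])
    simpa [hxr, hnxr] using hχn x hne)
  have hm' : IsNearMatching H (fun s => if s = C then r else ρ s)
      (fun x => if x ∈ C then μ x else m x) := by
    refine ⟨fun x => ?_, fun x hx => ?_, fun x hx => ?_⟩
    · by_cases h : x ∈ C
      · simp [h, hμC x h, hμ]
      · simp [h, hmC, hm.invol]
    · by_cases h : x ∈ C
      · simp only [h, if_true] at hx ⊢
        exact (hμadj x hx).2
      · simp only [h, if_false] at hx ⊢
        exact hm.adj x hx
    · by_cases h : x ∈ C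
      · simp only [h, if_true] at hx
        exact Or.inl ⟨C, hC, h, by simp [(hμfix x h hx).1], hodd⟩
      · simp only [h, if_false] at hx
        refine (hm.fixed x hx).imp_left ?_
        rintro ⟨s, hs, hxs, hxρ, ho⟩
        have hsC : s ≠ C := by rintro rfl; exact h hxs
        exact ⟨s, hs, hxs, by simpa [hsC] using hxρ, ho⟩
  refine ⟨χ, e2, fun v a b' ha hb' hca hcb => hm'.eq_of_adj_of_adj hH ?_ ?_ ha hb' hca hcb⟩
  · intro x hx
    by_cases h : x ∈ C
    · simp only [h, if_true] at hx ⊢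
      have hxr : x ≠ r := by rintro rfl; exact hx hμr
      have hμxr : μ x ≠ r := fun h => hxr (by rw [← hμ x, h, hμr])
      rw [e1 x h, e1 _ (hμC x h), if_neg hxr, if_neg hμxr]
      exact hχμ x hx
    · simp only [h, if_false] at hx ⊢
      simpa [h] using e3 x (by simpa [h] using hx)
  · intro s hs ho h3'
    obtain rfl := hlong s C hs hC ho hodd h3' h3
    refine ⟨b, by simpa using hrb, ?_⟩
    simp only [if_true]
    rw [e1 b hb, e1 r hr, if_neg hrb.ne', if_pos rfl]
    simp

end NearMatchings

lemma eq_of_two_pairs : ∀ f : Fin 4 → Bool, f 0 ≠ f 1 → f 2 ≠ f 3 → ∀ {a b d : Fin 4}, a ≠ b →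
    a ≠ d → f a = f b → f a = f d → b = d := by
  intro f h1 h2 a b d
  fin_cases a <;> fin_cases b <;> fin_cases d <;> simp <;> grind

/-- If `H` has at most one long odd cycle, then it can be properly coloured with four colours so
that every block `{i} × Fin 4` is rainbow. -/
lemma exists_coloring_of_long_unique {ι : Type} [Fintype ι] [DecidableEq ι]
    {H : SimpleGraph (ι × Fin 4)} (hH : DegLETwo H)
    (hlong : ∀ s t, IsCyclicSet H s → IsCyclicSet H t → Odd s.card → Odd t.card → 3 < s.card →
      3 < t.card → s = t) :
    ∃ c : ι × Fin 4 → Bool × Bool, (∀ u v, H.Adj u v → c u ≠ c v) ∧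
      ∀ i a b, a ≠ b → c (i, a) ≠ c (i, b) := by
  obtain ⟨χ, h1, h2⟩ := exists_bool_coloring_of_long_unique hH hlong
    (fun x => (x.1, (![1, 0, 3, 2] : Fin 4 → Fin 4) x.2)) (by
      rintro ⟨i, a⟩
      fin_cases a <;> rfl)
  have hY : ∀ i, χ (i, 0) ≠ χ (i, 1) ∧ χ (i, 2) ≠ χ (i, 3) := fun i => by
    have g1 := h1 (i, 1) (by simp)
    have g2 := h1 (i, 3) (by simp)
    exact ⟨g1, g2⟩
  obtain ⟨n, n1, n2, -⟩ := exists_involution_of_unique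
    (fun x y : ι × Fin 4 => x ≠ y ∧ x.1 = y.1 ∧ χ x = χ y)
    (fun x y h => ⟨h.1.symm, h.2.1.symm, h.2.2.symm⟩) (by
      rintro ⟨i, a⟩ ⟨j, b⟩ ⟨k, d⟩ ⟨h3, h4, h5⟩ ⟨h6, h7, h8⟩
      obtain rfl : i = j := h4
      obtain rfl : i = k := h7
      refine congrArg (Prod.mk i)
        (eq_of_two_pairs (fun a => χ (i, a)) (hY i).1 (hY i).2 ?_ ?_ h5 h8)
      · rintro rfl
        exact h3 rfl
      · rintro rfl
        exact h6 rfl)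
  obtain ⟨m, m1, m2, -⟩ := exists_involution_of_unique
    (fun x y => H.Adj x y ∧ χ x = χ y) (fun x y h => ⟨h.1.symm, h.2.symm⟩)
    (fun x y z h h' => h2 x y z h.1 h'.1 h.2.symm h'.2.symm)
  obtain ⟨χ₂, g1, g2⟩ := exists_bool_coloring_of_involutions n m n1 m1
  refine ⟨fun x => (χ x, χ₂ x), fun u v huv h => ?_, fun i a b hab h => ?_⟩
  · obtain ⟨e1, e2⟩ := Prod.mk.inj h
    have := m2 u v ⟨huv, e1⟩
    exact g2 u (by rw [this]; exact huv.ne') (by rw [this, e2])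
  · obtain ⟨e1, e2⟩ := Prod.mk.inj h
    have hne : (i, a) ≠ (i, b) := by simpa using hab
    have := n2 _ _ ⟨hne, rfl, e1⟩
    exact g1 (i, a) (by rw [this]; exact hne.symm) (by rw [this, e2])

lemma degLETwo_of_degree_le {V : Type*} [Fintype V] {H : SimpleGraph V} [DecidableRel H.Adj]
    (h : ∀ v, H.degree v ≤ 2) : DegLETwo H := by
  classical
  intro v a b c ha hb hc
  by_contra! hne
  have hsub : ({a, b, c} : Finset V) ⊆ H.neighborFinset v := by
    intro x hx
    simp only [Finset.mem_insert, Finset.mem_singleton] at hx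
    rw [mem_neighborFinset]
    rcases hx with rfl | rfl | rfl <;> assumption
  have h3 := Finset.card_le_card hsub
  rw [Finset.card_eq_three.2 ⟨a, b, c, hne.1, hne.2.1, hne.2.2, rfl⟩, card_neighborFinset_eq_degree]
    at h3
  exact absurd (h v) (by omega)

lemma DegLETwo.map {V W : Type*} {H : SimpleGraph V} (hH : DegLETwo H) (φ : V ↪ W) :
    DegLETwo (H.map φ) := by
  rintro _ _ _ _ ⟨-, v, a, ha, rfl, rfl⟩ ⟨-, w, b, hb, hw, rfl⟩ ⟨-, x, c, hc, hx, rfl⟩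
  obtain rfl := φ.injective hw
  obtain rfl := φ.injective hx
  simpa using hH x a b c ha hb hc

lemma IsCyclicSet.exists_map_eq {V W : Type*} {H : SimpleGraph V} {φ : V ↪ W} {t : Finset W}
    (ht : IsCyclicSet (H.map φ) t) : ∃ s, IsCyclicSet H s ∧ s.map φ = t := by
  classical
  obtain ⟨n, c, hn, hc, hadj, ht⟩ := ht
  have : NeZero n := ⟨by omega⟩
  have hex : ∀ i, ∃ v, φ v = c i := fun i => by
    obtain ⟨-, u, v, -, h, -⟩ := hadj i
    exact ⟨u, h⟩
  choose d hd using hex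
  refine ⟨Finset.univ.image d, ⟨n, d, hn, fun i j hij => hc ?_, fun i => ?_, by simp⟩, ?_⟩
  · rw [← hd, ← hd, hij]
  · have := hadj i
    rwa [← hd, ← hd, map_adj_apply] at this
  · ext x
    simp [ht, hd]

lemma exists_embedding_of_disjoint {V : Type} [DecidableEq V] {q : ℕ} (Y : Fin q → Finset V)
    (hcard : ∀ j, (Y j).card = 4) (hdisj : ∀ i j, i ≠ j → Disjoint (Y i) (Y j)) :
    ∃ φ : V ↪ (Fin q ⊕ V) × Fin 4, ∀ j, ∀ u ∈ Y j, (φ u).1 = Sum.inl j := by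
  classical
  have huniq : ∀ i j v, v ∈ Y i → v ∈ Y j → i = j := fun i j v hi hj => by
    by_contra hne
    exact Finset.disjoint_left.1 (hdisj i j hne) hi hj
  choose e he using fun j => (show ∃ e : V → Fin 4, Set.InjOn e (Y j) from by
    have f := (Y j).equivFinOfCardEq (hcard j)
    refine ⟨fun v => if h : v ∈ Y j then f ⟨v, h⟩ else 0, fun u hu v hv huv => ?_⟩
    simp only [Finset.mem_coe] at hu hv
    simpa [hu, hv] using huv)
  obtain ⟨φ, h1, h2⟩ : ∃ φ : V → (Fin q ⊕ V) × Fin 4,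
      (∀ j, ∀ u ∈ Y j, φ u = (Sum.inl j, e j u)) ∧
        ∀ u, (∀ j, u ∉ Y j) → φ u = (Sum.inr u, 0) := by
    refine ⟨fun u => if h : ∃ j, u ∈ Y j then (Sum.inl h.choose, e h.choose u)
      else (Sum.inr u, 0), fun j u hu => ?_, fun u hu => dif_neg (by simpa using hu)⟩
    have h : ∃ j, u ∈ Y j := ⟨j, hu⟩
    dsimp only
    rw [dif_pos h, huniq _ _ u h.choose_spec hu]
  refine ⟨⟨φ, fun u v huv => ?_⟩, fun j u hu => congrArg Prod.fst (h1 j u hu)⟩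
  by_cases hu : ∃ i, u ∈ Y i <;> by_cases hv : ∃ j, v ∈ Y j
  · obtain ⟨i, hu⟩ := hu
    obtain ⟨j, hv⟩ := hv
    rw [h1 i u hu, h1 j v hv, Prod.mk.injEq, Sum.inl.injEq] at huv
    obtain ⟨rfl, h⟩ := huv
    exact he i hu hv h
  · obtain ⟨i, hu⟩ := hu
    rw [h1 i u hu, h2 v (by simpa using hv)] at huv
    simp at huv
  · obtain ⟨j, hv⟩ := hv
    rw [h1 j v hv, h2 u (by simpa using hu)] at huv
    simp at huv
  · rw [h2 u (by simpa using hu), h2 v (by simpa using hv)] at huv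
    simpa using huv

theorem stmt_0 {V : Type} [Fintype V] [DecidableEq V]
    (H G : SimpleGraph V) [DecidableRel H.Adj]
    (hΔ : ∀ v, H.degree v ≤ 2)
    (hglue : GluedK4 H G)
    (hcond :
      {s : Finset V | IsCycleSet H s ∧ Odd s.card ∧ 3 < s.card}.ncard ≤ 1 ∨
      {s : Finset V | IsCycleSet H s ∧ s.card = 3}.ncard ≤ 3) :
    G.chromaticNumber ≤ 4 := by
  classical
  obtain ⟨q, Y, hcard, hdisj, hG⟩ := hglue
  have hH := degLETwo_of_degree_le hΔ
  obtain ⟨φ, hφ⟩ := exists_embedding_of_disjoint Y hcard hdisj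
  have hH' := hH.map φ
  have hcol : ∀ {α : Type} [Fintype α], Fintype.card α = 4 →
      (∃ c : (Fin q ⊕ V) × Fin 4 → α, (∀ u v, (H.map φ).Adj u v → c u ≠ c v) ∧
        ∀ i a b, a ≠ b → c (i, a) ≠ c (i, b)) → G.chromaticNumber ≤ 4 := by
    rintro α _ hα ⟨c, h1, h2⟩
    have hvalid : ∀ {u v}, G.Adj u v → c (φ u) ≠ c (φ v) := by
      intro u v huv
      rcases (hG u v).1 huv with h | ⟨hne, j, hu, hv⟩
      · exact h1 _ _ (map_adj_apply.2 h)
      · have e : (φ u).1 = (φ v).1 := (hφ j u hu).trans (hφ j v hv).symm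
        have := h2 (φ u).1 (φ u).2 (φ v).2 fun h => hne (φ.injective (Prod.ext e h))
        nth_rewrite 2 [e] at this
        exact this
    have := (Coloring.mk (fun v => c (φ v)) hvalid).colorable
    rw [hα] at this
    exact this.chromaticNumber_le
  rcases hcond with hc | hc
  · refine hcol (by simp) (exists_coloring_of_long_unique hH' fun s t hs ht hos hot h3s h3t => ?_)
    obtain ⟨s, hs₀, rfl⟩ := hs.exists_map_eq
    obtain ⟨t, ht₀, rfl⟩ := ht.exists_map_eq
    rw [Finset.card_map] at hos hot h3s h3t
    rw [(Set.ncard_le_one (Set.toFinite _)).1 hc s ⟨hs₀.isCycleSet hH, hos, h3s⟩ t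
      ⟨ht₀.isCycleSet hH, hot, h3t⟩]
  · refine hcol (by simp) (exists_coloring_of_few_triangles hH'
      (Finset.univ.filter (IsCyclicSet (H.map φ))) ?_ ?_ ?_ ?_ ?_)
    · exact fun C hC u hu v huv => (Finset.mem_filter.1 hC).2.isCore.mem_of_adj hH' hu huv
    · exact fun C hC C' hC' v hv hv' =>
        (Finset.mem_filter.1 hC).2.eq_of_mem hH' (Finset.mem_filter.1 hC').2 hv hv'
    · intro T hT hne
      obtain ⟨s, hsT, hs⟩ := hT.exists_isCycleSet_subset hne
      exact ⟨s, by simpa using hs.isCyclicSet, hsT⟩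
    · exact fun C hC => (Finset.mem_filter.1 hC).2.three_le_card
    · refine le_trans ?_ hc
      rw [Set.ncard_eq_toFinset_card']
      refine le_trans (Finset.card_le_card fun t ht => ?_)
        (Finset.card_image_le (f := Finset.map φ))
      rw [Finset.filter_filter, Finset.mem_filter] at ht
      obtain ⟨-, ht, ht3⟩ := ht
      obtain ⟨s, hs, rfl⟩ := ht.exists_map_eq
      rw [Finset.card_map] at ht3
      refine Finset.mem_image_of_mem _ ?_
      rw [Set.mem_toFinset]
      exact ⟨hs.isCycleSet hH, ht3⟩
end

section
/- Let H be a (finite simple) graph with maximum degree at most 2, and let G be obtained from H by gluing in vertex-disjoint copies of K_4. Then there is a set of vertices Z ⊆ V(G) with |Z| ≤ |V(G)|/22 such that the chromatic number of G − Z is at most 4. -/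
open SimpleGraph

section Alternating

lemma involution_apply_zpow {V : Type*} (f g : Equiv.Perm V)
    (hf : ∀ v, f (f v) = v) (hg : ∀ v, g (g v) = v) (k : ℤ) (v : V) :
    f (((f * g) ^ k) v) = ((f * g) ^ (-k)) (f v) := by
  have hfi : f⁻¹ = f := inv_eq_of_mul_eq_one_left (Equiv.ext hf)
  have hgi : g⁻¹ = g := inv_eq_of_mul_eq_one_left (Equiv.ext hg)
  have h : SemiconjBy f (f * g) (f * g)⁻¹ := by
    rw [SemiconjBy, mul_inv_rev, hfi, hgi, mul_assoc g f f, show f * f = 1 from Equiv.ext hf,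
      ← mul_assoc, show f * f = 1 from Equiv.ext hf, one_mul, mul_one]
  have h' := h.zpow_right k
  rw [inv_zpow'] at h'
  exact congrArg (fun e : Equiv.Perm V => e v) h'

lemma involution_apply_zpow' {V : Type*} (f g : Equiv.Perm V)
    (hf : ∀ v, f (f v) = v) (hg : ∀ v, g (g v) = v) (k : ℤ) (v : V) :
    g (((f * g) ^ k) v) = ((f * g) ^ (-(k + 1))) (f v) := by
  rw [← involution_apply_zpow f g hf hg, add_comm, zpow_one_add, Equiv.Perm.mul_apply,
    Equiv.Perm.mul_apply, hf]

/-- Two fixed-point-free involutions admit a common alternating 2-colouring. -/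
lemma exists_alternating_of_fixedPointFree {V : Type*} (f g : Equiv.Perm V)
    (hf : ∀ v, f (f v) = v) (hg : ∀ v, g (g v) = v) (hf' : ∀ v, f v ≠ v) (hg' : ∀ v, g v ≠ v) :
    ∃ c : V → Bool, (∀ v, c (f v) ≠ c v) ∧ ∀ v, c (g v) ≠ c v := by
  classical
  set σ := f * g with hσ
  have key : ∀ v, ¬ σ.SameCycle v (f v) := by
    rintro v ⟨k, hk⟩
    rcases Int.even_or_odd' k with ⟨j, rfl | rfl⟩
    · apply hf' ((σ ^ j) v)
      rw [involution_apply_zpow f g hf hg, ← hσ, ← hk, ← Equiv.Perm.mul_apply, ← zpow_add]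
      congr 2; ring
    · apply hg' ((σ ^ j) v)
      rw [involution_apply_zpow' f g hf hg, ← hσ, ← hk, ← Equiv.Perm.mul_apply, ← zpow_add]
      congr 2; ring
  let q : V → Quotient (Equiv.Perm.SameCycle.setoid σ) := fun v => Quotient.mk _ v
  have hq : ∀ v w, q v = q w ↔ σ.SameCycle v w := fun v w => Quotient.eq
  have hne : ∀ v, q v ≠ q (f v) := fun v h => key v ((hq _ _).1 h)
  have hσq : ∀ v, q (σ v) = q v := fun v => (hq _ _).2 ⟨-1, by simp⟩
  have hqg : ∀ v, q (g v) = q (f v) := by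
    intro v
    rw [hq]
    refine ⟨1, ?_⟩
    simp [hσ, hg]
  refine ⟨fun v => decide (WellOrderingRel (q v) (q (f v))), fun v => ?_, fun v => ?_⟩
  · simp only [hf, ne_eq, decide_eq_decide]
    rcases trichotomous_of WellOrderingRel (q v) (q (f v)) with h | h | h
    · have := asymm_of WellOrderingRel h; tauto
    · exact absurd h (hne v)
    · have := asymm_of WellOrderingRel h; tauto
  · have : q (f (g v)) = q v := hσq v
    simp only [hqg, this, ne_eq, decide_eq_decide]
    rcases trichotomous_of WellOrderingRel (q v) (q (f v)) with h | h | h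
    · have := asymm_of WellOrderingRel h; tauto
    · exact absurd h (hne v)
    · have := asymm_of WellOrderingRel h; tauto

/-- Two involutions admit a 2-colouring alternating along all their non-trivial orbits. -/
lemma exists_alternating {V : Type*} (f g : V → V)
    (hf : ∀ v, f (f v) = v) (hg : ∀ v, g (g v) = v) :
    ∃ c : V → Bool, (∀ v, f v ≠ v → c (f v) ≠ c v) ∧ ∀ v, g v ≠ v → c (g v) ≠ c v := by
  classical
  let dbl : (V → V) → V × Bool → V × Bool := fun f p =>
    if f p.1 = p.1 then (p.1, !p.2) else (f p.1, p.2)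
  have hd : ∀ f : V → V, (∀ v, f (f v) = v) → Function.Involutive (dbl f) := by
    rintro f hf ⟨v, b⟩
    by_cases h : f v = v
    · simp [dbl, h]
    · simp [dbl, h, hf, Ne.symm h]
  have hd' : ∀ f : V → V, ∀ p, dbl f p ≠ p := by
    rintro f ⟨v, b⟩
    by_cases h : f v = v <;> simp [dbl, h]
  obtain ⟨c, h1, h2⟩ := exists_alternating_of_fixedPointFree (hd f hf).toPerm (hd g hg).toPerm
    (hd f hf) (hd g hg) (hd' f) (hd' g)
  refine ⟨fun v => c (v, true), fun v hv => ?_, fun v hv => ?_⟩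
  · have := h1 (v, true)
    simpa [dbl, hv] using this
  · have := h2 (v, true)
    simpa [dbl, hv] using this

end Alternating

section Flip

/-- The component of a fixed point `v` of `f` in the graph of two involutions `f`, `g` contains at
most one other fixed point `w` of `f`, and alternating colourings separate `v` from `w`. -/
lemma exists_component {V : Type*} (f g : Equiv.Perm V)
    (hf : ∀ v, f (f v) = v) (hg : ∀ v, g (g v) = v) (v : V) (hv : f v = v) :
    ∃ (D : V → Prop) (w : V), D v ∧ D w ∧ (∀ y, D (f y) ↔ D y) ∧ (∀ y, D (g y) ↔ D y) ∧
      (∀ y, D y → f y = y → y = v ∨ y = w) ∧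
      ∀ x : V → Bool, (∀ y, f y ≠ y → x (f y) ≠ x y) → (∀ y, x (g y) ≠ x y) →
        w = v ∨ x w ≠ x v := by
  set σ := f * g with hσ
  have h1 : ∀ k : ℤ, f ((σ ^ k) v) = (σ ^ (-k)) v := fun k => by
    rw [involution_apply_zpow f g hf hg, hv]
  have h2 : ∀ k : ℤ, g ((σ ^ k) v) = (σ ^ (-(k + 1))) v := fun k => by
    rw [involution_apply_zpow' f g hf hg, hv]
  have hD1 : ∀ y, σ.SameCycle v y → σ.SameCycle v (f y) := by
    rintro y ⟨k, rfl⟩; exact ⟨-k, (h1 k).symm⟩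
  have hD2 : ∀ y, σ.SameCycle v y → σ.SameCycle v (g y) := by
    rintro y ⟨k, rfl⟩; exact ⟨_, (h2 k).symm⟩
  let S : AddSubgroup ℤ :=
    { carrier := {k | (σ ^ (2 * k)) v = v}
      zero_mem' := by simp
      add_mem' := by
        intro a b ha hb
        simp only [Set.mem_ofPred_eq] at ha hb ⊢
        rw [mul_add, zpow_add, Equiv.Perm.mul_apply, hb, ha]
      neg_mem' := by
        intro a ha
        simp only [Set.mem_ofPred_eq] at ha ⊢
        rw [mul_neg, zpow_neg, Equiv.Perm.inv_eq_iff_eq, ha] }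
  have hS : ∀ k, k ∈ S ↔ (σ ^ (2 * k)) v = v := fun k => Iff.rfl
  have hfix : ∀ k : ℤ, (σ ^ (-k)) v = (σ ^ k) v ↔ k ∈ S := by
    intro k
    rw [hS, zpow_neg, Equiv.Perm.inv_eq_iff_eq, ← Equiv.Perm.mul_apply, ← zpow_add, two_mul]
    exact eq_comm
  obtain ⟨a, ha⟩ := Int.subgroup_cyclic S
  have haS : ∀ k, k ∈ S ↔ ∃ z : ℤ, z * a = k := by
    intro k; rw [ha, AddSubgroup.mem_closure_singleton]; simp
  have haa : (a.natAbs : ℤ) ∈ S := by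
    rcases Int.natAbs_eq a with h | h
    · exact (haS _).2 ⟨1, by omega⟩
    · exact (haS _).2 ⟨-1, by omega⟩
  refine ⟨σ.SameCycle v, (σ ^ (a.natAbs : ℤ)) v, Equiv.Perm.SameCycle.refl _ _, ⟨_, rfl⟩,
    fun y => ⟨fun h => by simpa [hf] using hD1 _ h, hD1 y⟩,
    fun y => ⟨fun h => by simpa [hg] using hD2 _ h, hD2 y⟩, ?_, ?_⟩
  · rintro y ⟨k, rfl⟩ hy
    rw [h1, hfix, haS] at hy
    obtain ⟨z, rfl⟩ := hy
    obtain ⟨n, hn⟩ : ∃ n : ℤ, a.natAbs = n * a := by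
      obtain ⟨z, hz⟩ := (haS _).1 haa; exact ⟨z, hz.symm⟩
    have h2a : ∀ t : ℤ, (σ ^ (2 * (t * a))) v = v := fun t => (hS _).1 ((haS _).2 ⟨t, rfl⟩)
    rcases Int.even_or_odd' z with ⟨j, rfl | rfl⟩
    · left; rw [mul_assoc]; exact h2a j
    · right
      rcases Int.natAbs_eq a with h | h
      · rw [← h, show (2 * j + 1) * a = a + 2 * (j * a) by ring, zpow_add, Equiv.Perm.mul_apply, h2a]
      · have h' : (a.natAbs : ℤ) = - a := by omega
        rw [h', show (2 * j + 1) * a = -a + 2 * ((j + 1) * a) by ring, zpow_add,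
          Equiv.Perm.mul_apply, h2a]
  · intro x hxf hxg
    have hstep : ∀ k : ℤ, (k + 1 ∉ S → x ((σ ^ (k + 1)) v) = x ((σ ^ k) v)) ∧
        (k + 1 ∈ S → x ((σ ^ (k + 1)) v) ≠ x ((σ ^ k) v)) := by
      intro k
      have e1 := hxg ((σ ^ k) v)
      rw [h2] at e1
      constructor
      · intro hk
        have e2 := hxf ((σ ^ (-(k + 1))) v)
        rw [h1, neg_neg] at e2
        have e3 := e2 (fun h => hk ((hfix _).1 h.symm))
        revert e1 e3
        cases x ((σ ^ (-(k + 1))) v) <;> cases x ((σ ^ (k + 1)) v) <;> cases x ((σ ^ k) v) <;> simp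
      · intro hk
        rwa [(hfix _).2 hk] at e1
    rcases Nat.eq_zero_or_pos a.natAbs with h0 | h0
    · left; simp [h0]
    · right
      have hconst : ∀ k : ℕ, k < a.natAbs → x ((σ ^ (k : ℤ)) v) = x v := by
        intro k
        induction k with
        | zero => simp
        | succ k ih =>
          intro hk
          rw [← ih (by omega)]
          push_cast
          apply (hstep k).1
          intro h
          obtain ⟨z, hz⟩ := (haS _).1 h
          have h3 := Int.le_of_dvd (by omega) (Dvd.intro_left z hz)
          have h4 : a ∣ (k + 1 : ℤ) := Dvd.intro_left z hz
          have h5 := Nat.le_of_dvd (by omega) (Int.natAbs_dvd_natAbs.2 h4)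
          omega
      have e := (hstep ((a.natAbs - 1 : ℕ) : ℤ)).2
      rw [hconst _ (by omega), show (((a.natAbs - 1 : ℕ) : ℤ) + 1) = (a.natAbs : ℤ) by omega] at e
      exact e haa

end Flip

section Table

/-- Tables of integers indexed by bit strings of length `n`. -/
def BitTable : ℕ → Type
  | 0 => ℤ
  | n + 1 => BitTable n × BitTable n

namespace BitTable

def ofFun : (n : ℕ) → (List Bool → ℤ) → BitTable n
  | 0, φ => φ []
  | n + 1, φ => (ofFun n fun l => φ (true :: l), ofFun n fun l => φ (false :: l))

def eval : (n : ℕ) → BitTable n → List Bool → ℤ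
  | 0, t, _ => t
  | _ + 1, _, [] => 0
  | n + 1, t, b :: l => bif b then eval n t.1 l else eval n t.2 l

def add : (n : ℕ) → BitTable n → BitTable n → BitTable n
  | 0, s, t => Int.add s t
  | n + 1, s, t => (add n s.1 t.1, add n s.2 t.2)

/-- Fix the bit in position `j`. -/
def restrict (b : Bool) : (n : ℕ) → ℕ → BitTable (n + 1) → BitTable n
  | _, 0, t => bif b then t.1 else t.2
  | 0, _ + 1, t => t.1
  | n + 1, j + 1, t => (restrict b n j t.1, restrict b n j t.2)

def isNonpos : ℤ → Bool
  | .ofNat (_ + 1) => false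
  | _ => true

/-- For every partial matching of the positions, the sum of the table over the bit strings that
differ along the matching is nonpositive. -/
def check : (n : ℕ) → BitTable n → Bool
  | 0, t => isNonpos t
  | 1, t => isNonpos (Int.add t.1 t.2)
  | n + 2, t => check (n + 1) (add _ t.1 t.2) &&
      (List.range (n + 1)).all fun j => check n (add _ (restrict false n j t.1) (restrict true n j t.2))

lemma eval_ofFun : ∀ (n : ℕ) (φ : List Bool → ℤ) (l : List Bool), l.length = n →
    eval n (ofFun n φ) l = φ l
  | 0, φ, l, h => by simp [List.length_eq_zero_iff.1 h, eval, ofFun]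
  | n + 1, φ, [], h => by simp at h
  | n + 1, φ, b :: l, h => by
    have h' : l.length = n := by simpa using h
    cases b <;> simp [eval, ofFun, eval_ofFun n _ l h']

lemma eval_add : ∀ (n : ℕ) (s t : BitTable n) (l : List Bool),
    eval n (add n s t) l = eval n s l + eval n t l
  | 0, _, _, _ => rfl
  | n + 1, s, t, [] => by simp [eval]
  | n + 1, s, t, b :: l => by cases b <;> simp [eval, add, eval_add n]

lemma eval_restrict (b : Bool) : ∀ (n : ℕ) (t : BitTable (n + 1)) (l₁ l₂ : List Bool),
    (l₁ ++ l₂).length = n →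
      eval n (restrict b n l₁.length t) (l₁ ++ l₂) = eval (n + 1) t (l₁ ++ b :: l₂)
  | n, t, [], l₂, h => by cases n <;> cases b <;> rfl
  | 0, t, a :: l₁, l₂, h => by simp at h
  | n + 1, t, a :: l₁, l₂, h => by
    have h' : (l₁ ++ l₂).length = n := by simpa using h
    cases a
    · exact eval_restrict b n t.2 l₁ l₂ h'
    · exact eval_restrict b n t.1 l₁ l₂ h'

lemma isNonpos_iff : ∀ z : ℤ, isNonpos z = true ↔ z ≤ 0
  | .ofNat 0 => by simp [isNonpos]
  | .ofNat (n + 1) => by simp only [isNonpos]; simp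
  | .negSucc n => by simp only [isNonpos]; simp; omega

lemma check_zero {t : BitTable 0} (h : check 0 t = true) : eval 0 t [] ≤ 0 :=
  (isNonpos_iff _).1 h

lemma check_succ : ∀ {n : ℕ} {t : BitTable (n + 1)}, check (n + 1) t = true →
    check n (add n t.1 t.2) = true
  | 0, _, h => h
  | _ + 1, _, h => (Bool.and_eq_true_iff.1 h).1

lemma check_link {n : ℕ} {t : BitTable (n + 2)} (h : check (n + 2) t = true) {j : ℕ}
    (hj : j ≤ n) : check n (add n (restrict false n j t.1) (restrict true n j t.2)) = true := by
  have := (Bool.and_eq_true_iff.1 h).2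
  rw [List.all_eq_true] at this
  exact this j (List.mem_range.2 (by omega))

open Classical in
/-- A table passing `check` has nonpositive sum over the common alternating colourings of two
involutions `f`, `g`, evaluated at fixed points of `f`. -/
lemma sum_eval_nonpos {V : Type*} [Fintype V] (f g : Equiv.Perm V)
    (hf : ∀ v, f (f v) = v) (hg : ∀ v, g (g v) = v) : ∀ (n : ℕ) (t : BitTable n) (vs : List V),
    vs.length = n → vs.Nodup → (∀ v ∈ vs, f v = v) → check n t = true →
    ∑ x : V → Bool with (∀ y, f y ≠ y → x (f y) ≠ x y) ∧ ∀ y, x (g y) ≠ x y,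
      eval n t (vs.map x) ≤ 0 := by
  intro n
  induction n using Nat.strong_induction_on with
  | _ n ih =>
  rintro t (_ | ⟨v, vs⟩) hlen hnd hfix hc
  · obtain rfl : n = 0 := by simpa using hlen.symm
    exact Finset.sum_nonpos fun _ _ => check_zero hc
  obtain ⟨n, rfl⟩ : ∃ k, n = k + 1 := ⟨vs.length, by simpa using hlen.symm⟩
  have hlen' : vs.length = n := by simpa using hlen
  obtain ⟨D, w, hDv, hDw, hDf, hDg, hDfix, hx⟩ := exists_component f g hf hg v (hfix v (by simp))
  set A := Finset.univ.filter fun x : V → Bool =>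
    (∀ y, f y ≠ y → x (f y) ≠ x y) ∧ ∀ y, x (g y) ≠ x y with hA
  let flip : (V → Bool) → V → Bool := fun x y => if D y then !x y else x y
  have hflip : Function.Involutive flip := by
    intro x; funext y; by_cases h : D y <;> simp [flip, h]
  have hflipA : ∀ x ∈ A, flip x ∈ A := by
    intro x hx
    simp only [hA, Finset.mem_filter, Finset.mem_univ, true_and] at hx ⊢
    refine ⟨fun y hy => ?_, fun y => ?_⟩
    · have := hx.1 y hy
      by_cases h : D y <;> simpa [flip, h, hDf] using this
    · have := hx.2 y
      by_cases h : D y <;> simpa [flip, h, hDg] using this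
  have hsum : ∀ F : (V → Bool) → ℤ, 2 * ∑ x ∈ A, F x = ∑ x ∈ A, (F x + F (flip x)) := by
    intro F
    rw [two_mul, Finset.sum_add_distrib]
    congr 1
    exact Finset.sum_nbij' flip flip hflipA hflipA (fun x _ => hflip x) (fun x _ => hflip x)
      (fun x _ => by rw [hflip x])
  have hvD : ∀ x, flip x v = !x v := fun x => by simp [flip, hDv]
  have hother : ∀ u ∈ vs, u ≠ w → ∀ x, flip x u = x u := by
    intro u hu huw x
    have hnD : ¬ D u := by
      intro h
      rcases hDfix u h (hfix u (by simp [hu])) with rfl | rfl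
      · exact (List.nodup_cons.1 hnd).1 hu
      · exact huw rfl
    simp [flip, hnD]
  by_cases hw : w ∈ vs
  · obtain ⟨l₁, l₂, rfl⟩ := List.append_of_mem hw
    have hwv : w ≠ v := by rintro rfl; exact (List.nodup_cons.1 hnd).1 hw
    obtain ⟨n, rfl⟩ : ∃ k, n = k + 1 := ⟨(l₁ ++ l₂).length, by simp at hlen' ⊢; omega⟩
    have hl : (l₁ ++ l₂).length = n := by simp at hlen' ⊢; omega
    have hnd' := (List.nodup_cons.1 hnd).2
    have hsub : (l₁ ++ l₂).Sublist (l₁ ++ w :: l₂) := by simp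
    have hwn : w ∉ l₁ ++ l₂ := by
      have := List.nodup_middle.1 hnd'
      exact (List.nodup_cons.1 this).1
    have := ih n (by omega) (add n (restrict false n l₁.length t.1) (restrict true n l₁.length t.2))
      (l₁ ++ l₂) hl (hnd'.sublist hsub)
      (fun u hu => hfix u (List.mem_cons_of_mem _ (hsub.subset hu)))
      (check_link hc (by simp at hl; omega))
    have h2 := hsum fun x => eval (n + 1 + 1) t (List.map x (v :: (l₁ ++ w :: l₂)))
    have h3 : ∑ x ∈ A, (eval (n + 1 + 1) t (List.map x (v :: (l₁ ++ w :: l₂))) +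
        eval (n + 1 + 1) t (List.map (flip x) (v :: (l₁ ++ w :: l₂)))) =
        ∑ x ∈ A, eval n (add n (restrict false n l₁.length t.1) (restrict true n l₁.length t.2))
          (List.map x (l₁ ++ l₂)) := by
      refine Finset.sum_congr rfl fun x hxA => ?_
      have hxw : x w = !x v := by
        simp only [hA, Finset.mem_filter, Finset.mem_univ, true_and] at hxA
        have := (hx x hxA.1 hxA.2).resolve_left hwv
        revert this; cases x w <;> cases x v <;> simp
      have hfw : flip x w = x v := by simp [flip, hDw, hxw]
      have e1 : l₁.map (flip x) = l₁.map x := List.map_congr_left fun u hu =>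
        hother u (by simp [hu]) (by rintro rfl; exact hwn (by simp [hu])) x
      have e2 : l₂.map (flip x) = l₂.map x := List.map_congr_left fun u hu =>
        hother u (by simp [hu]) (by rintro rfl; exact hwn (by simp [hu])) x
      have hr := fun b s => eval_restrict b n s (l₁.map x) (l₂.map x) (by simpa using hl)
      simp only [List.length_map] at hr
      rw [eval_add]
      simp only [List.map_cons, List.map_append, e1, e2, hxw, hvD, hfw, hr]
      cases x v <;> simp [eval]
      exact add_comm _ _
    linarith [h3 ▸ h2]
  · have := ih n (by omega) (add n t.1 t.2) vs hlen' (List.nodup_cons.1 hnd).2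
      (fun u hu => hfix u (List.mem_cons_of_mem _ hu)) (check_succ hc)
    have h2 := hsum fun x => eval (n + 1) t (List.map x (v :: vs))
    have h3 : ∑ x ∈ A, (eval (n + 1) t (List.map x (v :: vs)) +
        eval (n + 1) t (List.map (flip x) (v :: vs))) =
        ∑ x ∈ A, eval n (add n t.1 t.2) (List.map x vs) := by
      refine Finset.sum_congr rfl fun x _ => ?_
      have e : vs.map (flip x) = vs.map x := List.map_congr_left fun u hu =>
        hother u hu (by rintro rfl; exact hw hu) x
      rw [eval_add]
      simp only [List.map_cons, e, hvD]
      cases x v <;> simp [eval]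
      exact add_comm _ _
    linarith [h3 ▸ h2]

end BitTable

/-- Cost of a colouring of an odd cycle, summed over its near-perfect alternating matchings. -/
def alternates : List Bool → Bool
  | a :: b :: l => (a != b) && alternates l
  | _ => true

def rotationCost (L : ℤ) (l : List Bool) : ℤ :=
  bif alternates l.tail then (bif l.head? == l.tail.head? && l.head? == l.getLast? then 10 - L else - L) else 0

def cycleCost (L : ℕ) (l : List Bool) : ℤ :=
  ((List.range L).map fun a => rotationCost L (l.rotate a)).sum


lemma check_cycleCost_five : BitTable.check 5 (.ofFun 5 (cycleCost 5)) = true := by decide +kernel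

lemma check_cycleCost_seven : BitTable.check 7 (.ofFun 7 (cycleCost 7)) = true := by decide +kernel

lemma check_cycleCost_nine : BitTable.check 9 (.ofFun 9 (cycleCost 9)) = true := by decide +kernel

end Table

section CycleMate

/-- Partner of position `d` in the alternating matching of a path `0, …, L - 1`, leaving out
position `0` if `L` is odd. -/
def pathMate (L d : ℕ) : ℕ :=
  if L % 2 = 1 then (if d = 0 then 0 else if d % 2 = 1 then d + 1 else d - 1)
  else if d % 2 = 0 then d + 1 else d - 1

lemma pathMate_lt {L d : ℕ} (h : d < L) : pathMate L d < L := by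
  unfold pathMate; split_ifs <;> omega

lemma pathMate_pathMate {L d : ℕ} : pathMate L (pathMate L d) = d := by
  simp only [pathMate]; grind

/-- The alternating matching of a cycle, leaving out `u` if the length is odd. -/
def cycleMate {L : ℕ} (u k : ZMod L) : ZMod L := u + (pathMate L (k - u).val : ℕ)

variable {L : ℕ}

lemma cycleMate_add {u : ZMod L} {d : ℕ} (h : d < L) :
    cycleMate u (u + d) = u + (pathMate L d : ℕ) := by
  simp [cycleMate, ZMod.val_natCast_of_lt h]

lemma natCast_inj_of_lt {a b : ℕ} (ha : a < L) (hb : b < L) (h : (a : ZMod L) = b) : a = b := by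
  rw [← ZMod.val_natCast_of_lt ha, h, ZMod.val_natCast_of_lt hb]

lemma cycleMate_self_iff {u : ZMod L} {d : ℕ} (h : d < L) :
    cycleMate u (u + d) = u + d ↔ pathMate L d = d := by
  rw [cycleMate_add h]
  constructor
  · intro h'
    exact natCast_inj_of_lt (pathMate_lt h) h (add_left_cancel h')
  · intro h'; rw [h']

variable [NeZero L]

lemma exists_eq_add_natCast (u k : ZMod L) : ∃ d < L, k = u + (d : ZMod L) :=
  ⟨(k - u).val, ZMod.val_lt _, by simp⟩

lemma cycleMate_cycleMate (u k : ZMod L) : cycleMate u (cycleMate u k) = k := by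
  obtain ⟨d, hd, rfl⟩ := exists_eq_add_natCast u k
  rw [cycleMate_add hd, cycleMate_add (pathMate_lt hd), pathMate_pathMate]

def MateAlternates (u : ZMod L) (x : ZMod L → Bool) : Prop :=
  ∀ k, cycleMate u k ≠ k → x (cycleMate u k) ≠ x k

lemma mateAlternates_iff {u : ZMod L} {x : ZMod L → Bool} : MateAlternates u x ↔
    ∀ d < L, pathMate L d ≠ d → x (u + (pathMate L d : ℕ)) ≠ x (u + d) := by
  constructor
  · intro h d hd hne
    rw [← cycleMate_add hd]
    exact h _ ((cycleMate_self_iff hd).not.2 hne)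
  · intro h k hk
    obtain ⟨d, hd, rfl⟩ := exists_eq_add_natCast u k
    rw [cycleMate_add hd]
    exact h d hd ((cycleMate_self_iff hd).not.1 hk)

/-- In an alternating colouring only the vertex left out can agree with both neighbours. -/
lemma MateAlternates.eq_of_bad {u k : ZMod L} {x : ZMod L → Bool} (h : MateAlternates u x)
    (hL : 2 ≤ L) (h1 : x (k + 1) = x k) (h2 : x (k - 1) = x k) : k = u ∧ L % 2 = 1 ∧ 5 ≤ L := by
  rw [mateAlternates_iff] at h
  obtain ⟨d, hd, rfl⟩ := exists_eq_add_natCast u k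
  have key : d = 0 ∧ L % 2 = 1 := by
    by_contra hc
    have h3 : pathMate L d = d + 1 ∨ pathMate L d + 1 = d := by
      unfold pathMate; split_ifs <;> omega
    have h4 := h d hd (by omega)
    rcases h3 with h3 | h3
    · rw [h3] at h4; push_cast at h4; rw [← add_assoc] at h4; exact h4 h1
    · apply h4
      rw [← h2]; congr 1
      rw [← h3, h3]; nth_rewrite 2 [← h3]; push_cast; ring
  obtain ⟨rfl, hodd⟩ := key
  refine ⟨by simp, hodd, ?_⟩
  by_contra hc
  obtain rfl : L = 3 := by omega
  have := h 1 (by omega) (by decide)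
  apply this
  simp only [Nat.cast_zero, add_zero] at h1 h2
  have e : ((pathMate 3 1 : ℕ) : ZMod 3) = -1 := by decide
  rw [e, ← sub_eq_add_neg, h2, Nat.cast_one, h1]

lemma alternates_map_range' (y : ℕ → Bool) : ∀ m s : ℕ,
    alternates ((List.range' s (2 * m)).map y) = true ↔
      ∀ j < m, y (s + 2 * j) ≠ y (s + 2 * j + 1)
  | 0, s => by simp [alternates]
  | m + 1, s => by
    have e : 2 * (m + 1) = 2 * m + 1 + 1 := by ring
    rw [e, List.range'_succ, List.range'_succ, List.map_cons, List.map_cons, alternates,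
      Bool.and_eq_true, alternates_map_range' y m, bne_iff_ne]
    constructor
    · rintro ⟨h1, h2⟩ (_ | j) hj
      · exact h1
      · have := h2 j (by omega)
        rw [show s + 2 * (j + 1) = s + 1 + 1 + 2 * j by ring]
        exact this
    · intro h
      refine ⟨h 0 (by omega), fun j hj => ?_⟩
      have := h (j + 1) (by omega)
      rwa [show s + 2 * (j + 1) = s + 1 + 1 + 2 * j by ring] at this

lemma mateAlternates_iff_alternates {m : ℕ} (hL : L = 2 * m + 1) (u : ZMod L) (x : ZMod L → Bool) :
    MateAlternates u x ↔
      alternates (((List.range L).map fun d : ℕ => x (u + d)).tail) = true := by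
  have e : (List.range L).map (fun d : ℕ => x (u + d)) =
      x (u + (0 : ℕ)) :: (List.range' (0 + 1) (2 * m)).map fun d : ℕ => x (u + d) := by
    rw [show List.range L = List.range (2 * m + 1) by rw [hL], List.range_eq_range',
      List.range'_succ, List.map_cons]
  rw [e, List.tail_cons, alternates_map_range' (fun d : ℕ => x (u + d)), mateAlternates_iff]
  constructor
  · intro h j hj
    have e : pathMate L (0 + 1 + 2 * j) = 0 + 1 + 2 * j + 1 := by
      unfold pathMate; split_ifs <;> omega
    have := h (0 + 1 + 2 * j) (by omega) (by omega)
    rw [e] at this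
    exact this.symm
  · intro h d hd hne
    have h3 : (d % 2 = 1 ∧ pathMate L d = d + 1) ∨ (d % 2 = 0 ∧ pathMate L d + 1 = d) := by
      revert hne
      unfold pathMate; split_ifs <;> omega
    rcases h3 with ⟨h3, h4⟩ | ⟨h3, h4⟩
    · have := h (d / 2) (by omega)
      rw [show 0 + 1 + 2 * (d / 2) = d by omega] at this
      rw [h4]; exact this.symm
    · have := h (d / 2 - 1) (by omega)
      rw [show 0 + 1 + 2 * (d / 2 - 1) = pathMate L d by omega, h4] at this
      exact this

open Classical in
lemma rotationCost_eq {m : ℕ} (hL : L = 2 * m + 1) (hm : 1 ≤ m) (u : ZMod L) (x : ZMod L → Bool) :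
    rotationCost L ((List.range L).map fun d : ℕ => x (u + d)) =
      if MateAlternates u x then
        (if x (u + 1) = x u ∧ x (u - 1) = x u then 10 - (L : ℤ) else - L) else 0 := by
  have h1 := mateAlternates_iff_alternates hL u x
  unfold rotationCost
  have hL1 : ((L - 1 : ℕ) : ZMod L) = -1 := by
    rw [Nat.cast_sub NeZero.one_le]; simp
  have hlast : ((List.range L).map fun d : ℕ => x (u + d)).getLast? = some (x (u - 1)) := by
    rw [List.getLast?_eq_getElem?, List.getElem?_map, List.getElem?_range (by simp; omega)]
    simp [hL1, sub_eq_add_neg]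
  have hhead : ((List.range L).map fun d : ℕ => x (u + d)).head? = some (x u) := by
    rw [List.head?_eq_getElem?, List.getElem?_map, List.getElem?_range (by omega)]
    simp
  have hhead' : ((List.range L).map fun d : ℕ => x (u + d)).tail.head? = some (x (u + 1)) := by
    rw [List.head?_eq_getElem?, List.getElem?_tail, List.getElem?_map,
      List.getElem?_range (by omega)]
    simp
  rw [hlast, hhead, hhead']
  by_cases h : MateAlternates u x
  · rw [h1.1 h]
    simp only [h, cond_true, if_true]
    cases x (u + 1) <;> cases x u <;> cases x (u - 1) <;> rfl
  · rw [Bool.eq_false_iff.2 (h1.not.1 h)]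
    simp [h]

open Classical in
lemma cycleCost_eq {m : ℕ} (hL : L = 2 * m + 1) (hm : 1 ≤ m) (x : ZMod L → Bool) :
    cycleCost L ((List.range L).map fun d : ℕ => x d) =
      ∑ u, if MateAlternates u x then
        (if x (u + 1) = x u ∧ x (u - 1) = x u then 10 - (L : ℤ) else - L) else 0 := by
  have hrot : ∀ a < L, ((List.range L).map fun d : ℕ => x d).rotate a =
      (List.range L).map fun d : ℕ => x ((a : ZMod L) + d) := by
    intro a _
    apply List.ext_getElem
    · simp
    · intro i h1 h2
      simp [List.getElem_rotate, add_comm]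
  have : (List.range L).map (fun a => rotationCost L
      (((List.range L).map fun d : ℕ => x d).rotate a)) = (List.range L).map fun a : ℕ =>
        if MateAlternates (a : ZMod L) x then
        (if x ((a : ZMod L) + 1) = x a ∧ x ((a : ZMod L) - 1) = x a then 10 - (L : ℤ) else - L) else 0 := by
    apply List.map_congr_left
    intro a ha
    rw [hrot a (by simpa using ha), rotationCost_eq hL hm]
  rw [cycleCost, this]
  rw [← List.sum_toFinset _ List.nodup_range, List.toFinset_range]
  refine Finset.sum_nbij' (fun a : ℕ => (a : ZMod L)) ZMod.val (by simp) (by simp [ZMod.val_lt])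
    (fun a ha => ZMod.val_natCast_of_lt (by simpa using ha)) (by simp) (by simp)

end CycleMate

section OddCycleCost

lemma Fin.exists_unique_partner : ∀ b : Fin 4 → Bool, b 0 ≠ b 1 → b 2 ≠ b 3 →
    ∃ p : Fin 4 → Fin 4, ∀ j, p (p j) = j ∧ p j ≠ j ∧ b (p j) = b j ∧
      ∀ j', j' ≠ j → b j' = b j → j' = p j := by
  intro b h1 h2
  refine ⟨fun j => if b (j + 2) = b j then j + 2 else ![3, 2, 1, 0] j, ?_⟩
  revert b
  decide

variable {ι : Type} (L : ι → ℕ)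

/-- Successor along the cycles. -/
def cycleNext : Equiv.Perm (Σ i, ZMod (L i)) := Equiv.sigmaCongrRight fun _ => Equiv.addRight 1

lemma cycleNext_mk (i : ι) (k : ZMod (L i)) : cycleNext L ⟨i, k⟩ = ⟨i, k + 1⟩ := rfl

/-- The union of the alternating matchings of the cycles in `s`. -/
def mateOn (s : Set ι) [DecidablePred (· ∈ s)] (u : ∀ i, ZMod (L i)) (v : Σ i, ZMod (L i)) :
    Σ i, ZMod (L i) :=
  if v.1 ∈ s then ⟨v.1, cycleMate (u v.1) v.2⟩ else v

lemma mateOn_mateOn [∀ i, NeZero (L i)] (s : Set ι) [DecidablePred (· ∈ s)] (u : ∀ i, ZMod (L i))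
    (v : Σ i, ZMod (L i)) : mateOn L s u (mateOn L s u v) = v := by
  obtain ⟨i, k⟩ := v
  by_cases h : i ∈ s
  · have e : ∀ k, mateOn L s u ⟨i, k⟩ = ⟨i, cycleMate (u i) k⟩ := fun k => if_pos h
    rw [e, e, cycleMate_cycleMate]
  · have e : mateOn L s u ⟨i, k⟩ = ⟨i, k⟩ := if_neg h
    rw [e, e]

lemma mateOn_alternates_iff (s : Set ι) [DecidablePred (· ∈ s)] (u : ∀ i, ZMod (L i))
    (x : (Σ i, ZMod (L i)) → Bool) :
    (∀ v, mateOn L s u v ≠ v → x (mateOn L s u v) ≠ x v) ↔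
      ∀ i ∈ s, MateAlternates (u i) fun k => x ⟨i, k⟩ := by
  constructor
  · intro h i hi k hk
    have := h ⟨i, k⟩
    simp only [mateOn, hi, if_true] at this
    exact this (by simpa using hk)
  · rintro h ⟨i, k⟩ hne
    by_cases hi : i ∈ s
    · simp only [mateOn, hi, if_true] at hne ⊢
      exact h i hi k (by simpa using hne)
    · simp [mateOn, hi] at hne

/-- The vertex `⟨i, k⟩` has the colour of both its neighbours. -/
def Bad (x : (Σ i, ZMod (L i)) → Bool) (i : ι) (k : ZMod (L i)) : Prop :=
  x ⟨i, k + 1⟩ = x ⟨i, k⟩ ∧ x ⟨i, k - 1⟩ = x ⟨i, k⟩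

lemma check_cycleCost (l : ℕ) (h5 : 5 ≤ l) (h10 : l < 10) (hodd : l % 2 = 1) :
    BitTable.check l (.ofFun l (cycleCost l)) = true := by
  obtain rfl | rfl | rfl : l = 5 ∨ l = 7 ∨ l = 9 := by omega
  · exact check_cycleCost_five
  · exact check_cycleCost_seven
  · exact check_cycleCost_nine

variable [Fintype ι] [DecidableEq ι] [∀ i, NeZero (L i)]

open Classical in
/-- Fixing everything outside one short odd cycle, the left-out vertex is bad with probability
at most one tenth of the length. -/
lemma sum_cost_update_nonpos (g : Equiv.Perm (Σ i, ZMod (L i))) (hg : ∀ v, g (g v) = v)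
    (u : ∀ i, ZMod (L i)) (i : ι) (hodd : L i % 2 = 1) (h5 : 5 ≤ L i) :
    ∑ a : ZMod (L i), ∑ x : (Σ i, ZMod (L i)) → Bool with
      (∀ j, MateAlternates (Function.update u i a j) fun k => x ⟨j, k⟩) ∧ ∀ v, x (g v) ≠ x v,
      (if Bad L x i a then 10 - (L i : ℤ) else - L i) ≤ 0 := by
  rcases lt_or_ge (L i) 10 with h10 | h10
  swap
  · refine Finset.sum_nonpos fun a _ => Finset.sum_nonpos fun x _ => ?_
    split_ifs <;> omega
  have hinv : Function.Involutive (mateOn L {i}ᶜ u) := mateOn_mateOn L {i}ᶜ u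
  let f : Equiv.Perm (Σ i, ZMod (L i)) := Function.Involutive.toPerm _ hinv
  have key := BitTable.sum_eval_nonpos f g hinv hg (L i) (.ofFun (L i) (cycleCost (L i)))
    ((List.range (L i)).map fun d : ℕ => (⟨i, d⟩ : Σ i, ZMod (L i))) (by simp)
    (List.nodup_range.map_on (fun a ha b hb h => natCast_inj_of_lt (by simpa using ha)
      (by simpa using hb) (by simpa using h)))
    (by
      intro v hv
      obtain ⟨d, -, rfl⟩ := List.mem_map.1 hv
      change mateOn L {i}ᶜ u _ = _
      simp [mateOn]) (check_cycleCost _ h5 h10 hodd)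
  refine le_trans (le_of_eq ?_) key
  simp only [Finset.sum_filter]
  rw [Finset.sum_comm]
  refine Finset.sum_congr (Finset.ext fun _ => by simp) fun x _ => ?_
  have e1 : (∀ v, f v ≠ v → x (f v) ≠ x v) ↔
    ∀ j ∈ ({i}ᶜ : Set ι), MateAlternates (u j) fun k => x ⟨j, k⟩ := mateOn_alternates_iff L {i}ᶜ u x
  have e2 : ∀ a, (∀ j, MateAlternates (Function.update u i a j) fun k => x ⟨j, k⟩) ↔
      MateAlternates a (fun k => x ⟨i, k⟩) ∧
        ∀ j ∈ ({i}ᶜ : Set ι), MateAlternates (u j) fun k => x ⟨j, k⟩ := by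
    intro a
    constructor
    · intro h
      refine ⟨by simpa using h i, fun j hj => ?_⟩
      have := h j
      rwa [Function.update_of_ne hj] at this
    · rintro ⟨h1, h2⟩ j
      by_cases hj : j = i
      · subst hj; simpa using h1
      · rw [Function.update_of_ne hj]; exact h2 j hj
  simp only [e1, e2]
  rw [BitTable.eval_ofFun _ _ _ (by simp), List.map_map]
  have := cycleCost_eq (L := L i) (m := L i / 2) (by omega) (by omega) fun k => x ⟨i, k⟩
  rw [show (List.range (L i)).map (x ∘ fun d : ℕ => (⟨i, d⟩ : Σ i, ZMod (L i))) =
    (List.range (L i)).map (fun d : ℕ => x ⟨i, d⟩) from rfl, this]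
  by_cases h : (∀ j ∈ ({i}ᶜ : Set ι), MateAlternates (u j) fun k => x ⟨j, k⟩) ∧ ∀ v, x (g v) ≠ x v
  · rw [if_pos h]
    refine Finset.sum_congr rfl fun a _ => ?_
    by_cases hm : MateAlternates a fun k => x ⟨i, k⟩
    · rw [if_pos ⟨⟨hm, h.1⟩, h.2⟩, if_pos hm]
      exact if_congr Iff.rfl rfl rfl
    · rw [if_neg fun hh => hm hh.1.1, if_neg hm]
  · rw [if_neg h]
    refine Finset.sum_eq_zero fun a _ => ?_
    rw [if_neg]
    tauto

open Classical in
/-- There are left-out vertices and an alternating colouring with few bad vertices. -/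
lemma exists_alternating_few_bad (g : Equiv.Perm (Σ i, ZMod (L i))) (hg : ∀ v, g (g v) = v)
    (hg' : ∀ v, g v ≠ v) :
    ∃ (u : ∀ i, ZMod (L i)) (x : (Σ i, ZMod (L i)) → Bool),
      (∀ j, MateAlternates (u j) fun k => x ⟨j, k⟩) ∧ (∀ v, x (g v) ≠ x v) ∧
      10 * (Finset.univ.filter fun i => L i % 2 = 1 ∧ 5 ≤ L i ∧ Bad L x i (u i)).card ≤
        ∑ i with L i % 2 = 1 ∧ 5 ≤ L i, L i := by
  let A : (∀ i, ZMod (L i)) → Finset ((Σ i, ZMod (L i)) → Bool) := fun u =>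
    Finset.univ.filter fun x =>
      (∀ j, MateAlternates (u j) fun k => x ⟨j, k⟩) ∧ ∀ v, x (g v) ≠ x v
  let cost : (∀ i, ZMod (L i)) → ((Σ i, ZMod (L i)) → Bool) → ι → ℤ := fun u x i =>
    if Bad L x i (u i) then 10 - (L i : ℤ) else - L i
  have hcost : ∀ i, L i % 2 = 1 → 5 ≤ L i → ∑ u, ∑ x ∈ A u, cost u x i ≤ 0 := by
    intro i hodd h5
    have e : ∑ u, ∑ a, ∑ x ∈ A (Function.update u i a), cost (Function.update u i a) x i =
        ∑ u : (∀ i, ZMod (L i)), ∑ _a : ZMod (L i), ∑ x ∈ A u, cost u x i := by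
      rw [← Finset.sum_product', ← Finset.sum_product']
      refine Finset.sum_nbij' (fun p => (Function.update p.1 i p.2, p.1 i))
        (fun p => (Function.update p.1 i p.2, p.1 i)) (by simp) (by simp) (by simp) (by simp)
        (by simp)
    have h1 : ∑ u, ∑ a, ∑ x ∈ A (Function.update u i a), cost (Function.update u i a) x i ≤ 0 := by
      refine Finset.sum_nonpos fun u _ => ?_
      simpa [A, cost] using sum_cost_update_nonpos L g hg u i hodd h5
    rw [e] at h1
    simp only [Finset.sum_const, Finset.card_univ, ZMod.card, ← Finset.smul_sum] at h1
    rw [nsmul_eq_mul] at h1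
    have hpos : (0 : ℤ) < L i := by omega
    exact nonpos_of_mul_nonpos_right h1 hpos
  have htotal : ∑ u, ∑ x ∈ A u, ∑ i with L i % 2 = 1 ∧ 5 ≤ L i, cost u x i ≤ 0 := by
    have : ∑ u, ∑ x ∈ A u, ∑ i with L i % 2 = 1 ∧ 5 ≤ L i, cost u x i =
        ∑ i with L i % 2 = 1 ∧ 5 ≤ L i, ∑ u, ∑ x ∈ A u, cost u x i := by
      rw [Finset.sum_comm (s := Finset.univ.filter _)]
      refine Finset.sum_congr rfl fun u _ => Finset.sum_comm
    rw [this]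
    refine Finset.sum_nonpos fun i hi => ?_
    obtain ⟨-, h1, h2⟩ := Finset.mem_filter.1 hi
    exact hcost i h1 h2
  have hne : ∀ u, (A u).Nonempty := by
    intro u
    obtain ⟨x, h1, h2⟩ := exists_alternating (mateOn L Set.univ u) g (mateOn_mateOn L _ u) hg
    refine ⟨x, Finset.mem_filter.2 ⟨Finset.mem_univ _, fun j => ?_, fun v => h2 v (hg' v)⟩⟩
    exact (mateOn_alternates_iff L Set.univ u x).1 h1 j trivial
  obtain ⟨u, x, hx, hc⟩ : ∃ u, ∃ x ∈ A u, ∑ i with L i % 2 = 1 ∧ 5 ≤ L i, cost u x i ≤ 0 := by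
    by_contra! hcon
    refine absurd htotal (not_le.2 ?_)
    exact Finset.sum_pos (fun u _ => Finset.sum_pos (hcon u) (hne u)) ⟨fun _ => 0, by simp⟩
  obtain ⟨-, hx1, hx2⟩ := Finset.mem_filter.1 hx
  refine ⟨u, x, hx1, hx2, ?_⟩
  have e : ∀ i, cost u x i = (if Bad L x i (u i) then 10 else 0) - (L i : ℤ) := by
    intro i; simp only [cost]; split_ifs <;> ring
  simp only [e, Finset.sum_sub_distrib] at hc
  rw [← Finset.sum_filter, Finset.sum_const, Finset.filter_filter] at hc
  simp only [and_assoc, nsmul_eq_mul] at hc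
  have h10 : ∀ s : Finset ι, ∑ i ∈ s, (L i : ℤ) = ((∑ i ∈ s, L i : ℕ) : ℤ) := by simp
  rw [h10] at hc
  omega

end OddCycleCost

section OddCycleColoring

variable {ι κ : Type} (L : ι → ℕ) (e : (Σ i, ZMod (L i)) ≃ κ × Fin 4)

/-- Outside `Z`, the map `col` is a proper colouring of the union of the cycles and the classes. -/
def IsProperOff (Z : Finset (Σ i, ZMod (L i))) (col : (Σ i, ZMod (L i)) → Fin 4) : Prop :=
  (∀ u v, u ∉ Z → v ∉ Z → (e u).1 = (e v).1 → u ≠ v → col u ≠ col v) ∧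
    ∀ u, u ∉ Z → cycleNext L u ∉ Z → cycleNext L u ≠ u → col u ≠ col (cycleNext L u)

/-- A perfect matching of each class. -/
def classMate : Equiv.Perm (Σ i, ZMod (L i)) :=
  e.trans ((Equiv.prodCongr (Equiv.refl κ) (Equiv.swap 0 1 * Equiv.swap 2 3)).trans e.symm)

lemma classMate_classMate (v : Σ i, ZMod (L i)) : classMate L e (classMate L e v) = v := by
  have : ∀ j : Fin 4, (Equiv.swap 0 1 * Equiv.swap 2 3 : Equiv.Perm (Fin 4))
    ((Equiv.swap 0 1 * Equiv.swap 2 3 : Equiv.Perm (Fin 4)) j) = j := by decide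
  simp only [classMate, Equiv.trans_apply, Equiv.apply_symm_apply, Equiv.prodCongr_apply,
    Prod.map, this]
  simp

lemma classMate_ne (v : Σ i, ZMod (L i)) : classMate L e v ≠ v := by
  have : ∀ j : Fin 4, (Equiv.swap 0 1 * Equiv.swap 2 3 : Equiv.Perm (Fin 4)) j ≠ j := by decide
  intro h
  have h2 := congrArg (fun v => (e v).2) h
  simp only [classMate, Equiv.trans_apply, Equiv.apply_symm_apply, Equiv.prodCongr_apply,
    Prod.map] at h2
  exact this _ h2

lemma classMate_symm_apply (c : κ) (j : Fin 4) : classMate L e (e.symm (c, j)) =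
    e.symm (c, (Equiv.swap 0 1 * Equiv.swap 2 3 : Equiv.Perm (Fin 4)) j) := by
  simp [classMate]

/-- A colouring that bisects every class gives an involution matching equally coloured vertices. -/
lemma exists_sameColor_involution (x : (Σ i, ZMod (L i)) → Bool)
    (hx : ∀ v, x (classMate L e v) ≠ x v) :
    ∃ g : (Σ i, ZMod (L i)) → Σ i, ZMod (L i), (∀ v, g (g v) = v) ∧ (∀ v, g v ≠ v) ∧
      ∀ u v, (e u).1 = (e v).1 → u ≠ v → x u = x v → u = g v := by
  have hp : ∀ c : κ, ∃ p : Fin 4 → Fin 4, ∀ j, p (p j) = j ∧ p j ≠ j ∧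
      x (e.symm (c, p j)) = x (e.symm (c, j)) ∧
      ∀ j', j' ≠ j → x (e.symm (c, j')) = x (e.symm (c, j)) → j' = p j := by
    intro c
    refine Fin.exists_unique_partner (fun j => x (e.symm (c, j))) ?_ ?_
    · have := hx (e.symm (c, 1))
      rw [classMate_symm_apply] at this
      exact this
    · have := hx (e.symm (c, 3))
      rw [classMate_symm_apply] at this
      exact this
  choose p hp using hp
  refine ⟨fun v => e.symm ((e v).1, p (e v).1 (e v).2), fun v => ?_, fun v h => ?_,
    fun u v huv hne hxx => ?_⟩
  · simp [(hp _ _).1]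
  · have := congrArg (fun v => (e v).2) h
    simp only [Equiv.apply_symm_apply] at this
    exact (hp _ _).2.1 this
  · have h := (hp (e v).1 (e v).2).2.2.2 (e u).2 (fun h => hne (e.injective (Prod.ext huv h)))
      (by rw [show ((e v).1, (e u).2) = e u from Prod.ext huv.symm rfl]; simpa using hxx)
    change u = e.symm ((e v).1, p (e v).1 (e v).2)
    rw [← h, ← huv]; simp

/-- If the components of the "equal colour" relation have at most two elements, they form an
involution along the cycles. -/
lemma exists_next_involution (x : (Σ i, ZMod (L i)) → Bool) (Z : Finset (Σ i, ZMod (L i)))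
    (hZ : ∀ v, cycleNext L v ≠ v → x (cycleNext L v) = x v → x ((cycleNext L).symm v) = x v →
      v ∈ Z) :
    ∃ f : (Σ i, ZMod (L i)) → Σ i, ZMod (L i), (∀ v, f (f v) = v) ∧
      ∀ v, v ∉ Z → cycleNext L v ∉ Z → cycleNext L v ≠ v → x (cycleNext L v) = x v →
        f v = cycleNext L v := by
  classical
  set n := cycleNext L
  let R : (Σ i, ZMod (L i)) → Prop := fun v => v ∉ Z ∧ n v ∉ Z ∧ n v ≠ v ∧ x (n v) = x v
  have hR : ∀ v, R v → ¬ R (n v) := by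
    rintro v ⟨h1, h2, h3, h4⟩ ⟨h5, h6, h7, h8⟩
    exact h2 (hZ _ h7 h8 (by simp [h4]))
  refine ⟨fun v => if R v then n v else if R (n.symm v) then n.symm v else v, fun v => ?_,
    fun v h1 h2 h3 h4 => if_pos ⟨h1, h2, h3, h4⟩⟩
  by_cases h : R v
  · simp [h, hR v h]
  · by_cases h' : R (n.symm v)
    · simp [h, h']
    · simp [h, h']

theorem exists_isProperOff_odd [Fintype ι] [DecidableEq ι] [∀ i, NeZero (L i)] :
    ∃ Z col, IsProperOff L e Z col ∧ 10 * Z.card ≤ ∑ i with L i % 2 = 1 ∧ 5 ≤ L i, L i := by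
  classical
  obtain ⟨u, x, hx1, hx2, hcard⟩ := exists_alternating_few_bad L (classMate L e)
    (classMate_classMate L e) (classMate_ne L e)
  set n := cycleNext L with hn
  let Z : Finset (Σ i, ZMod (L i)) := Finset.univ.filter fun v =>
    n v ≠ v ∧ x (n v) = x v ∧ x (n.symm v) = x v
  obtain ⟨f, hf, hf'⟩ := exists_next_involution L x Z (fun v h1 h2 h3 => by simp [Z, h1, h2, h3, hn])
  obtain ⟨g, hg, hgne, hg'⟩ := exists_sameColor_involution L e x hx2
  obtain ⟨y, hy1, hy2⟩ := exists_alternating f g hf hg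
  have φ : Bool × Bool ≃ Fin 4 := Fintype.equivFinOfCardEq (by simp)
  refine ⟨Z, fun v => φ (x v, y v), ⟨fun v w _ _ hvw hne h => ?_, fun v h1 h2 h3 h => ?_⟩,
    le_trans ?_ hcard⟩
  · obtain ⟨hxx, hyy⟩ := Prod.ext_iff.1 (φ.injective h)
    have := hg' v w hvw hne hxx
    refine hy2 w (hgne w) ?_
    rw [← this]; exact hyy
  · obtain ⟨hxx, hyy⟩ := Prod.ext_iff.1 (φ.injective h)
    have := hf' v h1 h2 h3 hxx.symm
    refine hy1 v (by rwa [this]) ?_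
    rw [this]; exact hyy.symm
  · refine Nat.mul_le_mul_left _ (Finset.card_le_card_of_injOn Sigma.fst ?_ ?_)
    all_goals
      have key : ∀ v ∈ Z, v.2 = u v.1 ∧ L v.1 % 2 = 1 ∧ 5 ≤ L v.1 ∧ Bad L x v.1 v.2 := by
        rintro ⟨i, k⟩ hv
        obtain ⟨-, h1, h2, h3⟩ := Finset.mem_filter.1 hv
        have hL : 2 ≤ L i := by
          by_contra hc
          have hone : L i = 1 := by have := NeZero.ne (L i); omega
          refine h1 ?_
          rw [hn, cycleNext_mk]
          have : Subsingleton (ZMod (L i)) := by rw [hone]; infer_instance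
          rw [Subsingleton.elim (k + 1) k]
        have h3' : x ⟨i, k - 1⟩ = x ⟨i, k⟩ := by
          rw [← h3]; congr 1
          rw [Equiv.eq_symm_apply, hn, cycleNext_mk, sub_add_cancel]
        obtain ⟨h4, h5, h6⟩ := (hx1 i).eq_of_bad hL h2 h3'
        exact ⟨h4, h5, h6, h2, h3'⟩
    · intro v hv
      obtain ⟨h1, h2, h3, h4⟩ := key v hv
      rw [h1] at h4
      simp [h2, h3, h4]
    · rintro ⟨i, k⟩ hv ⟨j, l⟩ hw (rfl : i = j)
      rw [show k = u i from (key _ hv).1, show l = u i from (key _ hw).1]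

end OddCycleColoring

section Parity

variable {J : Type} [Fintype J] [DecidableEq J]

lemma sum_eq_zero_of_sum_update (j : J) (φ : (J → Fin 3) → ZMod 2)
    (h : ∀ s, ∑ a, φ (Function.update s j a) = 0) : ∑ s, φ s = 0 := by
  have e : ∑ s, ∑ a, φ (Function.update s j a) = ∑ s : J → Fin 3, ∑ _a : Fin 3, φ s := by
    rw [← Finset.sum_product', ← Finset.sum_product']
    exact Finset.sum_nbij' (fun p => (Function.update p.1 j p.2, p.1 j))
      (fun p => (Function.update p.1 j p.2, p.1 j)) (by simp) (by simp) (by simp) (by simp)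
      (by simp)
  simp only [h, Finset.sum_const_zero, Finset.sum_const, Finset.card_univ, Fintype.card_fin] at e
  rw [← Finset.smul_sum, nsmul_eq_mul] at e
  have h3 : ((3 : ℕ) : ZMod 2) = 1 := by decide
  rw [h3, one_mul] at e
  exact e.symm

variable (b : J → J → Fin 3 → Fin 3 → ZMod 2)

/-- The entry of `b` at `j, l`, with diagonal entries replaced by `1`. -/
def parityEntry (s : J → Fin 3) (j l : J) : ZMod 2 := if l = j then 1 else b j l (s j) (s l)

variable {b}

lemma sum_prod_parityEntry_of_notMem_range (hsum : ∀ j l t, ∑ a, b j l a t = 0) (F : J → J) (j : J)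
    (hj : j ∉ Set.range F) : ∑ s, ∏ i, parityEntry b s i (F i) = 0 := by
  refine sum_eq_zero_of_sum_update j _ fun s => ?_
  have hF : ∀ i, F i ≠ j := fun i h => hj ⟨i, h⟩
  have e : ∀ a, ∏ i, parityEntry b (Function.update s j a) i (F i) =
      b j (F j) a (s (F j)) * ∏ i ∈ Finset.univ.erase j, parityEntry b s i (F i) := by
    intro a
    rw [← Finset.mul_prod_erase _ _ (Finset.mem_univ j)]
    congr 1
    · simp [parityEntry, hF]
    · refine Finset.prod_congr rfl fun i hi => ?_
      simp [parityEntry, hF, Finset.ne_of_mem_erase hi]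
  simp only [e, ← Finset.sum_mul, hsum, zero_mul]

lemma prod_parityEntry_inv (hsymm : ∀ j l a t, b j l a t = b l j t a) (σ : Equiv.Perm J)
    (s : J → Fin 3) : ∏ i, parityEntry b s i (σ⁻¹ i) = ∏ i, parityEntry b s i (σ i) := by
  rw [← Equiv.prod_comp σ]
  refine Finset.prod_congr rfl fun i _ => ?_
  have h : σ⁻¹ (σ i) = i := by simp
  simp only [h, parityEntry, hsymm i, eq_comm (a := i)]

lemma sum_prod_parityEntry_of_inv_eq (hsymm : ∀ j l a t, b j l a t = b l j t a)
    (hsum : ∀ j l t, ∑ a, b j l a t = 0) (σ : Equiv.Perm J) (hσ : σ⁻¹ = σ) (hne : σ ≠ 1) :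
    ∑ s, ∏ i, parityEntry b s i (σ i) = 0 := by
  obtain ⟨j, hj⟩ : ∃ j, σ j ≠ j := by
    by_contra! h
    exact hne (Equiv.ext h)
  have hjj : σ (σ j) = j := by
    nth_rewrite 1 [← hσ]; simp
  refine sum_eq_zero_of_sum_update j _ fun s => ?_
  have hsq : ∀ z : ZMod 2, z * z = z := by decide
  have e : ∀ a, ∏ i, parityEntry b (Function.update s j a) i (σ i) =
      b j (σ j) a (s (σ j)) *
        ∏ i ∈ (Finset.univ.erase j).erase (σ j), parityEntry b s i (σ i) := by
    intro a
    rw [← Finset.mul_prod_erase _ _ (Finset.mem_univ j), ← Finset.mul_prod_erase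
      (Finset.univ.erase j) _ (Finset.mem_erase.2 ⟨hj, Finset.mem_univ (σ j)⟩), ← mul_assoc]
    congr 1
    · simp only [parityEntry, hjj, hj, hj.symm, if_false, Function.update_self, ne_eq,
        not_false_eq_true, Function.update_of_ne]
      rw [hsymm (σ j), hsq]
    · refine Finset.prod_congr rfl fun i hi => ?_
      have h1 := Finset.ne_of_mem_erase hi
      have h2 := Finset.ne_of_mem_erase (Finset.mem_of_mem_erase hi)
      have h3 : σ i ≠ j := fun h => h1 (σ.injective (h.trans hjj.symm))
      simp [parityEntry, h2, h3]
  simp only [e, ← Finset.sum_mul, hsum, zero_mul]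

theorem sum_prod_one_add_eq_one (hdiag : ∀ j a t, b j j a t = 0)
    (hsymm : ∀ j l a t, b j l a t = b l j t a) (hsum : ∀ j l t, ∑ a, b j l a t = 0) :
    ∑ s : J → Fin 3, ∏ j, (1 + ∑ l, b j l (s j) (s l)) = 1 := by
  have e : ∀ (s : J → Fin 3) j, 1 + ∑ l, b j l (s j) (s l) = ∑ l, parityEntry b s j l := by
    intro s j
    have : ∀ l, parityEntry b s j l = (if l = j then 1 else 0) + b j l (s j) (s l) := by
      intro l
      unfold parityEntry
      split_ifs with h
      · subst h; simp [hdiag]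
      · simp
    simp only [this, Finset.sum_add_distrib]
    simp
  simp only [e, Finset.prod_univ_sum, Fintype.piFinset_univ]
  rw [Finset.sum_comm]
  rw [← Fintype.sum_of_injective (fun σ : Equiv.Perm J => (σ : J → J)) DFunLike.coe_injective
    (fun σ => ∑ s, ∏ i, parityEntry b s i (σ i)) _ ?_ fun _ => rfl]
  · rw [← Finset.add_sum_erase _ _ (Finset.mem_univ (1 : Equiv.Perm J))]
    have h0 : ∑ σ ∈ Finset.univ.erase (1 : Equiv.Perm J),
        ∑ s, ∏ i, parityEntry b s i (σ i) = 0 := by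
      refine Finset.sum_involution (fun σ _ => σ⁻¹) (fun σ _ => ?_) (fun σ hσ h1 h2 => ?_)
        (fun σ hσ => by simpa using hσ) (fun σ _ => inv_inv σ)
      · simp only [prod_parityEntry_inv hsymm]
        exact CharTwo.add_self_eq_zero _
      · exact h1 (sum_prod_parityEntry_of_inv_eq hsymm hsum σ h2 (Finset.ne_of_mem_erase hσ))
    rw [h0, add_zero]
    simp only [parityEntry, Equiv.Perm.coe_one, id, if_true, Finset.prod_const_one,
      Finset.sum_const, Finset.card_univ, Fintype.card_fun, Fintype.card_fin, nsmul_eq_mul]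
    rw [Nat.cast_pow, show ((3 : ℕ) : ZMod 2) = 1 by decide]
    simp
  · intro F hF
    have : ∃ j, j ∉ Set.range F := by
      by_contra! h
      exact hF ⟨Equiv.ofBijective F (Finite.surjective_iff_bijective.1 h), rfl⟩
    obtain ⟨j, hj⟩ := this
    exact sum_prod_parityEntry_of_notMem_range hsum F j hj

end Parity

section CyclePlusTriangles

/-- Contribution of a vertex with value `x` to a monomial of the graph polynomial, where `α, β`
record the choices made on the arcs leaving and entering the vertex. -/
def vertexWeight (α β : ZMod 2) (x : ℤ) : ℤ := (if α = 1 then x else 1) * if β = 1 then 1 else x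

/-- Signed sum of the contributions of a triangle over all its colourings. -/
def triangleWeight (α β : Fin 3 → ZMod 2) : ℤ :=
  ∑ t : Equiv.Perm (Fin 3), (Equiv.Perm.sign t : ℤ) * ∏ a, vertexWeight (α a) (β a) (t a : ℕ)

/-- The parity of half of `triangleWeight`. -/
def triangleParity (α β : Fin 3 → ZMod 2) (s : Fin 3) : ZMod 2 :=
  (1 + (α s + β s)) * (α (s + 1) + β (s + 1)) * (α (s + 2) + β (s + 2)) *
    (α (s + 1) + α (s + 2))

lemma triangleWeight_add_one : ∀ α β : Fin 3 → ZMod 2,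
    triangleWeight (fun a => α a + 1) (fun a => β a + 1) = -triangleWeight α β := by
  decide +kernel

lemma triangleWeight_eq : ∀ α β : Fin 3 → ZMod 2,
    triangleWeight α β = 2 * (triangleWeight α β / 2) := by
  decide +kernel

lemma cast_triangleWeight_div_two : ∀ α β : Fin 3 → ZMod 2,
    ((triangleWeight α β / 2 : ℤ) : ZMod 2) = ∑ s, triangleParity α β s := by
  decide +kernel

lemma prod_sub_add_one {N : ℕ} (X : Fin (N + 1) → ℤ) : ∏ i, (X i - X (i + 1)) =
    ∑ o : Fin (N + 1) → ZMod 2, (∏ i, if o i = 1 then 1 else -1) *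
      ∏ i, vertexWeight (o i) (o (i - 1)) (X i) := by
  have e : ∀ i, X i - X (i + 1) = ∑ c : ZMod 2, if c = 1 then X i else -X (i + 1) := by
    intro i
    have : ∀ f : ZMod 2 → ℤ, ∑ c, f c = f 0 + f 1 := fun f => Fin.sum_univ_two f
    rw [this, if_neg (by decide), if_pos rfl]
    ring
  simp only [e, Finset.prod_univ_sum, Fintype.piFinset_univ]
  refine Finset.sum_congr rfl fun o _ => ?_
  simp only [vertexWeight, Finset.prod_mul_distrib]
  rw [← Equiv.prod_comp (Equiv.addRight (1 : Fin (N + 1)))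
    (fun i => if o (i - 1) = 1 then 1 else X i)]
  simp only [← Finset.prod_mul_distrib, Equiv.coe_addRight, add_sub_cancel_right]
  refine Finset.prod_congr rfl fun i _ => ?_
  split_ifs <;> simp

variable {J : Type} [Fintype J] {N : ℕ} (p : J × Fin 3 ≃ Fin (N + 1))

/-- Coefficient attached to a choice `o` of an end of each arc. -/
def choiceSum (w : (Fin 3 → ZMod 2) → (Fin 3 → ZMod 2) → ℤ) (o : Fin (N + 1) → ZMod 2) : ℤ :=
  (∏ i, if o i = 1 then 1 else -1) * ∏ j, w (fun a => o (p (j, a))) fun a => o (p (j, a) - 1)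

lemma choiceSum_triangleWeight (o : Fin (N + 1) → ZMod 2) : choiceSum p triangleWeight o =
    2 ^ Fintype.card J * choiceSum p (fun α β => triangleWeight α β / 2) o := by
  have : ∀ j, triangleWeight (fun a => o (p (j, a))) (fun a => o (p (j, a) - 1)) = _ :=
    fun j => triangleWeight_eq _ _
  rw [choiceSum, Finset.prod_congr rfl fun j _ => this j, Finset.prod_mul_distrib, choiceSum,
    Finset.prod_const, Finset.card_univ]
  ring

lemma choiceSum_add_one (o : Fin (N + 1) → ZMod 2) :
    choiceSum p (fun α β => triangleWeight α β / 2) (fun i => o i + 1) =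
      choiceSum p (fun α β => triangleWeight α β / 2) o := by
  have h1 : ∀ j, triangleWeight (fun a => o (p (j, a)) + 1) (fun a => o (p (j, a) - 1) + 1) / 2 =
      (-1) * (triangleWeight (fun a => o (p (j, a))) (fun a => o (p (j, a) - 1)) / 2) := by
    intro j
    have := triangleWeight_eq (fun a => o (p (j, a))) (fun a => o (p (j, a) - 1))
    rw [triangleWeight_add_one]
    omega
  have h2 : ∀ i, (if o i + 1 = 1 then 1 else -1 : ℤ) = (-1) * if o i = 1 then 1 else -1 := by
    intro i
    generalize o i = c
    revert c
    decide
  have hN : N + 1 = Fintype.card J * 3 := by simpa using (Fintype.card_congr p).symm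
  simp only [choiceSum, h1, h2, Finset.prod_mul_distrib, Finset.prod_const, Finset.card_univ,
    Fintype.card_fin]
  have h3 : (-1 : ℤ) ^ (N + 1) * (-1) ^ Fintype.card J = 1 := by
    rw [hN, ← pow_add, show Fintype.card J * 3 + Fintype.card J = 2 * (Fintype.card J * 2) by ring,
      pow_mul]
    simp
  linear_combination (((∏ i, if o i = 1 then 1 else -1) *
    ∏ j, triangleWeight (fun a => o (p (j, a))) (fun a => o (p (j, a) - 1)) / 2 : ℤ)) * h3

lemma sum_choiceSum_eq_two_mul :
    ∑ o : Fin (N + 1) → ZMod 2, choiceSum p (fun α β => triangleWeight α β / 2) o =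
      2 * ∑ o : Fin (N + 1) → ZMod 2 with o (Fin.last N) = 0,
        choiceSum p (fun α β => triangleWeight α β / 2) o := by
  rw [← Finset.sum_filter_add_sum_filter_not Finset.univ fun o => o (Fin.last N) = 0, two_mul]
  congr 1
  have h2 : ∀ a : ZMod 2, a + 1 + 1 = a := by decide
  have h3 : ∀ a : ZMod 2, a ≠ 0 ↔ a + 1 = 0 := by decide
  refine Finset.sum_nbij' (fun o i => o i + 1) (fun o i => o i + 1) ?_ ?_ ?_ ?_ ?_
  · intro o; simp [h3]
  · intro o; simp [h3, h2]
  · intro o _; simp [h2]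
  · intro o _; simp [h2]
  · intro o _; exact (choiceSum_add_one p o).symm

variable [DecidableEq J]

lemma sum_sign_mul_prod_sub :
    ∑ τ : J → Equiv.Perm (Fin 3), (∏ j, (Equiv.Perm.sign (τ j) : ℤ)) *
      ∏ i : Fin (N + 1), (((τ (p.symm i).1 (p.symm i).2 : ℕ) : ℤ) -
        ((τ (p.symm (i + 1)).1 (p.symm (i + 1)).2 : ℕ) : ℤ)) =
    ∑ o : Fin (N + 1) → ZMod 2, choiceSum p triangleWeight o := by
  have e : ∀ τ : J → Equiv.Perm (Fin 3), _ := fun τ =>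
    prod_sub_add_one fun i : Fin (N + 1) => ((τ (p.symm i).1 (p.symm i).2 : ℕ) : ℤ)
  simp only [e, Finset.mul_sum]
  rw [Finset.sum_comm]
  refine Finset.sum_congr rfl fun o _ => ?_
  simp only [choiceSum, triangleWeight, Finset.prod_univ_sum, Fintype.piFinset_univ,
    Finset.mul_sum]
  refine Finset.sum_congr rfl fun τ _ => ?_
  rw [← Equiv.prod_comp p (fun i => vertexWeight _ _ _), Fintype.prod_prod_type,
    Finset.prod_mul_distrib]
  simp only [Equiv.symm_apply_apply]
  ring

lemma cast_choiceSum (o : Fin (N + 1) → ZMod 2) :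
    ((choiceSum p (fun α β => triangleWeight α β / 2) o : ℤ) : ZMod 2) =
      ∑ s : J → Fin 3, ∏ j,
        triangleParity (fun a => o (p (j, a))) (fun a => o (p (j, a) - 1)) (s j) := by
  rw [choiceSum]
  push_cast
  have h1 : ∏ i, (((if o i = 1 then 1 else -1 : ℤ)) : ZMod 2) = 1 := by
    refine Finset.prod_eq_one fun i _ => ?_
    split_ifs <;> decide
  push_cast at h1
  rw [h1, one_mul]
  simp only [cast_triangleWeight_div_two, Finset.prod_univ_sum, Fintype.piFinset_univ]

end CyclePlusTriangles

section CyclicSum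

variable {N : ℕ}

lemma zero_sub_one_eq_last : (0 - 1 : Fin (N + 1)) = Fin.last N :=
  sub_eq_of_eq_add (Fin.last_add_one N).symm

lemma sum_le_add_sum_le_sub_one (y : Fin (N + 1) → ZMod 2) (hy : ∑ i, y i = 0) (i : Fin (N + 1)) :
    (∑ k, if k ≤ i then y k else 0) + (∑ k, if k ≤ i - 1 then y k else 0) = y i := by
  rcases eq_or_ne i 0 with rfl | hi
  · have h1 : ∀ k : Fin (N + 1), k ≤ 0 - 1 := by
      intro k
      rw [zero_sub_one_eq_last]
      exact Fin.le_last k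
    simp only [h1, if_true, hy]
    simp
  · have h2 : ∀ a : ZMod 2, a + a = 0 := by decide
    rw [← Finset.sum_add_distrib, Finset.sum_eq_single i]
    · have : ¬ i ≤ i - 1 := by
        rw [Fin.le_def, Fin.val_sub_one_of_ne_zero hi]
        have := Fin.val_ne_zero_iff.2 hi
        omega
      simp [this]
    · intro k _ hk
      have : k ≤ i ↔ k ≤ i - 1 := by
        rw [Fin.le_def, Fin.le_def, Fin.val_sub_one_of_ne_zero hi]
        have h3 := Fin.val_ne_of_ne hk
        have := Fin.val_ne_zero_iff.2 hi
        omega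
      by_cases h : k ≤ i
      · simp [h, this.1 h, h2]
      · simp [h, this.not.1 h]
    · simp

lemma eq_sum_le_of_add_sub_one (y o : Fin (N + 1) → ZMod 2) (hy : ∑ i, y i = 0)
    (ho : o (Fin.last N) = 0) (h : ∀ i, o i + o (i - 1) = y i) :
    o = fun i => ∑ k, if k ≤ i then y k else 0 := by
  set P : Fin (N + 1) → ZMod 2 := fun i => ∑ k, if k ≤ i then y k else 0
  have hP : P (Fin.last N) = 0 := by simp [P, Fin.le_last, hy]
  have h1 : ∀ i, o (i - 1) = P (i - 1) → o i = P i := by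
    intro i hi
    have h2 : P i + P (i - 1) = y i := sum_le_add_sum_le_sub_one y hy i
    rw [← h i, hi] at h2
    exact (add_right_cancel h2).symm
  funext i
  induction i using Fin.induction with
  | zero => exact h1 0 (by rw [zero_sub_one_eq_last, ho, hP])
  | succ i ih =>
    refine h1 _ ?_
    rwa [← Fin.coeSucc_eq_succ, add_sub_cancel_right]

end CyclicSum

section CyclePlusTriangles

variable {J : Type} {N : ℕ} (p : J × Fin 3 ≃ Fin (N + 1))

/-- Indicator of the vertices that are not chosen by `s`. -/
def notChosen (s : J → Fin 3) (i : Fin (N + 1)) : ZMod 2 := if (p.symm i).2 = s (p.symm i).1 then 0 else 1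

lemma sum_notChosen [Fintype J] (s : J → Fin 3) : ∑ i, notChosen p s i = 0 := by
  rw [← Equiv.sum_comp p, Fintype.sum_prod_type]
  refine Finset.sum_eq_zero fun j _ => ?_
  simp only [notChosen, Equiv.symm_apply_apply]
  generalize s j = t
  revert t
  decide

variable [DecidableEq J]

/-- Number modulo 2 of pairs of a vertex of triangle `l` other than `t` and a vertex of triangle
`j` other than `a`, with the first one coming no later. -/
def triangleOrder (j l : J) (a t : Fin 3) : ZMod 2 :=
  if j = l then 0 else ∑ r with r ≠ t, ∑ q with q ≠ a, if p (l, r) ≤ p (j, q) then 1 else 0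

lemma triangleOrder_symm (j l : J) (a t : Fin 3) :
    triangleOrder p j l a t = triangleOrder p l j t a := by
  unfold triangleOrder
  rcases eq_or_ne j l with h | h
  · simp [h]
  · rw [if_neg h, if_neg h.symm, Finset.sum_comm, ← sub_eq_zero, CharTwo.sub_eq_add,
      ← Finset.sum_add_distrib]
    have : ∀ q r, ((if p (l, r) ≤ p (j, q) then 1 else 0) +
        if p (j, q) ≤ p (l, r) then 1 else 0 : ZMod 2) = 1 := by
      intro q r
      have hne : p (l, r) ≠ p (j, q) := fun hh => h (congrArg Prod.fst (p.injective hh)).symm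
      rcases lt_or_gt_of_ne hne with h1 | h1
      · simp [h1.le, h1.not_ge]
      · simp [h1.le, h1.not_ge]
    simp only [← Finset.sum_add_distrib, this]
    revert a t
    decide

lemma sum_triangleOrder (j l : J) (t : Fin 3) : ∑ a, triangleOrder p j l a t = 0 := by
  unfold triangleOrder
  rcases eq_or_ne j l with h | h
  · simp [h]
  · simp only [if_neg h]
    rw [Finset.sum_comm]
    refine Finset.sum_eq_zero fun r _ => ?_
    have : ∀ f : Fin 3 → ZMod 2, ∑ a, ∑ q with q ≠ a, f q = 0 := by decide
    exact this _

variable [Fintype J] (s : J → Fin 3)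

lemma sum_prod_triangleParity :
    ∑ o : Fin (N + 1) → ZMod 2 with o (Fin.last N) = 0, ∏ j,
        triangleParity (fun a => o (p (j, a))) (fun a => o (p (j, a) - 1)) (s j) =
      ∏ j, (1 + ∑ l, triangleOrder p j l (s j) (s l)) := by
  set P : Fin (N + 1) → ZMod 2 := fun i => ∑ k, if k ≤ i then notChosen p s k else 0 with hP
  have hmem : P (Fin.last N) = 0 := by simp [P, Fin.le_last, sum_notChosen]
  rw [Finset.sum_eq_single P]
  · refine Finset.prod_congr rfl fun j _ => ?_
    have h0 : ∀ a, P (p (j, a)) + P (p (j, a) - 1) = if a = s j then 0 else 1 := by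
      intro a
      rw [hP, sum_le_add_sum_le_sub_one _ (sum_notChosen p s), notChosen, Equiv.symm_apply_apply]
    have h1 : ∀ a : Fin 3, a + 1 ≠ a := by decide
    have h2 : ∀ a : Fin 3, a + 2 ≠ a := by decide
    simp only [triangleParity, h0, h1, h2, if_true, if_false, add_zero, mul_one, one_mul]
    have e : ∀ i, P i = ∑ l, ∑ r with r ≠ s l, if p (l, r) ≤ i then 1 else 0 := by
      intro i
      simp only [hP]
      rw [← Equiv.sum_comp p, Fintype.sum_prod_type]
      refine Finset.sum_congr rfl fun l _ => ?_
      rw [Finset.sum_filter]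
      refine Finset.sum_congr rfl fun r _ => ?_
      simp only [notChosen, Equiv.symm_apply_apply, ne_eq]
      split_ifs <;> rfl
    have hsum : ∀ (f : Fin 3 → ZMod 2) a, f (a + 1) + f (a + 2) = ∑ q with q ≠ a, f q := by decide
    rw [e, e, ← Finset.sum_add_distrib]
    have key : ∀ l, (∑ r with r ≠ s l, if p (l, r) ≤ p (j, s j + 1) then 1 else 0 : ZMod 2) +
        (∑ r with r ≠ s l, if p (l, r) ≤ p (j, s j + 2) then 1 else 0 : ZMod 2) =
        (if j = l then 1 else 0) + triangleOrder p j l (s j) (s l) := by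
      intro l
      rw [← Finset.sum_add_distrib]
      rw [Finset.sum_congr rfl fun r _ => hsum (fun q => if p (l, r) ≤ p (j, q) then 1 else 0) (s j)]
      unfold triangleOrder
      split_ifs with h
      · subst h
        rw [← hsum, ← hsum, ← hsum]
        have hne : p (j, s j + 1) ≠ p (j, s j + 2) := fun hh => by
          have := congrArg Prod.snd (p.injective hh)
          simp at this
        have h2 : (1 : ZMod 2) + 1 = 0 := by decide
        rcases lt_or_gt_of_ne hne with h1 | h1
        · simp [h1.le, h1.not_ge, h2]
        · simp [h1.le, h1.not_ge, h2]
      · rw [zero_add]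
    simp only [key, Finset.sum_add_distrib]
    simp
  · intro o ho hne
    by_contra h
    rw [← ne_eq, Finset.prod_ne_zero_iff] at h
    refine hne (eq_sum_le_of_add_sub_one _ o (sum_notChosen p s) (by simpa using ho) fun i => ?_)
    have h1 := h (p.symm i).1 (Finset.mem_univ _)
    have h2 : ∀ α β : Fin 3 → ZMod 2, ∀ t a, triangleParity α β t ≠ 0 →
      α a + β a = if a = t then 0 else 1 := by decide +kernel
    have := h2 _ _ _ (p.symm i).2 h1
    simpa [notChosen] using this
  · simp [hmem]

/-- The cycle plus triangles theorem of Fleischner and Stiebitz. -/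
theorem exists_coloring_cycle_plus_triangles :
    ∃ τ : J → Equiv.Perm (Fin 3), ∀ i : Fin (N + 1),
      τ (p.symm i).1 (p.symm i).2 ≠ τ (p.symm (i + 1)).1 (p.symm (i + 1)).2 := by
  by_contra! hcon
  have h := sum_sign_mul_prod_sub p
  rw [Finset.sum_eq_zero] at h
  · simp only [choiceSum_triangleWeight, ← Finset.mul_sum, sum_choiceSum_eq_two_mul] at h
    have h0 : ∑ o : Fin (N + 1) → ZMod 2 with o (Fin.last N) = 0,
        choiceSum p (fun α β => triangleWeight α β / 2) o = 0 := by
      have := h.symm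
      simpa using this
    have h1 := congrArg (Int.cast : ℤ → ZMod 2) h0
    rw [Int.cast_sum] at h1
    simp only [cast_choiceSum] at h1
    rw [Finset.sum_comm] at h1
    simp only [sum_prod_triangleParity] at h1
    rw [sum_prod_one_add_eq_one (fun j a t => by simp [triangleOrder])
      (triangleOrder_symm p) (sum_triangleOrder p)] at h1
    exact absurd h1 (by decide)
  · intro τ _
    obtain ⟨i, hi⟩ := hcon τ
    rw [Finset.prod_eq_zero (Finset.mem_univ i) (by rw [hi, sub_self]), mul_zero]

end CyclePlusTriangles

section SystemOfRepresentatives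

variable {ι κ : Type} [Fintype ι] (L : ι → ℕ) [∀ i, NeZero (L i)]
  (e : (Σ i, ZMod (L i)) ≃ κ × Fin 4)

/-- Cycles of length at least three have vertices in distinct classes, apart from at most one
quarter of the number of triangles. -/
lemma exists_representatives :
    ∃ (D : Finset ι) (s : ∀ i, ZMod (L i)), 4 * D.card ≤ (Finset.univ.filter (L · = 3)).card ∧
      ∀ i j, 3 ≤ L i → 3 ≤ L j → i ∉ D → j ∉ D → (e ⟨i, s i⟩).1 = (e ⟨j, s j⟩).1 → i = j := by
  classical
  set d := (Finset.univ.filter (L · = 3)).card / 4 with hd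
  let cls : ι → Finset κ := fun i => Finset.univ.image fun k => (e ⟨i, k⟩).1
  let t : {i // 3 ≤ L i} → Finset (κ ⊕ Fin d) := fun i => (cls i).disjSum Finset.univ
  obtain ⟨f, hf, hft⟩ := (Finset.all_card_le_biUnion_card_iff_exists_injective t).1 (by
    intro A
    rcases A.eq_empty_or_nonempty with rfl | ⟨i0, hi0⟩
    · simp
    have h1 : A.biUnion t = (A.biUnion fun i => cls i).disjSum Finset.univ := by
      ext (c | c)
      · simp [t]
      · simp only [Finset.mem_biUnion, t, Finset.inr_mem_disjSum, Finset.mem_univ, and_true,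
          iff_true]
        exact ⟨i0, hi0⟩
    rw [h1, Finset.card_disjSum, Finset.card_univ, Fintype.card_fin]
    have h2 : ∑ i ∈ A, L i ≤ (A.biUnion fun i => cls i).card * 4 := by
      calc ∑ i ∈ A, L i = (A.sigma fun i => (Finset.univ : Finset (ZMod (L i)))).card := by
            simp [Finset.card_sigma]
        _ ≤ ((A.biUnion fun i => cls i) ×ˢ (Finset.univ : Finset (Fin 4))).card := by
            refine Finset.card_le_card_of_injOn (fun v => e ⟨v.1, v.2⟩) ?_ ?_
            · rintro ⟨i, k⟩ hv
              simp only [Finset.coe_sigma, Set.mem_sigma_iff, Finset.mem_coe] at hv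
              simp only [Finset.coe_product, Set.mem_prod, Finset.mem_coe, Finset.mem_biUnion,
                Finset.mem_univ, and_true, cls, Finset.mem_image]
              exact ⟨i, hv.1, k, trivial, rfl⟩
            · rintro ⟨⟨i, hi⟩, k⟩ _ ⟨⟨j, hj⟩, l⟩ _ h
              have := e.injective h
              simp only [Sigma.mk.injEq] at this
              obtain ⟨rfl, h⟩ := this
              rw [eq_of_heq h]
        _ = _ := by simp
    have h3 : 4 * A.card ≤ ∑ i ∈ A, L i + (A.filter fun i : {i // 3 ≤ L i} => L i.1 = 3).card := by
      rw [Finset.card_filter, ← Finset.sum_add_distrib, mul_comm, ← smul_eq_mul,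
        ← Finset.sum_const]
      refine Finset.sum_le_sum fun i _ => ?_
      have := i.2
      split_ifs <;> omega
    have h4 : (A.filter fun i : {i // 3 ≤ L i} => L i.1 = 3).card ≤ (Finset.univ.filter (L · = 3)).card :=
      Finset.card_le_card_of_injOn Subtype.val
        (fun i hi => by simpa using (Finset.mem_filter.1 hi).2) (fun _ _ _ _ h => Subtype.ext h)
    omega)
  have hs : ∀ i, ∃ k : ZMod (L i), ∀ (h : 3 ≤ L i) c, f ⟨i, h⟩ = .inl c → (e ⟨i, k⟩).1 = c := by
    intro i
    by_cases h : 3 ≤ L i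
    · rcases hc : f ⟨i, h⟩ with c | c
      · have := hft ⟨i, h⟩
        rw [hc] at this
        simp only [t, Finset.inl_mem_disjSum, cls, Finset.mem_image] at this
        obtain ⟨k, -, hk⟩ := this
        exact ⟨k, fun _ c' hc' => hk.trans (Sum.inl_injective (hc.symm.trans hc'))⟩
      · exact ⟨0, fun _ c' hc' => absurd (hc.symm.trans hc') (by simp)⟩
    · exact ⟨0, fun h' => absurd h' h⟩
  choose s hs using hs
  set D : Finset ι := Finset.univ.filter fun i => ∃ (h : 3 ≤ L i) (c : Fin d), f ⟨i, h⟩ = .inr c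
    with hD
  refine ⟨D, s, ?_, ?_⟩
  · choose h c hc using fun i : {i // i ∈ D} => (Finset.mem_filter.1 i.2).2
    have : Function.Injective c := by
      intro i j hij
      have h1 := hf ((hc i).trans ((congrArg _ hij).trans (hc j).symm))
      exact Subtype.ext (Subtype.mk.inj h1)
    have := Fintype.card_le_of_injective c this
    rw [Fintype.card_coe, Fintype.card_fin] at this
    omega
  · intro i j hi hj hiD hjD h
    have : ∀ i (hi : 3 ≤ L i), i ∉ D → f ⟨i, hi⟩ = .inl (e ⟨i, s i⟩).1 := by
      intro i hi hiD
      rcases hc : f ⟨i, hi⟩ with c | c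
      · rw [hs i hi c hc]
      · exact absurd (Finset.mem_filter.2 ⟨Finset.mem_univ _, hi, c, hc⟩) hiD
    have h1 := hf ((this i hi hiD).trans ((congrArg _ h).trans (this j hj hjD).symm))
    exact congrArg Subtype.val h1

end SystemOfRepresentatives

section TransversalColoring

/-- Ranking a finite type by an injective key. -/
lemma exists_equiv_fin_of_key {W : Type} [Fintype W] {N : ℕ} (hN : Fintype.card W = N + 1)
    (key : W → ℕ) (hkey : Function.Injective key) :
    ∃ p : W ≃ Fin (N + 1), ∀ w w', key w' = key w + 1 → p w' = p w + 1 := by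
  classical
  let rank : W → ℕ := fun w => (Finset.univ.filter fun z => key z < key w).card
  have hrank : ∀ w, rank w < N + 1 := fun w => by
    rw [← hN, ← Finset.card_univ]
    exact Finset.card_lt_card (Finset.filter_ssubset.2 ⟨w, Finset.mem_univ _, lt_irrefl _⟩)
  have hlt : ∀ w w', key w < key w' → rank w < rank w' := fun w w' h => by
    refine Finset.card_lt_card ⟨fun z hz => ?_, fun hsub => ?_⟩
    · simp only [Finset.mem_filter, Finset.mem_univ, true_and] at hz ⊢
      exact hz.trans h
    · have := hsub (Finset.mem_filter.2 ⟨Finset.mem_univ w, h⟩)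
      simp at this
  have hinj : Function.Injective fun w => (⟨rank w, hrank w⟩ : Fin (N + 1)) := by
    intro w w' h
    have h' : rank w = rank w' := congrArg Fin.val h
    rcases lt_trichotomy (key w) (key w') with h1 | h1 | h1
    · have := hlt _ _ h1; omega
    · exact hkey h1
    · have := hlt _ _ h1; omega
  refine ⟨Equiv.ofBijective _ ((Fintype.bijective_iff_injective_and_card _).2 ⟨hinj, by simp [hN]⟩),
    fun w w' h => ?_⟩
  have h1 : rank w' = rank w + 1 := by
    have : (Finset.univ.filter fun z => key z < key w') =
        insert w (Finset.univ.filter fun z => key z < key w) := by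
      ext z
      simp only [Finset.mem_filter, Finset.mem_univ, true_and, Finset.mem_insert, h,
        Nat.lt_succ_iff_lt_or_eq, ← hkey.eq_iff (a := z)]
      tauto
    simp only [rank, this]
    rw [Finset.card_insert_of_notMem (by simp)]
  change (⟨rank w', hrank w'⟩ : Fin (N + 1)) = ⟨rank w, hrank w⟩ + 1
  have h2 := hrank w'
  apply Fin.ext
  rw [Fin.val_add_one_of_lt' (by simp only; omega)]
  exact h1

variable {ι κ : Type} [Fintype ι] (L : ι → ℕ) [∀ i, NeZero (L i)]
  (e : (Σ i, ZMod (L i)) ≃ κ × Fin 4)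

/-- Arranging the cycles one after the other, with starting points `s`. -/
lemma exists_key (s : ∀ i, ZMod (L i)) : ∃ key : (Σ i, ZMod (L i)) → ℕ, Function.Injective key ∧
    ∀ i k, k + 1 ≠ s i → key ⟨i, k + 1⟩ = key ⟨i, k⟩ + 1 := by
  let B := ∑ i, L i + 1
  have hB : ∀ i, L i < B := fun i =>
    Nat.lt_succ_of_le (Finset.single_le_sum (fun _ _ => Nat.zero_le _) (Finset.mem_univ i))
  have hval : ∀ i (k : ZMod (L i)), k.val < B := fun i k => (ZMod.val_lt k).trans (hB i)
  refine ⟨fun v => B * (Fintype.equivFin ι v.1 : ℕ) + (v.2 - s v.1).val, ?_, fun i k hk => ?_⟩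
  · rintro ⟨i, k⟩ ⟨j, l⟩ h
    simp only at h
    have h1 : (Fintype.equivFin ι i : ℕ) = Fintype.equivFin ι j := by
      have := congrArg (· / B) h
      have hpos : 0 < B := Nat.succ_pos _
      rwa [Nat.mul_add_div hpos, Nat.mul_add_div hpos, Nat.div_eq_of_lt (hval _ _),
        Nat.div_eq_of_lt (hval _ _), add_zero, add_zero] at this
    obtain rfl : i = j := (Fintype.equivFin ι).injective (Fin.ext h1)
    have h2 : k - s i = l - s i := ZMod.val_injective _ (by omega)
    rw [sub_left_inj.1 h2]
  · simp only [add_assoc, Nat.add_left_cancel_iff]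
    have h1 : k + 1 - s i = (k - s i) + 1 := by ring
    have h2 : (k - s i) + 1 ≠ 0 := by rw [← h1]; exact sub_ne_zero.2 hk
    have hL : L i ≠ 1 := fun h => by
      have : Subsingleton (ZMod (L i)) := by rw [h]; infer_instance
      exact h2 (Subsingleton.elim _ _)
    have hL' : 1 < L i := by have := NeZero.ne (L i); omega
    have : Fact (1 < L i) := ⟨hL'⟩
    rw [h1, ZMod.val_add_of_lt]
    · rw [ZMod.val_one]
    · rw [ZMod.val_one]
      have h3 := ZMod.val_lt (k - s i)
      by_contra hc
      have h4 : (k - s i).val + 1 = L i := by omega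
      apply h2
      have h5 := congrArg (Nat.cast : ℕ → ZMod (L i)) h4
      simpa using h5

/-- If `T` and `Z` together meet every long cycle, the vertices outside `T` can be coloured with
three colours. -/
lemma exists_three_coloring [Fintype κ] [DecidableEq κ] (Z : Finset (Σ i, ZMod (L i)))
    (T : κ → Fin 4) (s : ∀ i, ZMod (L i))
    (hs : ∀ i, 3 ≤ L i → ⟨i, s i⟩ ∈ Z ∨ T (e ⟨i, s i⟩).1 = (e ⟨i, s i⟩).2) :
    ∃ col : (Σ i, ZMod (L i)) → Fin 3,
      (∀ u v, T (e u).1 ≠ (e u).2 → T (e v).1 ≠ (e v).2 → (e u).1 = (e v).1 → u ≠ v →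
        col u ≠ col v) ∧
      ∀ u, u ∉ Z → cycleNext L u ∉ Z → cycleNext L u ≠ u → T (e u).1 ≠ (e u).2 →
        T (e (cycleNext L u)).1 ≠ (e (cycleNext L u)).2 → col u ≠ col (cycleNext L u) := by
  rcases isEmpty_or_nonempty κ with hκ | hκ
  · exact ⟨fun v => hκ.elim (e v).1, fun u => hκ.elim (e u).1, fun u => hκ.elim (e u).1⟩
  obtain ⟨key, hkey, hnext⟩ := exists_key L s
  obtain ⟨N, hN⟩ : ∃ N, Fintype.card (κ × Fin 3) = N + 1 :=
    Nat.exists_eq_succ_of_ne_zero Fintype.card_ne_zero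
  obtain ⟨p, hp⟩ := exists_equiv_fin_of_key hN
    (fun w => key (e.symm (w.1, (T w.1).succAbove w.2))) (by
      rintro ⟨c, a⟩ ⟨c', a'⟩ h
      have h1 := e.symm.injective (hkey h)
      simp only [Prod.mk.injEq] at h1
      obtain ⟨rfl, h1⟩ := h1
      rw [Fin.succAbove_right_injective h1])
  obtain ⟨τ, hτ⟩ := exists_coloring_cycle_plus_triangles p
  have ha : ∀ v, ∃ a, T (e v).1 ≠ (e v).2 → (T (e v).1).succAbove a = (e v).2 := by
    intro v
    by_cases h : T (e v).1 = (e v).2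
    · exact ⟨0, fun h' => absurd h h'⟩
    · obtain ⟨a, ha⟩ := Fin.exists_succAbove_eq (Ne.symm h)
      exact ⟨a, fun _ => ha⟩
  choose a ha using ha
  have hav : ∀ v, T (e v).1 ≠ (e v).2 →
      e.symm ((e v).1, (T (e v).1).succAbove (a v)) = v := by
    intro v hv
    rw [ha v hv]; simp
  have hne : ∀ u v, T (e u).1 ≠ (e u).2 → T (e v).1 ≠ (e v).2 → key v = key u + 1 →
      τ (e u).1 (a u) ≠ τ (e v).1 (a v) := by
    intro u v hu hv h
    have h1 := hp ((e u).1, a u) ((e v).1, a v) (by simp only [hav u hu, hav v hv, h])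
    have h2 := hτ (p ((e u).1, a u))
    rw [← h1] at h2
    simpa using h2
  refine ⟨fun v => τ (e v).1 (a v), fun u v hu hv huv huv' h => ?_,
    fun u h1 h2 h3 h4 h5 => ?_⟩
  · simp only [huv] at h
    have h1 := (τ (e v).1).injective h
    apply huv'
    rw [← hav u hu, ← hav v hv, h1, huv]
  · obtain ⟨i, k⟩ := u
    rw [cycleNext_mk] at h2 h3 h5 ⊢
    by_cases hk : k + 1 = s i
    · have hL : L i < 3 := by
        by_contra hc
        rcases hs i (by omega) with h | h
        · exact h2 (by rwa [hk])
        · exact h5 (by rwa [hk])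
      have hk2 : k + 1 + 1 = k := by
        have : (2 : ZMod (L i)) = 0 := by
          have := NeZero.ne (L i)
          have h12 : L i = 1 ∨ L i = 2 := by omega
          rcases h12 with h | h <;> rw [h] <;> decide
        rw [add_assoc, one_add_one_eq_two, this, add_zero]
      have hks : k ≠ s i := fun h => h3 (by rw [hk, ← h])
      have h6 := hnext i (k + 1) (by rwa [hk2])
      rw [hk2] at h6
      exact (hne _ _ h5 h4 h6).symm
    · exact hne _ _ h4 h5 (hnext i k hk)

/-- The transversal `T` spans no arc outside `Z`. -/
def IsIndepTransversal (Z : Finset (Σ i, ZMod (L i))) (T : κ → Fin 4) : Prop :=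
  ∀ u, u ∉ Z → cycleNext L u ∉ Z → T (e u).1 = (e u).2 →
    T (e (cycleNext L u)).1 = (e (cycleNext L u)).2 → cycleNext L u = u

lemma exists_isIndepTransversal [Fintype κ] [DecidableEq κ] (Z : Finset (Σ i, ZMod (L i)))
    (R : κ → Fin 4) (s : ∀ i, ZMod (L i))
    (hs : ∀ i, 3 ≤ L i → ⟨i, s i⟩ ∈ Z ∨ R (e ⟨i, s i⟩).1 = (e ⟨i, s i⟩).2) :
    ∃ T, IsIndepTransversal L e Z T := by
  obtain ⟨col, hcol, hcol'⟩ := exists_three_coloring L e Z R s hs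
  have : ∀ c, ∃ a : Fin 3, col (e.symm (c, (R c).succAbove a)) = 0 := by
    intro c
    refine (Finite.injective_iff_surjective.1 fun a b h => ?_) 0
    by_contra hab
    refine hcol _ _ ?_ ?_ ?_ ?_ h <;> simp [hab, (Fin.succAbove_ne _ _).symm]
  choose a ha using this
  refine ⟨fun c => (R c).succAbove (a c), fun u h1 h2 h3 h4 => ?_⟩
  have key : ∀ v, (R (e v).1).succAbove (a (e v).1) = (e v).2 →
      col v = 0 ∧ R (e v).1 ≠ (e v).2 := by
    intro v hv
    have := ha (e v).1
    rw [hv] at this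
    refine ⟨by simpa using this, ?_⟩
    rw [← hv]
    exact (Fin.succAbove_ne _ _).symm
  by_contra hne
  exact hcol' u h1 h2 hne (key _ h3).2 (key _ h4).2 ((key _ h3).1.trans (key _ h4).1.symm)

/-- An independent transversal can be chosen to meet every cycle with a representative. -/
lemma exists_isIndepTransversal_meeting [Fintype κ] [DecidableEq κ]
    (Z : Finset (Σ i, ZMod (L i))) (D : Finset ι) (s : ∀ i, ZMod (L i))
    (hs : ∀ i j, i ∉ D → j ∉ D → (e ⟨i, s i⟩).1 = (e ⟨j, s j⟩).1 → i = j)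
    (hT : ∃ T, IsIndepTransversal L e Z T) :
    ∃ T, IsIndepTransversal L e Z T ∧ ∀ i, i ∉ D → ∃ k, T (e ⟨i, k⟩).1 = (e ⟨i, k⟩).2 := by
  classical
  let Φ : (κ → Fin 4) → Finset ι := fun T =>
    Finset.univ.filter fun i => i ∉ D ∧ T (e ⟨i, s i⟩).1 = (e ⟨i, s i⟩).2
  obtain ⟨T, hTmem, hTmax⟩ := Finset.exists_max_image
    (Finset.univ.filter fun T => IsIndepTransversal L e Z T) (fun T => (Φ T).card)
    (by obtain ⟨T, hT⟩ := hT; exact ⟨T, by simpa using hT⟩)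
  have hT : IsIndepTransversal L e Z T := (Finset.mem_filter.1 hTmem).2
  refine ⟨T, hT, fun i hi => ?_⟩
  by_contra! hcon
  set v : Σ i, ZMod (L i) := ⟨i, s i⟩ with hv
  set T' := Function.update T (e v).1 (e v).2 with hT'
  have h1 : ∀ u, T' (e u).1 = (e u).2 → u = v ∨ T (e u).1 = (e u).2 := by
    intro u hu
    by_cases h : (e u).1 = (e v).1
    · left
      rw [hT', h, Function.update_self] at hu
      exact e.injective (Prod.ext h hu.symm)
    · right
      rwa [hT', Function.update_of_ne h] at hu
  have h2 : IsIndepTransversal L e Z T' := by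
    intro u hu1 hu2 hu3 hu4
    rcases h1 _ hu3 with h3 | h3 <;> rcases h1 _ hu4 with h4 | h4
    · rw [h4, h3]
    · rw [h3] at h4
      exact absurd h4 (hcon _)
    · exfalso
      have : u = ⟨i, s i - 1⟩ := by
        apply (cycleNext L).injective
        rw [h4, cycleNext_mk, sub_add_cancel]
      rw [this] at h3
      exact hcon _ h3
    · exact hT u hu1 hu2 h3 h4
  have h3 : (Φ T).card < (Φ T').card := by
    refine Finset.card_lt_card ⟨fun j hj => ?_, fun hsub => ?_⟩
    · simp only [Φ, Finset.mem_filter, Finset.mem_univ, true_and] at hj ⊢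
      refine ⟨hj.1, ?_⟩
      rw [hT', Function.update_of_ne, hj.2]
      intro h
      obtain rfl := hs j i hj.1 hi h
      exact hcon _ hj.2
    · have : i ∈ Φ T' := by simp [Φ, hi, hT', hv]
      have := (Finset.mem_filter.1 (hsub this)).2.2
      exact hcon _ this
  exact absurd (hTmax T' (by simpa using h2)) (not_le.2 h3)

theorem exists_isProperOff_triangles [Fintype κ] [DecidableEq κ] :
    ∃ Z col, IsProperOff L e Z col ∧ 4 * Z.card ≤ (Finset.univ.filter (L · = 3)).card := by
  classical
  obtain ⟨D, s, hD, hs⟩ := exists_representatives L e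
  let Z : Finset (Σ i, ZMod (L i)) := D.image fun i => ⟨i, s i⟩
  have hZ : ∀ i ∈ D, ⟨i, s i⟩ ∈ Z := fun i hi => Finset.mem_image_of_mem _ hi
  let D' : Finset ι := Finset.univ.filter fun i => 3 ≤ L i → i ∈ D
  have hD' : ∀ i, i ∉ D' ↔ 3 ≤ L i ∧ i ∉ D := by simp [D']
  have hs' : ∀ i j, i ∉ D' → j ∉ D' → (e ⟨i, s i⟩).1 = (e ⟨j, s j⟩).1 → i = j := by
    intro i j hi hj
    rw [hD'] at hi hj
    exact hs i j hi.1 hj.1 hi.2 hj.2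
  have hR : ∀ c, ∃ r, ∀ i, i ∉ D' → (e ⟨i, s i⟩).1 = c → r = (e ⟨i, s i⟩).2 := by
    intro c
    by_cases h : ∃ i, i ∉ D' ∧ (e ⟨i, s i⟩).1 = c
    · obtain ⟨i, hi, hic⟩ := h
      refine ⟨(e ⟨i, s i⟩).2, fun j hj hjc => ?_⟩
      rw [hs' i j hi hj (hic.trans hjc.symm)]
    · exact ⟨0, fun i hi hic => absurd ⟨i, hi, hic⟩ h⟩
  choose R hR using hR
  have hmeet : ∀ i, 3 ≤ L i → i ∈ D ∨ i ∉ D' := by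
    intro i hi
    rw [hD']
    tauto
  obtain ⟨T, hT, hTmeet⟩ := exists_isIndepTransversal_meeting L e Z D' s hs'
    (exists_isIndepTransversal L e Z R s fun i hi =>
      (hmeet i hi).imp (hZ i) fun h => hR _ i h rfl)
  have ht : ∀ i, ∃ k, 3 ≤ L i → ⟨i, k⟩ ∈ Z ∨ T (e ⟨i, k⟩).1 = (e ⟨i, k⟩).2 := by
    intro i
    by_cases hi : 3 ≤ L i
    · rcases hmeet i hi with h | h
      · exact ⟨s i, fun _ => .inl (hZ i h)⟩
      · obtain ⟨k, hk⟩ := hTmeet i h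
        exact ⟨k, fun _ => .inr hk⟩
    · exact ⟨0, fun h => absurd h hi⟩
  choose t ht using ht
  obtain ⟨col, hcol, hcol'⟩ := exists_three_coloring L e Z T t ht
  refine ⟨Z, fun v => if T (e v).1 = (e v).2 then Fin.last 3 else (col v).castSucc,
    ⟨fun u v _ _ huv hne => ?_, fun u h1 h2 h3 => ?_⟩, ?_⟩
  · by_cases hu : T (e u).1 = (e u).2 <;> by_cases hv : T (e v).1 = (e v).2
    · exact absurd (e.injective (Prod.ext huv (by rw [← hu, ← hv, huv]))) hne
    · simp only [hu, hv, if_true, if_false]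
      exact (Fin.castSucc_ne_last _).symm
    · simp only [hu, hv, if_true, if_false]
      exact Fin.castSucc_ne_last _
    · simp only [hu, hv, if_false]
      exact fun h => hcol u v hu hv huv hne (Fin.castSucc_injective _ h)
  · by_cases hu : T (e u).1 = (e u).2 <;>
      by_cases hv : T (e (cycleNext L u)).1 = (e (cycleNext L u)).2
    · exact absurd (hT u h1 h2 hu hv) h3
    · simp only [hu, hv, if_true, if_false]
      exact (Fin.castSucc_ne_last _).symm
    · simp only [hu, hv, if_true, if_false]
      exact Fin.castSucc_ne_last _
    · simp only [hu, hv, if_false]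
      exact fun h => hcol' u h1 h2 h3 hu hv (Fin.castSucc_injective _ h)
  · exact (Nat.mul_le_mul_left _ Finset.card_image_le).trans hD

end TransversalColoring

section Permutation

theorem exists_isProperOff {ι κ : Type} [Fintype ι] [Fintype κ] (L : ι → ℕ) [∀ i, NeZero (L i)]
    (e : (Σ i, ZMod (L i)) ≃ κ × Fin 4) :
    ∃ Z col, IsProperOff L e Z col ∧ 22 * Z.card ≤ ∑ i with 2 ≤ L i, L i := by
  classical
  obtain ⟨Z₁, col₁, h₁, hZ₁⟩ := exists_isProperOff_odd L e
  obtain ⟨Z₂, col₂, h₂, hZ₂⟩ := exists_isProperOff_triangles L e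
  have h : ∑ i with L i % 2 = 1 ∧ 5 ≤ L i, L i + 3 * (Finset.univ.filter (L · = 3)).card ≤
      ∑ i with 2 ≤ L i, L i := by
    rw [Finset.card_filter, Finset.sum_filter, Finset.sum_filter, Finset.mul_sum,
      ← Finset.sum_add_distrib]
    refine Finset.sum_le_sum fun i _ => ?_
    split_ifs <;> omega
  rcases le_total Z₁.card Z₂.card with hle | hle
  · exact ⟨Z₁, col₁, h₁, by omega⟩
  · exact ⟨Z₂, col₂, h₂, by omega⟩

/-- The cycle decomposition of a permutation of a finite type. -/
lemma exists_cycleNext_conj {W : Type} [Finite W] (π : Equiv.Perm W) :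
    ∃ (ι : Type) (_ : Fintype ι) (L : ι → ℕ) (_ : ∀ i, NeZero (L i))
      (ψ : (Σ i, ZMod (L i)) ≃ W), ∀ v, ψ (cycleNext L v) = π (ψ v) := by
  classical
  have := Fintype.ofFinite W
  let ι := Quotient (Equiv.Perm.SameCycle.setoid π)
  let L : ι → ℕ := fun i => Function.minimalPeriod π i.out
  have hper : ∀ w, w ∈ Function.periodicPts π := fun w =>
    π.injective.mem_periodicPts w
  have hL : ∀ i, 0 < L i := fun i => Function.minimalPeriod_pos_of_mem_periodicPts (hper _)
  have hne : ∀ i, NeZero (L i) := fun i => ⟨(hL i).ne'⟩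
  let φ : (Σ i, ZMod (L i)) → W := fun v => π^[v.2.val] v.1.out
  have hsame : ∀ v, π.SameCycle v.1.out (φ v) := fun v => ⟨v.2.val, by
    simp only [φ, Equiv.Perm.iterate_eq_pow, zpow_natCast]⟩
  have hinj : Function.Injective φ := by
    rintro ⟨i, k⟩ ⟨j, l⟩ h
    have h1 : π.SameCycle i.out j.out := by
      have := hsame ⟨i, k⟩
      rw [h] at this
      exact this.trans (hsame ⟨j, l⟩).symm
    obtain rfl : i = j := by
      rw [← i.out_eq, ← j.out_eq]
      exact Quotient.sound h1
    have h2 := Function.iterate_injOn_Iio_minimalPeriod (ZMod.val_lt k) (ZMod.val_lt l) h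
    rw [ZMod.val_injective _ h2]
  have hsurj : Function.Surjective φ := by
    intro w
    have h1 : π.SameCycle (Quotient.mk (Equiv.Perm.SameCycle.setoid π) w).out w :=
      Quotient.mk_out (s := Equiv.Perm.SameCycle.setoid π) w
    obtain ⟨n, -, -, hn⟩ := h1.exists_pow_eq
    refine ⟨⟨Quotient.mk _ w, (n : ZMod _)⟩, ?_⟩
    simp only [φ, ZMod.val_natCast, L]
    rw [Function.iterate_mod_minimalPeriod_eq, Equiv.Perm.iterate_eq_pow, hn]
  refine ⟨ι, inferInstance, L, hne, Equiv.ofBijective φ ⟨hinj, hsurj⟩, ?_⟩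
  rintro ⟨i, k⟩
  change π^[(k + 1).val] i.out = π (π^[k.val] i.out)
  rw [← Function.iterate_succ_apply' π, ZMod.val_add, ZMod.val_one_eq_one_mod, Nat.add_mod_mod]
  exact Function.iterate_mod_minimalPeriod_eq

theorem exists_coloring_perm {W κ : Type} [Fintype W] [DecidableEq W] [Fintype κ]
    (π : Equiv.Perm W) (e : W ≃ κ × Fin 4) :
    ∃ (Z : Finset W) (col : W → Fin 4), 22 * Z.card ≤ (Finset.univ.filter fun w => π w ≠ w).card ∧
      (∀ u v, u ∉ Z → v ∉ Z → (e u).1 = (e v).1 → u ≠ v → col u ≠ col v) ∧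
      ∀ u, u ∉ Z → π u ∉ Z → π u ≠ u → col u ≠ col (π u) := by
  obtain ⟨ι, _, L, _, ψ, hψ⟩ := exists_cycleNext_conj π
  obtain ⟨Z, col, ⟨h1, h2⟩, hZ⟩ := exists_isProperOff L (ψ.trans e)
  have hnext : ∀ u, ψ.symm (π u) = cycleNext L (ψ.symm u) := fun u => by
    rw [Equiv.symm_apply_eq, hψ, Equiv.apply_symm_apply]
  refine ⟨Z.map ψ.toEmbedding, col ∘ ψ.symm, ?_, fun u v hu hv huv hne => ?_,
    fun u hu hv hne => ?_⟩
  · rw [Finset.card_map]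
    refine hZ.trans ?_
    have : ∑ i with 2 ≤ L i, L i = ((Finset.univ.filter fun i => 2 ≤ L i).sigma
        fun i => (Finset.univ : Finset (ZMod (L i)))).card := by simp [Finset.card_sigma]
    rw [this]
    refine Finset.card_le_card_of_injOn ψ ?_ ψ.injective.injOn
    rintro ⟨i, k⟩ hi
    have hL : 2 ≤ L i := by simpa using hi
    have : Fact (1 < L i) := ⟨hL⟩
    simp only [Finset.coe_filter, Finset.mem_univ, true_and, Set.mem_ofPred_eq, ← hψ,
      cycleNext_mk]
    intro h
    have := ψ.injective h
    simp at this
  · refine h1 _ _ ?_ ?_ ?_ ?_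
    · simpa using hu
    · simpa using hv
    · simpa using huv
    · simpa using hne
  · simp only [Function.comp, hnext]
    refine h2 _ ?_ ?_ ?_
    · simpa using hu
    · rw [← hnext]; simpa using hv
    · rw [← hnext]; simpa using hne

end Permutation

section MaxDegreeTwo

variable {V : Type} [Fintype V] [DecidableEq V] (H : SimpleGraph V) [DecidableRel H.Adj]

/-- The involution exchanging the two darts leaving a vertex of degree two. -/
lemma exists_dart_involution (hΔ : ∀ v, H.degree v ≤ 2) :
    ∃ g : H.Dart → H.Dart, (∀ d, g (g d) = d) ∧
      ∀ d d' : H.Dart, d.fst = d'.fst → d ≠ d' → g d = d' := by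
  classical
  have hthree : ∀ d₁ d₂ d₃ : H.Dart, d₁.fst = d₂.fst → d₁.fst = d₃.fst → d₁ ≠ d₂ → d₁ ≠ d₃ →
      d₂ = d₃ := by
    intro d₁ d₂ d₃ h2 h3 hn2 hn3
    by_contra hn
    have hsnd : ∀ d d' : H.Dart, d.fst = d'.fst → d ≠ d' → d.snd ≠ d'.snd := fun d d' h hne h' =>
      hne (Dart.ext _ _ (Prod.ext h h'))
    have hcard := hΔ d₁.fst
    have hsub : {d₁.snd, d₂.snd, d₃.snd} ⊆ H.neighborFinset d₁.fst := by
      intro v hv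
      simp only [Finset.mem_insert, Finset.mem_singleton] at hv
      rw [mem_neighborFinset]
      rcases hv with rfl | rfl | rfl
      · exact d₁.adj
      · rw [h2]; exact d₂.adj
      · rw [h3]; exact d₃.adj
    have := Finset.card_le_card hsub
    rw [Finset.card_eq_three.2 ⟨_, _, _, hsnd _ _ h2 hn2, hsnd _ _ h3 hn3,
      hsnd _ _ (h2.symm.trans h3) hn, rfl⟩, card_neighborFinset_eq_degree] at this
    omega
  have hex : ∀ d : H.Dart, ∃ d' : H.Dart, d.fst = d'.fst ∧
      ((∃ d'' : H.Dart, d.fst = d''.fst ∧ d ≠ d'') → d ≠ d') := by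
    intro d
    by_cases h : ∃ d'' : H.Dart, d.fst = d''.fst ∧ d ≠ d''
    · obtain ⟨d', h1, h2⟩ := h
      exact ⟨d', h1, fun _ => h2⟩
    · exact ⟨d, rfl, fun h' => absurd h' h⟩
  choose g hg hg' using hex
  have huniq : ∀ d d' : H.Dart, d.fst = d'.fst → d ≠ d' → g d = d' := fun d d' h hne =>
    hthree d _ _ (hg d) h (hg' d ⟨d', h, hne⟩) hne
  refine ⟨g, fun d => ?_, huniq⟩
  by_cases h : d = g d
  · rw [← h, ← h]
  · exact huniq _ _ (hg d).symm (Ne.symm h)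

/-- A graph of maximum degree at most two is covered by the arcs of a permutation. -/
lemma exists_perm_of_degree_le_two (hΔ : ∀ v, H.degree v ≤ 2) :
    ∃ π : Equiv.Perm V, ∀ u v, H.Adj u v → π u = v ∨ π v = u := by
  classical
  obtain ⟨g, hg, hg'⟩ := exists_dart_involution H hΔ
  obtain ⟨c, hc1, hc2⟩ := exists_alternating Dart.symm g Dart.symm_symm hg
  have hsymm : ∀ d : H.Dart, c d.symm ≠ c d := fun d => hc1 d d.symm_ne
  have hfst : ∀ d d' : H.Dart, d.fst = d'.fst → c d = c d' → d = d' := by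
    intro d d' h h'
    by_contra hne
    have := hg' d d' h hne
    exact hc2 d (by rw [this]; exact Ne.symm hne) (by rw [this, h'])
  have hsnd : ∀ d d' : H.Dart, d.snd = d'.snd → c d = c d' → d = d' := by
    intro d d' h h'
    have h1 := hsymm d
    have h2 := hsymm d'
    have : d.symm = d'.symm := hfst _ _ h (by
      revert h1 h2
      rw [h']
      cases c d.symm <;> cases c d'.symm <;> cases c d' <;> simp)
    rw [← d.symm_symm, this, d'.symm_symm]
  have hf : ∀ u, ∃ v, ∀ d : H.Dart, c d = true → d.fst = u → d.snd = v := by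
    intro u
    by_cases h : ∃ d : H.Dart, c d = true ∧ d.fst = u
    · obtain ⟨d, hd, hdu⟩ := h
      exact ⟨d.snd, fun d' hd' hdu' => by
        rw [hfst d' d (hdu'.trans hdu.symm) (hd'.trans hd.symm)]⟩
    · exact ⟨u, fun d hd hdu => absurd ⟨d, hd, hdu⟩ h⟩
  choose f hf using hf
  let s : Set V := {u | ∃ d : H.Dart, c d = true ∧ d.fst = u}
  have hinj : Set.InjOn f s := by
    rintro u ⟨d, hd, rfl⟩ v ⟨d', hd', rfl⟩ h
    rw [← hf _ d hd rfl, ← hf _ d' hd' rfl] at h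
    rw [hsnd d d' h (hd.trans hd'.symm)]
  obtain ⟨π, hπ⟩ := Set.MapsTo.exists_equiv_extend_of_card_eq (t := Finset.univ)
    (by simp : Fintype.card V = (Finset.univ : Finset V).card) (s := s) (f := f)
    (by intro x _; simp) hinj
  let π' : Equiv.Perm V := π.trans (Equiv.subtypeUnivEquiv (by simp))
  have hπ' : ∀ d : H.Dart, c d = true → π' d.fst = d.snd := fun d hd => by
    rw [hf _ d hd rfl]
    exact hπ _ ⟨d, hd, rfl⟩
  refine ⟨π', fun u v huv => ?_⟩
  have h := hsymm ⟨(u, v), huv⟩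
  rcases hd : c ⟨(u, v), huv⟩ with _ | _
  · right
    rw [hd] at h
    exact hπ' _ (Bool.eq_true_of_not_eq_false h)
  · exact .inl (hπ' _ hd)

end MaxDegreeTwo

section Padding

/-- Disjoint four-element sets in `V`, completed to a partition of `Fin 4 × V` into
four-element sets. -/
lemma exists_equiv_prod_fin_four {V : Type} [Fintype V] [DecidableEq V] {q : ℕ}
    (Y : Fin q → Finset V) (hY : ∀ j, (Y j).card = 4)
    (hdisj : ∀ i j, i ≠ j → Disjoint (Y i) (Y j)) :
    ∃ (κ : Type) (_ : Fintype κ) (e : Fin 4 × V ≃ κ × Fin 4),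
      ∀ j, ∀ u ∈ Y j, ∀ v ∈ Y j, (e (0, u)).1 = (e (0, v)).1 := by
  classical
  let κ := (Fin q × Fin 4) ⊕ {v // ∀ j, v ∉ Y j}
  let y : ∀ j, Fin 4 ≃ Y j := fun j => ((Y j).equivFinOfCardEq (hY j)).symm
  let Ψ : κ × Fin 4 → Fin 4 × V := fun x =>
    Sum.elim (fun ji => (ji.2, (y ji.1 x.2 : V))) (fun u => (x.2, u.1)) x.1
  have hinj : Function.Injective Ψ := by
    rintro ⟨⟨j, i⟩ | ⟨u, hu⟩, a⟩ ⟨⟨j', i'⟩ | ⟨u', hu'⟩, a'⟩ h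
    · obtain ⟨rfl, h2⟩ : i = i' ∧ (y j a : V) = y j' a' := by simpa [Ψ] using h
      obtain rfl : j = j' := by
        by_contra hne
        exact Finset.disjoint_left.1 (hdisj j j' hne) (y j a).2 (h2 ▸ (y j' a').2)
      rw [(y j).injective (Subtype.ext h2)]
    · obtain ⟨-, rfl⟩ : i = a' ∧ (y j a : V) = u' := by simpa [Ψ] using h
      exact absurd (y j a).2 (hu' j)
    · obtain ⟨-, rfl⟩ : a = i' ∧ u = (y j' a' : V) := by simpa [Ψ] using h
      exact absurd (y j' a').2 (hu j')
    · obtain ⟨rfl, rfl⟩ : a = a' ∧ u = u' := by simpa [Ψ] using h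
      rfl
  have hmem : ∀ j i u (hu : u ∈ Y j), Ψ (.inl (j, i), (y j).symm ⟨u, hu⟩) = (i, u) := by
    intro j i u hu
    simp [Ψ]
  have hsurj : Function.Surjective Ψ := by
    rintro ⟨i, v⟩
    by_cases h : ∃ j, v ∈ Y j
    · obtain ⟨j, hj⟩ := h
      exact ⟨_, hmem j i v hj⟩
    · exact ⟨(.inr ⟨v, not_exists.1 h⟩, i), rfl⟩
  let e := (Equiv.ofBijective Ψ ⟨hinj, hsurj⟩).symm
  have he : ∀ j, ∀ u ∈ Y j, (e (0, u)).1 = .inl (j, 0) := by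
    intro j u hu
    have : e (0, u) = (.inl (j, 0), (y j).symm ⟨u, hu⟩) :=
      (Equiv.symm_apply_eq _).2 (hmem j 0 u hu).symm
    rw [this]
  exact ⟨κ, inferInstance, e, fun j u hu v hv => (he j u hu).trans (he j v hv).symm⟩

end Padding

theorem stmt_1 {V : Type} [Fintype V] [DecidableEq V]
    (H G : SimpleGraph V) [DecidableRel H.Adj]
    (hΔ : ∀ v, H.degree v ≤ 2)
    (hglue : GluedK4 H G) :
    ∃ Z : Finset V,
      (Z.card : ℚ) ≤ (Fintype.card V : ℚ) / 22 ∧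
      (G.induce ((↑Z : Set V)ᶜ)).chromaticNumber ≤ 4 := by
  classical
  obtain ⟨q, Y, hY, hdisj, hadj⟩ := hglue
  obtain ⟨π, hπ⟩ := exists_perm_of_degree_le_two H hΔ
  obtain ⟨κ, _, e, he⟩ := exists_equiv_prod_fin_four Y hY hdisj
  let σ : Equiv.Perm (Fin 4 × V) :=
    Equiv.prodShear (Equiv.refl _) fun i => if i = 0 then π else 1
  have hσ : ∀ v, σ (0, v) = (0, π v) := fun v => by simp [σ, Equiv.prodShear]
  have hσ' : ∀ i v, i ≠ 0 → σ (i, v) = (i, v) := fun i v hi => by simp [σ, Equiv.prodShear, hi]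
  obtain ⟨Z, col, hZ, hY', hπ'⟩ := exists_coloring_perm σ e
  have hmoved : (Finset.univ.filter fun w => σ w ≠ w).card ≤ Fintype.card V := by
    refine Finset.card_le_card_of_injOn Prod.snd (by simp) ?_
    have h0 : ∀ w, σ w ≠ w → w.1 = 0 := fun w hw => by
      by_contra h
      exact hw (hσ' _ _ h)
    intro w hw w' hw' h
    simp only [Finset.coe_filter, Finset.mem_univ, true_and, Set.mem_ofPred_eq] at hw hw'
    exact Prod.ext ((h0 w hw).trans (h0 w' hw').symm) h
  let Z' : Finset V := Finset.univ.filter fun v => (0, v) ∈ Z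
  have hZ' : Z'.card ≤ Z.card :=
    Finset.card_le_card_of_injOn (fun v => (0, v)) (by intro v; simp [Z'])
      (Prod.mk_right_injective 0).injOn
  refine ⟨Z', ?_, ?_⟩
  · rw [le_div_iff₀ (by norm_num)]
    have : Z'.card * 22 ≤ Fintype.card V := by omega
    exact_mod_cast this
  have hcolor : ∀ u v, u ∉ Z' → v ∉ Z' → G.Adj u v → col (0, u) ≠ col (0, v) := by
    intro u v hu hv huv
    have hu : (0, u) ∉ Z := by simpa [Z'] using hu
    have hv : (0, v) ∉ Z := by simpa [Z'] using hv
    have hne : ∀ {a b : V}, a ≠ b → ((0 : Fin 4), a) ≠ (0, b) := fun h h' => h (Prod.mk.inj h').2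
    rcases (hadj u v).1 huv with h | ⟨hne', j, huj, hvj⟩
    · rcases hπ u v h with rfl | rfl
      · rw [← hσ] at hv ⊢
        exact hπ' _ hu hv (by rw [hσ]; exact hne huv.ne')
      · rw [← hσ] at hu ⊢
        exact (hπ' _ hv hu (by rw [hσ]; exact hne huv.ne)).symm
    · exact hY' _ _ hu hv (he j u huj v hvj) (hne hne')
  have hcol : (G.induce ((↑Z' : Set V)ᶜ)).Colorable 4 :=
    ⟨Coloring.mk (fun v => col (0, v)) fun {u v} h =>
      hcolor u v (fun hu => u.2 hu) (fun hv => v.2 hv) h⟩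
  exact_mod_cast hcol.chromaticNumber_le
end
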